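/- For every integer n ≥ 345, the 3×3 determinant with rows (Δp(n+2), Δp(n+3), Δp(n+4)), (Δp(n+1), Δp(n+2), Δp(n+3)), (Δp(n), Δp(n+1), Δp(n+2)) is strictly positive. -/

import Mathlib

/-- The partition function: the number of partitions of `n`. -/
def partitionFn (n : ℕ) : ℕ := Fintype.card (Nat.Partition n)

/-- The first-order forward difference of the partition function, as an integer. -/
def dP (n : ℕ) : ℤ := (partitionFn (n + 1) : ℤ) - partitionFn n

section GeneratingFunction

open Filter Topology

/-- The power series `∏ i < K, ∑ j, X ^ ((i + 1) * j)`, whose coefficients count the partitions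
into parts of size at most `K`. -/
noncomputable def boundedPartSeries (K : ℕ) : PowerSeries ℝ :=
  ∏ i ∈ Finset.range K, PowerSeries.mk fun n ↦ if i + 1 ∣ n then 1 else 0

open scoped PowerSeries.WithPiTopology in
lemma one_add_tsum_X_pow_mul {R : Type*} [CommRing R] [TopologicalSpace R] [DiscreteTopology R]
    (i : ℕ) :
    (1 + ∑' j, (1 : R) • (PowerSeries.X : PowerSeries R) ^ ((i + 1) * (j + 1))) =
      PowerSeries.mk fun n ↦ if i + 1 ∣ n then 1 else 0 := by
  have hs := Nat.Partition.summable_genFun_term (R := R) (fun _ _ ↦ 1) i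
  ext n
  have := (hs.hasSum.map (PowerSeries.coeff (R := R) n)
    (PowerSeries.WithPiTopology.continuous_coeff R n)).tsum_eq
  rw [map_add, ← this, PowerSeries.coeff_mk]
  simp only [Function.comp_def, one_smul, PowerSeries.coeff_X_pow, PowerSeries.coeff_one]
  rcases Nat.eq_zero_or_pos n with rfl | hn
  · simp
  · by_cases h : i + 1 ∣ n
    · obtain ⟨c, rfl⟩ := h
      obtain ⟨c, rfl⟩ := Nat.exists_eq_add_one_of_ne_zero (n := c) (by rintro rfl; simp at hn)
      rw [tsum_eq_single c]
      · simp
      · intro b hb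
        simp [Ne.symm hb]
    · rw [if_neg h, if_neg hn.ne', zero_add]
      convert tsum_zero with b
      rw [if_neg]
      rintro rfl
      exact h ⟨_, rfl⟩

open scoped PowerSeries.WithPiTopology in
lemma eventually_coeff_boundedPartSeries (n : ℕ) :
    ∀ᶠ K in atTop, (boundedPartSeries K).coeff n = partitionFn n := by
  let _ : TopologicalSpace ℝ := ⊥
  have : DiscreteTopology ℝ := ⟨rfl⟩
  have h := Nat.Partition.hasProd_genFun (R := ℝ) (fun _ _ ↦ 1)
  simp_rw [one_add_tsum_X_pow_mul] at h
  have h2 := (PowerSeries.WithPiTopology.tendsto_iff_coeff_tendsto ℝ _ _ _).mp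
    h.tendsto_prod_nat n
  rw [nhds_discrete, tendsto_pure] at h2
  filter_upwards [h2] with K hK
  rw [boundedPartSeries, hK]
  simp [partitionFn, Finsupp.prod]

lemma coeff_boundedPartSeries_mono (n : ℕ) :
    Monotone fun K ↦ (boundedPartSeries K).coeff n := by
  have hnn : ∀ K n, 0 ≤ (boundedPartSeries K).coeff n := by
    intro K
    induction K with
    | zero => intro n; simp [boundedPartSeries, PowerSeries.coeff_one]; split_ifs <;> simp
    | succ K ih =>
      intro n
      rw [boundedPartSeries, Finset.prod_range_succ, PowerSeries.coeff_mul]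
      refine Finset.sum_nonneg fun x _ ↦ mul_nonneg (ih _) ?_
      rw [PowerSeries.coeff_mk]; split_ifs <;> simp
  refine monotone_nat_of_le_succ fun K ↦ ?_
  rw [boundedPartSeries, boundedPartSeries, Finset.prod_range_succ, ← boundedPartSeries,
    PowerSeries.coeff_mul]
  refine le_trans (le_of_eq ?_) (Finset.single_le_sum (f := fun p : ℕ × ℕ ↦
    (boundedPartSeries K).coeff p.1 * PowerSeries.coeff p.2
      (PowerSeries.mk fun n ↦ if K + 1 ∣ n then (1 : ℝ) else 0)) (fun x _ ↦ mul_nonneg (hnn _ _) ?_)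
    (show (n, 0) ∈ Finset.HasAntidiagonal.antidiagonal n by simp))
  · simp
  · rw [PowerSeries.coeff_mk]; split_ifs <;> simp

lemma coeff_boundedPartSeries_le (K n : ℕ) :
    (boundedPartSeries K).coeff n ≤ partitionFn n := by
  obtain ⟨L, hL⟩ := (eventually_atTop.mp (eventually_coeff_boundedPartSeries n))
  rw [← hL (max K L) (le_max_right _ _)]
  exact coeff_boundedPartSeries_mono n (le_max_left _ _)

lemma coeff_boundedPartSeries_nonneg (K n : ℕ) : 0 ≤ (boundedPartSeries K).coeff n := by
  refine le_trans ?_ (coeff_boundedPartSeries_mono n (Nat.zero_le K))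
  simp [boundedPartSeries, PowerSeries.coeff_one]; split_ifs <;> simp

lemma hasSum_boundedPartSeries {q : ℂ} (hq : ‖q‖ < 1) (K : ℕ) :
    (Summable fun n ↦ ‖((boundedPartSeries K).coeff n : ℂ) * q ^ n‖) ∧
    ∑' n, ((boundedPartSeries K).coeff n : ℂ) * q ^ n =
      (∏ i ∈ Finset.range K, (1 - q ^ (i + 1)))⁻¹ := by
  induction K with
  | zero =>
    have : ∀ n, ((boundedPartSeries 0).coeff n : ℂ) * q ^ n = if n = 0 then 1 else 0 := by
      intro n
      by_cases h : n = 0 <;> simp [boundedPartSeries, PowerSeries.coeff_one, h]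
    rw [funext this]
    refine ⟨?_, by simp⟩
    have h' : ∀ n, ‖((boundedPartSeries 0).coeff n : ℂ) * q ^ n‖ = if n = 0 then 1 else 0 := by
      intro n
      rw [this]; split_ifs <;> simp
    rw [funext h']
    exact summable_of_ne_finset_zero (s := {0}) (by simp +contextual)
  | succ K ih =>
    let g : ℕ → ℂ := fun n ↦ (if K + 1 ∣ n then 1 else 0) * q ^ n
    have hqK : ‖q ^ (K + 1)‖ < 1 := by
      rw [norm_pow]; exact pow_lt_one₀ (norm_nonneg _) hq (by simp)
    have hgi : Function.Injective fun j : ℕ ↦ (K + 1) * j := fun a b h ↦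
      Nat.eq_of_mul_eq_mul_left K.succ_pos h
    have hg1 : HasSum g (1 - q ^ (K + 1))⁻¹ := by
      rw [← hgi.hasSum_iff]
      · have : g ∘ (fun j : ℕ ↦ (K + 1) * j) = fun j ↦ (q ^ (K + 1)) ^ j := by
          funext j
          rw [← pow_mul]
          simp [g]
        rw [this]
        exact hasSum_geometric_of_norm_lt_one hqK
      · intro n hn
        have : ¬ (K + 1 ∣ n) := fun ⟨c, hc⟩ ↦ hn ⟨c, hc.symm⟩
        simp [g, this]
    have hg2 : Summable fun n ↦ ‖g n‖ := by
      refine Summable.of_nonneg_of_le (fun _ ↦ norm_nonneg _) (fun n ↦ ?_)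
        (summable_geometric_of_lt_one (norm_nonneg q) hq)
      simp only [g]
      split_ifs <;> simp
    have key : ∀ n, ((boundedPartSeries (K + 1)).coeff n : ℂ) * q ^ n =
        ∑ kl ∈ Finset.HasAntidiagonal.antidiagonal n,
          (((boundedPartSeries K).coeff kl.1 : ℂ) * q ^ kl.1) * g kl.2 := by
      intro n
      rw [boundedPartSeries, Finset.prod_range_succ, ← boundedPartSeries, PowerSeries.coeff_mul]
      push_cast
      rw [Finset.sum_mul]
      refine Finset.sum_congr rfl fun x hx ↦ ?_
      rw [PowerSeries.coeff_mk, ← Finset.HasAntidiagonal.mem_antidiagonal.mp hx, pow_add]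
      by_cases h : K + 1 ∣ x.2
      · simp only [g, h, if_true]; push_cast; ring
      · simp [g, h]
    have h1 := summable_norm_sum_mul_antidiagonal_of_summable_norm ih.1 hg2
    have h2 := tsum_mul_tsum_eq_tsum_sum_antidiagonal_of_summable_norm ih.1 hg2
    refine ⟨h1.congr fun n ↦ (congrArg norm (key n)).symm, ?_⟩
    rw [tsum_congr key, ← h2, ih.2, hg1.tsum_eq, Finset.prod_range_succ, mul_inv]

/-- The function `∏ (1 - q ^ (n + 1))⁻¹`. -/
noncomputable def eulerInv (q : ℂ) : ℂ := (∏' n : ℕ, (1 - q ^ (n + 1)))⁻¹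

lemma tprod_one_sub_pow_ne_zero {q : ℂ} (hq : ‖q‖ < 1) : ∏' n : ℕ, (1 - q ^ (n + 1)) ≠ 0 := by
  have := tprod_one_add_ne_zero_of_summable (f := fun n : ℕ ↦ -q ^ (n + 1)) ?_ ?_
  · simpa [sub_eq_add_neg] using this
  · intro i h
    have h1 : q ^ (i + 1) = 1 := by linear_combination -h
    have h2 : ‖q ^ (i + 1)‖ < 1 := by
      rw [norm_pow]; exact pow_lt_one₀ (norm_nonneg _) hq (by simp)
    rw [h1] at h2
    simp at h2
  · simpa using (summable_nat_add_iff 1).mpr (summable_geometric_of_lt_one (norm_nonneg _) hq)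

lemma tendsto_prod_eulerInv {q : ℂ} (hq : ‖q‖ < 1) :
    Tendsto (fun K ↦ (∏ i ∈ Finset.range K, (1 - q ^ (i + 1)))⁻¹) atTop (𝓝 (eulerInv q)) :=
  (ModularForm.multipliable_one_sub_pow hq).hasProd.tendsto_prod_nat.inv₀
    (tprod_one_sub_pow_ne_zero hq)

lemma summable_partitionFn {r : ℝ} (h0 : 0 ≤ r) (h1 : r < 1) :
    Summable fun n ↦ (partitionFn n : ℝ) * r ^ n := by
  have hq : ‖(r : ℂ)‖ < 1 := by simpa [abs_of_nonneg h0] using h1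
  obtain ⟨B, hB⟩ := (tendsto_prod_eulerInv hq).norm.bddAbove_range
  refine summable_of_sum_range_le (c := B) (fun n ↦ by positivity) fun M ↦ ?_
  have hev : ∀ᶠ K in atTop, ∀ n ∈ Finset.range M,
      (boundedPartSeries K).coeff n = partitionFn n :=
    (Finset.eventually_all _).mpr fun n _ ↦ eventually_coeff_boundedPartSeries n
  obtain ⟨K, hK⟩ := hev.exists
  have hs := hasSum_boundedPartSeries hq K
  have e : ∀ n, ‖((boundedPartSeries K).coeff n : ℂ) * (r : ℂ) ^ n‖ =
      (boundedPartSeries K).coeff n * r ^ n := by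
    intro n
    simp [abs_of_nonneg h0, abs_of_nonneg (coeff_boundedPartSeries_nonneg K n)]
  have hs1 := hs.1
  simp_rw [e] at hs1
  calc ∑ n ∈ Finset.range M, (partitionFn n : ℝ) * r ^ n
      = ∑ n ∈ Finset.range M, (boundedPartSeries K).coeff n * r ^ n :=
        Finset.sum_congr rfl fun n hn ↦ by rw [hK n hn]
    _ ≤ ∑' n, (boundedPartSeries K).coeff n * r ^ n :=
        hs1.sum_le_tsum _ fun n _ ↦
          mul_nonneg (coeff_boundedPartSeries_nonneg K n) (pow_nonneg h0 _)
    _ ≤ ‖∑' n, ((boundedPartSeries K).coeff n : ℂ) * (r : ℂ) ^ n‖ := by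
        have : ∑' n, ((boundedPartSeries K).coeff n : ℂ) * (r : ℂ) ^ n =
            ((∑' n, (boundedPartSeries K).coeff n * r ^ n : ℝ) : ℂ) := by push_cast; rfl
        rw [this, Complex.norm_real]
        exact le_abs_self _
    _ ≤ B := by
        rw [hs.2]
        exact hB ⟨K, rfl⟩

lemma summable_norm_partitionFn {q : ℂ} (hq : ‖q‖ < 1) :
    Summable fun n ↦ ‖(partitionFn n : ℂ) * q ^ n‖ := by
  simpa using summable_partitionFn (norm_nonneg q) hq

/-- Euler's generating function of the partition numbers. -/
lemma hasSum_partitionFn {q : ℂ} (hq : ‖q‖ < 1) :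
    HasSum (fun n ↦ (partitionFn n : ℂ) * q ^ n) (eulerInv q) := by
  have hsum := summable_norm_partitionFn hq
  have h1 : Tendsto (fun K ↦ ∑' n, ((boundedPartSeries K).coeff n : ℂ) * q ^ n) atTop
      (𝓝 (∑' n, (partitionFn n : ℂ) * q ^ n)) := by
    refine tendsto_tsum_of_dominated_convergence hsum (fun n ↦ ?_) (Eventually.of_forall ?_)
    · refine tendsto_const_nhds.congr' ?_
      filter_upwards [eventually_coeff_boundedPartSeries n] with K hK
      rw [hK]; simp
    · intro K n
      simp only [norm_mul, Complex.norm_real, Real.norm_eq_abs,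
        abs_of_nonneg (coeff_boundedPartSeries_nonneg K n), Complex.norm_natCast]
      exact mul_le_mul_of_nonneg_right (coeff_boundedPartSeries_le K n) (norm_nonneg _)
  simp_rw [(hasSum_boundedPartSeries hq _).2] at h1
  rw [tendsto_nhds_unique (tendsto_prod_eulerInv hq) h1]
  exact hsum.of_norm.hasSum

end GeneratingFunction

section Modularity

open Filter Topology

open Complex in
lemma csqrt_I_mul {s : ℂ} (hs : 0 < s.re) : sqrt (I * s) = sqrt I * sqrt s := by
  have hs0 : s ≠ 0 := fun h ↦ by simp [h] at hs
  rw [sqrt_eq_exp (mul_ne_zero I_ne_zero hs0), sqrt_eq_exp I_ne_zero, sqrt_eq_exp hs0,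
    ← Complex.exp_add, log_mul I_ne_zero hs0, add_div]
  have := abs_lt.mp (abs_arg_lt_pi_div_two_iff.mpr (Or.inl hs))
  rw [arg_I]
  constructor <;> linarith [Real.pi_pos]

open Complex ModularForm in
lemma eta_I_mul {s : ℂ} :
    ModularForm.eta (I * (s / (2 * Real.pi))) = exp (-s / 24) * (eulerInv (exp (-s)))⁻¹ := by
  have hpi : (Real.pi : ℂ) ≠ 0 := by exact_mod_cast Real.pi_ne_zero
  rw [ModularForm.eta, eulerInv, inv_inv]
  congr 1
  · rw [Function.Periodic.qParam]
    congr 1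
    push_cast
    field_simp
    rw [I_sq]; ring
  · refine tprod_congr fun n ↦ ?_
    rw [eta_q_eq_cexp, ← exp_nat_mul]
    congr 2
    push_cast
    field_simp
    rw [I_sq]; ring

lemma norm_cexp_neg_lt_one {s : ℂ} (hs : 0 < s.re) : ‖Complex.exp (-s)‖ < 1 := by
  rw [Complex.norm_exp]; simpa using hs

lemma eulerInv_ne_zero {q : ℂ} (hq : ‖q‖ < 1) : eulerInv q ≠ 0 :=
  inv_ne_zero (tprod_one_sub_pow_ne_zero hq)

lemma re_div_pos {s : ℂ} (hs : 0 < s.re) {c : ℝ} (hc : 0 < c) : 0 < ((c : ℂ) / s).re := by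
  have hs0 : s ≠ 0 := fun h ↦ by simp [h] at hs
  rw [div_eq_mul_inv, Complex.re_ofReal_mul, Complex.inv_re]
  have := Complex.normSq_pos.mpr hs0
  positivity

open Complex ModularForm in
/-- The transformation law of Euler's generating function under `s ↦ 4 * π ^ 2 / s`. -/
lemma eulerInv_modular {s : ℂ} (hs : 0 < s.re) :
    eulerInv (exp (-s)) = sqrt (s / (2 * Real.pi)) *
      exp (-s / 24 + (Real.pi : ℂ) ^ 2 / (6 * s)) *
      eulerInv (exp (-(4 * (Real.pi : ℂ) ^ 2 / s))) := by
  have hpi : (Real.pi : ℂ) ≠ 0 := by exact_mod_cast Real.pi_ne_zero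
  have hs0 : s ≠ 0 := fun h ↦ by simp [h] at hs
  have hs' : 0 < (s / (2 * Real.pi)).re := by
    have : s / (2 * Real.pi) = ((1 / (2 * Real.pi) : ℝ) : ℂ) * s := by push_cast; ring
    rw [this, re_ofReal_mul]
    have := Real.pi_pos
    positivity
  have hs2 : 0 < (4 * (Real.pi : ℂ) ^ 2 / s).re := by
    have := re_div_pos hs (c := 4 * Real.pi ^ 2) (by have := Real.pi_pos; positivity)
    push_cast at this
    exact this
  have h := eta_comp_eq_csqrt_I_inv (x := I * (s / (2 * Real.pi))) (by simpa using hs')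
  have e1 : (-1 / (I * (s / (2 * Real.pi))) : ℂ) =
      I * ((4 * (Real.pi : ℂ) ^ 2 / s) / (2 * Real.pi)) := by
    field_simp
    rw [I_sq]; ring
  simp only [Function.comp_apply, Pi.smul_apply, Pi.mul_apply, smul_eq_mul] at h
  rw [e1, eta_I_mul, eta_I_mul, csqrt_I_mul hs'] at h
  have hI : sqrt I ≠ 0 := by rw [sqrt_eq_exp I_ne_zero]; exact exp_ne_zero _
  rw [mul_assoc (sqrt I), inv_mul_cancel_left₀ hI] at h
  have hE1 := eulerInv_ne_zero (norm_cexp_neg_lt_one hs)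
  have hE2 := eulerInv_ne_zero (norm_cexp_neg_lt_one hs2)
  have e2 : exp (-s / 24 + (Real.pi : ℂ) ^ 2 / (6 * s)) =
      exp (-s / 24) * (exp (-(4 * (Real.pi : ℂ) ^ 2 / s) / 24))⁻¹ := by
    rw [← exp_neg, ← exp_add]
    congr 2
    field_simp; ring
  rw [e2]
  have hx := exp_ne_zero (-(4 * (Real.pi : ℂ) ^ 2 / s) / 24)
  generalize exp (-(4 * (Real.pi : ℂ) ^ 2 / s) / 24) = A at *
  generalize eulerInv (exp (-(4 * (Real.pi : ℂ) ^ 2 / s))) = B at *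
  generalize eulerInv (exp (-s)) = C at *
  generalize sqrt (s / (2 * Real.pi)) = D at *
  generalize exp (-s / 24) = F at *
  field_simp
  field_simp at h
  linear_combination h

end Modularity

section NormBounds

open Filter Topology

open Complex in
lemma one_sub_norm_mul_exp_le {w : ℂ} (hw : ‖w‖ < 1) :
    ‖1 - w‖⁻¹ ≤ (1 - ‖w‖)⁻¹ * Real.exp (w.re - ‖w‖) := by
  have h1 := Complex.hasSum_re (hasSum_taylorSeries_neg_log hw)
  have h2 := Complex.hasSum_re (hasSum_taylorSeries_neg_log
    (z := ((‖w‖ : ℝ) : ℂ)) (by simpa using hw))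
  have h3 := h2.sub h1
  have hle : ‖w‖ - w.re ≤ Real.log ‖1 - w‖ - Real.log (1 - ‖w‖) := by
    refine (le_of_eq ?_).trans ((le_hasSum h3 1 fun j _ ↦ ?_).trans (le_of_eq ?_))
    · simp
    · rw [sub_nonneg]
      refine (re_le_norm _).trans (le_of_eq ?_)
      rw [norm_div, norm_pow, ← ofReal_pow, Complex.norm_natCast, ← ofReal_natCast, ← ofReal_div,
        ofReal_re]
    · rw [neg_re, neg_re, log_re, log_re, ← ofReal_one, ← ofReal_sub, norm_real,
        Real.norm_of_nonneg (by linarith)]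
      ring
  have hp : 0 < 1 - ‖w‖ := by linarith
  have hp2 : 0 < ‖1 - w‖ := by
    rw [norm_pos_iff]
    rintro h
    have : w = 1 := by linear_combination -h
    simp [this] at hw
  rw [← Real.exp_log (inv_pos.mpr hp2), ← Real.exp_log (inv_pos.mpr hp), ← Real.exp_add,
    Real.log_inv, Real.log_inv]
  exact Real.exp_le_exp.mpr (by linarith)

lemma norm_pow_succ_lt_one {q : ℂ} (hq : ‖q‖ < 1) (k : ℕ) : ‖q ^ (k + 1)‖ < 1 := by
  rw [norm_pow]; exact pow_lt_one₀ (norm_nonneg _) hq (by simp)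

lemma hasSum_pow_succ {q : ℂ} (hq : ‖q‖ < 1) : HasSum (fun n : ℕ ↦ q ^ (n + 1)) (q / (1 - q)) := by
  simpa [pow_succ', div_eq_mul_inv] using (hasSum_geometric_of_norm_lt_one hq).mul_left q

lemma hasSum_pow_succ_real {r : ℝ} (h0 : 0 ≤ r) (h1 : r < 1) :
    HasSum (fun n : ℕ ↦ r ^ (n + 1)) (r / (1 - r)) := by
  simpa [pow_succ', div_eq_mul_inv] using (hasSum_geometric_of_lt_one h0 h1).mul_left r

/-- Comparison of Euler's product at `q` with its value at `‖q‖`. -/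
lemma norm_eulerInv_le {q : ℂ} (hq : ‖q‖ < 1) :
    ‖eulerInv q‖ ≤ ‖eulerInv (‖q‖ : ℂ)‖ * Real.exp ((q / (1 - q)).re - ‖q‖ / (1 - ‖q‖)) := by
  have hq' : ‖((‖q‖ : ℝ) : ℂ)‖ < 1 := by simpa using hq
  have l1 := (tendsto_prod_eulerInv hq).norm
  have l2 := (tendsto_prod_eulerInv hq').norm
  have l3 := ((Complex.hasSum_re (hasSum_pow_succ hq)).sub
    (hasSum_pow_succ_real (norm_nonneg q) hq)).tendsto_sum_nat
  refine le_of_tendsto_of_tendsto' l1 (l2.mul ((Real.continuous_exp.tendsto _).comp l3)) fun K ↦ ?_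
  simp only [Function.comp_apply]
  rw [Real.exp_sum, norm_inv, norm_inv, norm_prod, norm_prod, ← Finset.prod_inv_distrib,
    ← Finset.prod_inv_distrib, ← Finset.prod_mul_distrib]
  refine Finset.prod_le_prod (fun i _ ↦ by positivity) fun i _ ↦ ?_
  have h := one_sub_norm_mul_exp_le (norm_pow_succ_lt_one hq i)
  have e : ‖1 - ((‖q‖ : ℝ) : ℂ) ^ (i + 1)‖ = 1 - ‖q ^ (i + 1)‖ := by
    rw [norm_pow, ← Complex.ofReal_pow, ← Complex.ofReal_one, ← Complex.ofReal_sub,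
      Complex.norm_real, Real.norm_of_nonneg]
    have := norm_pow_succ_lt_one hq i
    rw [norm_pow] at this
    linarith
  rw [e]
  simpa using h

lemma partitionFn_zero : partitionFn 0 = 1 := by simp [partitionFn]

lemma one_sub_sum_le_prod_one_sub {f : ℕ → ℝ} (h0 : ∀ i, 0 ≤ f i) (h1 : ∀ i, f i ≤ 1) (K : ℕ) :
    1 - ∑ i ∈ Finset.range K, f i ≤ ∏ i ∈ Finset.range K, (1 - f i) := by
  induction K with
  | zero => simp
  | succ K ih =>
    rw [Finset.sum_range_succ, Finset.prod_range_succ]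
    have hs : 0 ≤ ∑ i ∈ Finset.range K, f i := Finset.sum_nonneg fun i _ ↦ h0 i
    nlinarith [h0 K, h1 K, mul_le_mul_of_nonneg_right ih (sub_nonneg.mpr (h1 K)),
      mul_nonneg hs (h0 K)]

lemma norm_eulerInv_quarter_le : ‖eulerInv ((1 / 4 : ℝ) : ℂ)‖ ≤ 3 / 2 := by
  have hq : ‖((1 / 4 : ℝ) : ℂ)‖ < 1 := by rw [Complex.norm_real]; norm_num
  refine le_of_tendsto' (tendsto_prod_eulerInv hq).norm fun K ↦ ?_
  have h1 : (2 / 3 : ℝ) ≤ ∏ i ∈ Finset.range K, (1 - (1 / 4 : ℝ) ^ (i + 1)) := by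
    have h2 := one_sub_sum_le_prod_one_sub (f := fun i : ℕ ↦ (1 / 4 : ℝ) ^ (i + 1))
      (fun i ↦ by positivity) (fun i ↦ pow_le_one₀ (by norm_num) (by norm_num)) K
    have h3 : ∑ i ∈ Finset.range K, (1 / 4 : ℝ) ^ (i + 1) ≤ (1 / 4) / (1 - 1 / 4) :=
      sum_le_hasSum _ (fun i _ ↦ by positivity) (hasSum_pow_succ_real (by norm_num) (by norm_num))
    norm_num at h3 h2 ⊢
    linarith
  have e : (∏ i ∈ Finset.range K, (1 - ((1 / 4 : ℝ) : ℂ) ^ (i + 1))) =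
      ((∏ i ∈ Finset.range K, (1 - (1 / 4 : ℝ) ^ (i + 1)) : ℝ) : ℂ) := by push_cast; rfl
  rw [e, norm_inv, Complex.norm_real, Real.norm_of_nonneg (by linarith)]
  rw [show (3 / 2 : ℝ) = (2 / 3)⁻¹ by norm_num]
  exact inv_anti₀ (by norm_num) h1

lemma norm_eulerInv_sub_one_le {q : ℂ} (hq : ‖q‖ ≤ 1 / 4) : ‖eulerInv q - 1‖ ≤ 2 * ‖q‖ := by
  have hq4 : ‖((1 / 4 : ℝ) : ℂ)‖ < 1 := by rw [Complex.norm_real]; norm_num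
  have hs := hasSum_partitionFn (q := q) (by linarith)
  have h4 := hasSum_partitionFn hq4
  have h4' : HasSum (fun n ↦ (partitionFn n : ℝ) * (1 / 4) ^ n) (eulerInv ((1 / 4 : ℝ) : ℂ)).re := by
    convert Complex.hasSum_re h4 using 2 with n
    rw [← Complex.ofReal_pow, ← Complex.ofReal_natCast, ← Complex.ofReal_mul, Complex.ofReal_re]
  have h5 := (hasSum_nat_add_iff' 1).mpr hs
  have h6 := ((hasSum_nat_add_iff' 1).mpr h4').mul_left (4 * ‖q‖)
  simp only [Finset.range_one, Finset.sum_singleton, partitionFn_zero, pow_zero, Nat.cast_one,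
    mul_one] at h5 h6
  have h7 : (eulerInv ((1 / 4 : ℝ) : ℂ)).re ≤ 3 / 2 :=
    (Complex.re_le_norm _).trans norm_eulerInv_quarter_le
  refine (h5.norm_le_of_bounded h6 fun n ↦ ?_).trans ?_
  · rw [norm_mul, norm_pow, Complex.norm_natCast, pow_succ, pow_succ]
    have : ‖q‖ ^ n ≤ (1 / 4) ^ n := pow_le_pow_left₀ (norm_nonneg _) hq n
    calc (partitionFn (n + 1) : ℝ) * (‖q‖ ^ n * ‖q‖) ≤ partitionFn (n + 1) * ((1 / 4) ^ n * ‖q‖) := by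
          gcongr
      _ = _ := by ring
  · nlinarith [norm_nonneg q]

lemma norm_eulerInv_le_three_halves {q : ℂ} (hq : ‖q‖ ≤ 1 / 4) : ‖eulerInv q‖ ≤ 3 / 2 := by
  have h := norm_eulerInv_sub_one_le hq
  calc ‖eulerInv q‖ = ‖(eulerInv q - 1) + 1‖ := by ring_nf
    _ ≤ ‖eulerInv q - 1‖ + ‖(1 : ℂ)‖ := norm_add_le _ _
    _ ≤ 3 / 2 := by rw [norm_one]; linarith

end NormBounds

section CircleMethod

open Filter Topology

/-- The point of the vertical line of real part `σ` with imaginary part `2 * π * x`. -/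
noncomputable def lineAt (σ x : ℝ) : ℂ := σ + 2 * Real.pi * x * Complex.I

lemma lineAt_re (σ x : ℝ) : (lineAt σ x).re = σ := by simp [lineAt]

lemma lineAt_im (σ x : ℝ) : (lineAt σ x).im = 2 * Real.pi * x := by simp [lineAt]

lemma continuous_lineAt (σ : ℝ) : Continuous (lineAt σ) := by
  unfold lineAt; fun_prop

lemma norm_cexp_neg_lineAt (σ x : ℝ) : ‖Complex.exp (-lineAt σ x)‖ = Real.exp (-σ) := by
  rw [Complex.norm_exp, Complex.neg_re, lineAt_re]

lemma integral_cexp_int_mul (k : ℤ) :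
    ∫ x in (-(1 / 2) : ℝ)..(1 / 2), Complex.exp (2 * Real.pi * k * Complex.I * x) =
      if k = 0 then 1 else 0 := by
  split_ifs with h
  · simp [h]; norm_num
  · have hc : (2 * Real.pi * k * Complex.I : ℂ) ≠ 0 := by
      have : (Real.pi : ℂ) ≠ 0 := by exact_mod_cast Real.pi_ne_zero
      have : (k : ℂ) ≠ 0 := by exact_mod_cast h
      simp_all [Complex.I_ne_zero]
    rw [integral_exp_mul_complex hc, div_eq_zero_iff]
    left
    rw [sub_eq_zero, Complex.exp_eq_exp_iff_exists_int]
    exact ⟨k, by push_cast; ring⟩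

/-- Cauchy's formula for the partition numbers. -/
lemma partitionFn_eq_integral {σ : ℝ} (hσ : 0 < σ) (n : ℕ) :
    (partitionFn n : ℂ) = ∫ x in (-(1 / 2) : ℝ)..(1 / 2),
      eulerInv (Complex.exp (-lineAt σ x)) * Complex.exp (n * lineAt σ x) := by
  have hr : Real.exp (-σ) < 1 := by simpa using hσ
  have h := intervalIntegral.hasSum_integral_of_dominated_convergence
    (μ := MeasureTheory.volume) (a := -(1 / 2)) (b := 1 / 2)
    (F := fun (m : ℕ) (x : ℝ) ↦ (partitionFn m : ℂ) * Complex.exp (-lineAt σ x) ^ m *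
      Complex.exp (n * lineAt σ x))
    (f := fun x ↦ eulerInv (Complex.exp (-lineAt σ x)) * Complex.exp (n * lineAt σ x))
    (fun m _ ↦ (partitionFn m : ℝ) * Real.exp (-σ) ^ m * Real.exp (n * σ)) ?_ ?_ ?_ ?_ ?_
  · refine HasSum.unique ?_ h
    have e : ∀ m : ℕ, (∫ x in (-(1 / 2) : ℝ)..(1 / 2), (partitionFn m : ℂ) *
        Complex.exp (-lineAt σ x) ^ m * Complex.exp (n * lineAt σ x)) =
        if m = n then (partitionFn n : ℂ) else 0 := by
      intro m
      have e1 : ∀ x : ℝ, (partitionFn m : ℂ) *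
        Complex.exp (-lineAt σ x) ^ m * Complex.exp (n * lineAt σ x) =
        (partitionFn m * Complex.exp ((n - m : ℂ) * σ)) *
          Complex.exp (2 * Real.pi * ((n - m : ℤ) : ℂ) * Complex.I * x) := by
        intro x
        rw [← Complex.exp_nat_mul, mul_assoc, mul_assoc, ← Complex.exp_add, ← Complex.exp_add]
        congr 2
        rw [lineAt]
        push_cast
        ring
      simp_rw [e1]
      rw [intervalIntegral.integral_const_mul, integral_cexp_int_mul]
      rcases eq_or_ne m n with rfl | hmn
      · simp
      · have : ((n : ℤ) - m) ≠ 0 := by omega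
        simp [this, hmn]
    rw [funext e]
    simpa using hasSum_ite_eq n (partitionFn n : ℂ)
  · intro m
    have := continuous_lineAt σ
    exact (by fun_prop : Continuous _).aestronglyMeasurable
  · intro m
    refine Eventually.of_forall fun x _ ↦ ?_
    rw [norm_mul, norm_mul, norm_pow, norm_cexp_neg_lineAt, Complex.norm_natCast,
      Complex.norm_exp]
    simp [lineAt_re]
  · exact Eventually.of_forall fun x _ ↦
      (summable_partitionFn (Real.exp_pos _).le hr).mul_right _
  · simp
  · refine Eventually.of_forall fun x _ ↦ ?_
    exact (hasSum_partitionFn (by rw [norm_cexp_neg_lineAt]; exact hr)).mul_right _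

end CircleMethod

section Laplace

open Filter Topology MeasureTheory Set

lemma sinh_le_mul_cosh {x : ℝ} (hx : 0 ≤ x) : Real.sinh x ≤ x * Real.cosh x := by
  have h : MonotoneOn (fun x : ℝ ↦ x * Real.cosh x - Real.sinh x) (Ici 0) := by
    refine monotoneOn_of_deriv_nonneg (convex_Ici 0) (by fun_prop) (by fun_prop) fun y hy ↦ ?_
    rw [interior_Ici] at hy
    have : HasDerivAt (fun x : ℝ ↦ x * Real.cosh x - Real.sinh x)
        (1 * Real.cosh y + y * Real.sinh y - Real.cosh y) y :=
      ((hasDerivAt_id y).mul (Real.hasDerivAt_cosh y)).sub (Real.hasDerivAt_sinh y)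
    rw [this.deriv]
    have := Real.sinh_nonneg_iff.mpr (le_of_lt hy)
    have := mul_nonneg (le_of_lt hy) this
    linarith
  simpa using h (mem_Ici.mpr le_rfl) (mem_Ici.mpr hx) hx

lemma cosh_sub_one_le_mul_sinh {x : ℝ} (hx : 0 ≤ x) : Real.cosh x - 1 ≤ x * Real.sinh x := by
  have h : MonotoneOn (fun x : ℝ ↦ x * Real.sinh x - Real.cosh x) (Ici 0) := by
    refine monotoneOn_of_deriv_nonneg (convex_Ici 0) (by fun_prop) (by fun_prop) fun y hy ↦ ?_
    rw [interior_Ici] at hy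
    have : HasDerivAt (fun x : ℝ ↦ x * Real.sinh x - Real.cosh x)
        (1 * Real.sinh y + y * Real.cosh y - Real.sinh y) y :=
      ((hasDerivAt_id y).mul (Real.hasDerivAt_sinh y)).sub (Real.hasDerivAt_cosh y)
    rw [this.deriv]
    have := mul_nonneg (le_of_lt hy) (Real.cosh_pos y).le
    linarith
  have := h (mem_Ici.mpr le_rfl) (mem_Ici.mpr hx) hx
  simp at this
  linarith

lemma mul_sinh_le_sq_mul_cosh {x : ℝ} (hx : 0 ≤ x) : x * Real.sinh x ≤ x ^ 2 * Real.cosh x := by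
  nlinarith [sinh_le_mul_cosh hx]

lemma cosh_le_exp {x : ℝ} (hx : 0 ≤ x) : Real.cosh x ≤ Real.exp x := by
  rw [Real.cosh_eq]
  have : Real.exp (-x) ≤ Real.exp x := Real.exp_le_exp.mpr (by linarith)
  linarith

/-- The function `(cosh (b * u) - 1 - (b * u) ^ 2 / 2) / u`. -/
noncomputable def coshQuot (b u : ℝ) : ℝ := (Real.cosh (b * u) - 1 - (b * u) ^ 2 / 2) / u

/-- The derivative of `coshQuot b`. -/
noncomputable def coshQuotDeriv (b u : ℝ) : ℝ :=
  (b * u * Real.sinh (b * u) - Real.cosh (b * u) + 1 - (b * u) ^ 2 / 2) / u ^ 2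

lemma hasDerivAt_coshQuot (b : ℝ) {u : ℝ} (hu : u ≠ 0) :
    HasDerivAt (coshQuot b) (coshQuotDeriv b u) u := by
  have h1 : HasDerivAt (fun u ↦ b * u) b u := by simpa using (hasDerivAt_id u).const_mul b
  have h2 : HasDerivAt (coshQuot b) _ u :=
    (((h1.cosh).sub_const 1).sub ((h1.pow 2).div_const 2)).div (hasDerivAt_id u) hu
  refine h2.congr_deriv ?_
  rw [coshQuotDeriv]
  simp
  ring

lemma abs_cosh_sub_le {x : ℝ} (hx : 0 ≤ x) :
    |Real.cosh x - 1 - x ^ 2 / 2| ≤ x ^ 2 * Real.exp x := by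
  have h1 := cosh_sub_one_le_mul_sinh hx
  have h2 := mul_sinh_le_sq_mul_cosh hx
  have h3 := mul_le_mul_of_nonneg_left (cosh_le_exp hx) (sq_nonneg x)
  have h4 := Real.one_le_cosh x
  have h5 := mul_le_mul_of_nonneg_left h4 (sq_nonneg x)
  rw [abs_le]
  constructor <;> nlinarith

lemma abs_coshQuot_le {b u : ℝ} (hb : 0 ≤ b) (hu : 0 < u) :
    |coshQuot b u| ≤ b ^ 2 * u * Real.exp (b * u) := by
  rw [coshQuot, abs_div, abs_of_pos hu, div_le_iff₀ hu]
  refine (abs_cosh_sub_le (by positivity)).trans (le_of_eq (by ring))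

lemma abs_coshQuotDeriv_le {b u : ℝ} (hb : 0 ≤ b) (hu : 0 < u) :
    |coshQuotDeriv b u| ≤ b ^ 2 * Real.exp (b * u) := by
  rw [coshQuotDeriv, abs_div, abs_of_pos (by positivity : 0 < u ^ 2), div_le_iff₀ (by positivity)]
  have hx : 0 ≤ b * u := by positivity
  generalize hxd : b * u = x at *
  have e : b ^ 2 * Real.exp x * u ^ 2 = x ^ 2 * Real.exp x := by rw [← hxd]; ring
  rw [e]
  have h1 := cosh_sub_one_le_mul_sinh hx
  have h2 := mul_sinh_le_sq_mul_cosh hx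
  have h3 := mul_le_mul_of_nonneg_left (cosh_le_exp hx) (sq_nonneg x)
  have h4 := Real.one_le_cosh x
  have h5 := mul_le_mul_of_nonneg_left h4 (sq_nonneg x)
  rw [abs_le]
  constructor <;> nlinarith

lemma integrable_exp_mul_sub_sq (c : ℝ) {σ : ℝ} (hσ : 0 < σ) :
    Integrable fun u : ℝ ↦ Real.exp (c * u - σ * u ^ 2) := by
  have h := (integrable_cexp_quadratic (b := (σ : ℂ)) (by simpa using hσ) c 0).norm
  convert h using 2 with u
  rw [Complex.norm_exp]
  congr 1
  rw [← Complex.ofReal_pow, ← Complex.ofReal_neg, ← Complex.ofReal_mul, ← Complex.ofReal_mul,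
    Complex.add_re, Complex.add_re, Complex.ofReal_re, Complex.ofReal_re, Complex.zero_re]
  ring

lemma integrableOn_mul_cexp_neg_sq {f : ℝ → ℂ} {s : ℂ} (hs : 0 < s.re) {C c : ℝ}
    (hf : ContinuousOn f (Ioi 0)) (hb : ∀ u, 0 < u → ‖f u‖ ≤ C * Real.exp (c * u)) :
    IntegrableOn (fun u : ℝ ↦ f u * Complex.exp (-s * u ^ 2)) (Ioi 0) := by
  refine Integrable.mono' ((integrable_exp_mul_sub_sq c hs).const_mul C).integrableOn ?_ ?_
  · refine ContinuousOn.aestronglyMeasurable ?_ measurableSet_Ioi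
    exact hf.mul (by fun_prop)
  · refine (ae_restrict_iff' measurableSet_Ioi).mpr (Eventually.of_forall fun u hu ↦ ?_)
    rw [norm_mul, Complex.norm_exp, sub_eq_add_neg, Real.exp_add, ← mul_assoc]
    have e : (-s * (u : ℂ) ^ 2).re = -(s.re * u ^ 2) := by
      rw [← Complex.ofReal_pow, mul_comm, Complex.re_ofReal_mul]; simp; ring
    rw [e]
    exact mul_le_mul_of_nonneg_right (hb u hu) (Real.exp_pos _).le

lemma hasDerivAt_cexp_neg_sq (s : ℂ) (u : ℝ) :
    HasDerivAt (fun u : ℝ ↦ Complex.exp (-s * (u : ℂ) ^ 2))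
      (Complex.exp (-s * (u : ℂ) ^ 2) * (-s * (2 * u))) u := by
  have h1 : HasDerivAt (fun z : ℂ ↦ Complex.exp (-s * z ^ 2))
      (Complex.exp (-s * (u : ℂ) ^ 2) * (-s * (2 * u))) (u : ℂ) := by
    have := ((hasDerivAt_pow 2 (u : ℂ)).const_mul (-s)).cexp
    simpa using this
  exact h1.comp_ofReal

lemma tendsto_exp_mul_sub_sq (c : ℝ) {σ : ℝ} (hσ : 0 < σ) :
    Tendsto (fun u : ℝ ↦ Real.exp (c * u - σ * u ^ 2)) atTop (𝓝 0) := by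
  refine Real.tendsto_exp_atBot.comp ?_
  have : (fun u : ℝ ↦ c * u - σ * u ^ 2) = fun u ↦ u * (c - σ * u) := by ext; ring
  rw [this]
  refine tendsto_id.atTop_mul_atBot₀ ?_
  exact tendsto_atBot_add_const_left _ c
    (tendsto_neg_atTop_atBot.comp (tendsto_id.const_mul_atTop hσ)) |>.congr fun x ↦ by simp; ring

lemma tendsto_mul_cexp_neg_sq {f : ℝ → ℂ} {s : ℂ} (hs : 0 < s.re) {C c : ℝ}
    (hb : ∀ u, 0 < u → ‖f u‖ ≤ C * Real.exp (c * u)) :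
    Tendsto (fun u : ℝ ↦ f u * Complex.exp (-s * u ^ 2)) atTop (𝓝 0) := by
  refine squeeze_zero_norm' ?_ (by simpa using (tendsto_exp_mul_sub_sq c hs).const_mul C)
  filter_upwards [eventually_gt_atTop 0] with u hu
  rw [norm_mul, Complex.norm_exp, sub_eq_add_neg, Real.exp_add, ← mul_assoc]
  have e : (-s * (u : ℂ) ^ 2).re = -(s.re * u ^ 2) := by
    rw [← Complex.ofReal_pow, mul_comm, Complex.re_ofReal_mul]; simp; ring
  rw [e]
  exact mul_le_mul_of_nonneg_right (hb u hu) (Real.exp_pos _).le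

/-- Integration by parts against a Gaussian on the half line. -/
lemma integral_deriv_mul_cexp_neg_sq {f f' : ℝ → ℝ} {s : ℂ} (hs : 0 < s.re) {C c : ℝ}
    (hf0 : f 0 = 0) (hd : ∀ u, 0 < u → HasDerivAt f (f' u) u)
    (hc : ContinuousOn f' (Ioi 0))
    (hb : ∀ u, 0 < u → |f u| ≤ C * (u * Real.exp (c * u)))
    (hb' : ∀ u, 0 < u → |f' u| ≤ C * Real.exp (c * u)) :
    ∫ u in Ioi 0, (f' u : ℂ) * Complex.exp (-s * u ^ 2) =
      2 * s * ∫ u in Ioi 0, (u * f u : ℂ) * Complex.exp (-s * u ^ 2) := by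
  have hC : 0 ≤ C := by
    have := (abs_nonneg _).trans (hb' 1 one_pos)
    exact nonneg_of_mul_nonneg_left this (Real.exp_pos _)
  have hcf : ContinuousOn f (Ioi 0) := fun u hu ↦ (hd u hu).continuousAt.continuousWithinAt
  have hue : ∀ u : ℝ, u ≤ Real.exp u := fun u ↦ by linarith [Real.add_one_le_exp u]
  have hue2 : ∀ u : ℝ, 0 < u → u * u ≤ Real.exp (2 * u) := fun u hu ↦ by
    rw [two_mul, Real.exp_add]
    exact mul_le_mul (hue u) (hue u) hu.le (Real.exp_pos _).le
  have b1 : ∀ u : ℝ, 0 < u → ‖(f u : ℂ)‖ ≤ C * Real.exp ((c + 1) * u) := fun u hu ↦ by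
    rw [Complex.norm_real]
    refine (hb u hu).trans (mul_le_mul_of_nonneg_left ?_ hC)
    rw [add_mul, one_mul, Real.exp_add, mul_comm]
    exact mul_le_mul_of_nonneg_left (hue u) (Real.exp_pos _).le
  have b2 : ∀ u : ℝ, 0 < u → ‖(u * f u : ℂ)‖ ≤ C * Real.exp ((c + 2) * u) := fun u hu ↦ by
    rw [norm_mul, Complex.norm_real, Complex.norm_real, Real.norm_of_nonneg hu.le]
    refine (mul_le_mul_of_nonneg_left (hb u hu) hu.le).trans ?_
    rw [add_mul, Real.exp_add]
    have := mul_le_mul_of_nonneg_left (hue2 u hu) (mul_nonneg hC (Real.exp_pos (c * u)).le)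
    linarith
  have b3 : ∀ u : ℝ, 0 < u → ‖(f' u : ℂ)‖ ≤ C * Real.exp (c * u) := fun u hu ↦ by
    rw [Complex.norm_real]; exact hb' u hu
  have i1 := integrableOn_mul_cexp_neg_sq hs (f := fun u ↦ (u * f u : ℂ))
    ((by fun_prop : Continuous fun u : ℝ ↦ (u : ℂ)).continuousOn.mul
      (Complex.continuous_ofReal.comp_continuousOn hcf)) b2
  have i2 := integrableOn_mul_cexp_neg_sq hs (f := fun u ↦ (f' u : ℂ))
    (Complex.continuous_ofReal.comp_continuousOn hc) b3
  have h := integral_Ioi_of_hasDerivAt_of_tendsto (a := 0) (m := 0)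
    (f := fun u : ℝ ↦ (f u : ℂ) * Complex.exp (-s * u ^ 2))
    (f' := fun u : ℝ ↦ (f' u : ℂ) * Complex.exp (-s * u ^ 2) -
      2 * s * ((u * f u : ℂ) * Complex.exp (-s * u ^ 2))) ?_ ?_ ?_ ?_
  · rw [integral_sub i2 (i1.const_mul _), integral_const_mul, hf0, Complex.ofReal_zero] at h
    linear_combination h
  · refine ContinuousWithinAt.mul ?_ (by fun_prop : Continuous _).continuousWithinAt
    refine Complex.continuous_ofReal.continuousAt.comp_continuousWithinAt ?_
    rw [ContinuousWithinAt, hf0]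
    have hl : Tendsto (fun u : ℝ ↦ C * (u * Real.exp (c * u))) (𝓝[Ici 0] 0) (𝓝 0) := by
      have : Continuous (fun u : ℝ ↦ C * (u * Real.exp (c * u))) := by fun_prop
      simpa using (this.tendsto 0).mono_left nhdsWithin_le_nhds
    refine squeeze_zero_norm' ?_ hl
    filter_upwards [self_mem_nhdsWithin] with u hu
    rcases (mem_Ici.mp hu).eq_or_lt with rfl | hu
    · simp [hf0]
    · exact hb u hu
  · intro u hu
    refine (((hd u hu).ofReal_comp).mul (hasDerivAt_cexp_neg_sq s u)).congr_deriv ?_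
    ring
  · exact i2.sub (i1.const_mul _)
  · exact tendsto_mul_cexp_neg_sq hs b1

lemma integral_cosh_mul_cexp_neg_sq (b : ℝ) {s : ℂ} (hs : 0 < s.re) :
    IntegrableOn (fun u : ℝ ↦ (Real.cosh (b * u) : ℂ) * Complex.exp (-s * u ^ 2)) (Ioi 0) ∧
    ∫ u : ℝ in Ioi 0, (Real.cosh (b * u) : ℂ) * Complex.exp (-s * u ^ 2) =
      (Real.pi / s) ^ (1 / 2 : ℂ) * Complex.exp (b ^ 2 / (4 * s)) / 2 := by
  have hs0 : s ≠ 0 := fun h ↦ by simp [h] at hs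
  have hi : Integrable (fun u : ℝ ↦ Complex.exp (-s * u ^ 2 + b * u + 0)) :=
    integrable_cexp_quadratic hs b 0
  have hi' := hi.comp_neg
  have h1 := integral_cexp_quadratic (b := -s) (by simpa using hs) b 0
  rw [← intervalIntegral.integral_Iic_add_Ioi (b := 0) hi.integrableOn hi.integrableOn,
    ← neg_zero, ← integral_comp_neg_Ioi, neg_zero, ← integral_add hi'.integrableOn hi.integrableOn]
    at h1
  have e : ∀ u : ℝ, Complex.exp (-s * ((-u : ℝ) : ℂ) ^ 2 + b * ((-u : ℝ) : ℂ) + 0) +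
      Complex.exp (-s * u ^ 2 + b * u + 0) =
      2 * ((Real.cosh (b * u) : ℂ) * Complex.exp (-s * u ^ 2)) := by
    intro u
    rw [Complex.ofReal_cosh, Complex.cosh, add_zero, add_zero, Complex.exp_add, Complex.exp_add]
    push_cast
    rw [neg_sq, mul_neg]
    ring
  have hi2 := (hi'.integrableOn (s := Ioi 0)).add (hi.integrableOn (s := Ioi 0))
  have hi3 : IntegrableOn (fun u : ℝ ↦ 2 * ((Real.cosh (b * u) : ℂ) * Complex.exp (-s * u ^ 2)))
      (Ioi 0) := hi2.congr (Eventually.of_forall e)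
  rw [integral_congr_ae (Eventually.of_forall e), integral_const_mul] at h1
  refine ⟨(hi3.const_mul (1 / 2)).congr (Eventually.of_forall fun u ↦ by ring), ?_⟩
  rw [neg_neg] at h1
  rw [eq_div_iff two_ne_zero, mul_comm, h1]
  congr 2
  field_simp
  ring

lemma integral_sq_mul_cexp_neg_sq {s : ℂ} (hs : 0 < s.re) :
    IntegrableOn (fun u : ℝ ↦ (u * u : ℂ) * Complex.exp (-s * u ^ 2)) (Ioi 0) ∧
    2 * s * ∫ u : ℝ in Ioi 0, (u * u : ℂ) * Complex.exp (-s * u ^ 2) =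
      (Real.pi / s) ^ (1 / 2 : ℂ) / 2 := by
  have hue : ∀ u : ℝ, u ≤ Real.exp u := fun u ↦ by linarith [Real.add_one_le_exp u]
  constructor
  · refine integrableOn_mul_cexp_neg_sq hs (f := fun u ↦ (u * u : ℂ)) (C := 1) (c := 2)
      (by fun_prop) fun u hu ↦ ?_
    rw [norm_mul, Complex.norm_real, Real.norm_of_nonneg hu.le, two_mul, Real.exp_add, one_mul]
    exact mul_le_mul (hue u) (hue u) hu.le (Real.exp_pos _).le
  · have h := integral_deriv_mul_cexp_neg_sq (f := fun u ↦ u) (f' := fun _ ↦ 1) (C := 1) (c := 0)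
      hs rfl (fun u _ ↦ hasDerivAt_id u) continuousOn_const
      (fun u hu ↦ by simp [abs_of_pos hu]) (fun u hu ↦ by simp)
    rw [← h]
    simpa using integral_gaussian_complex_Ioi hs

/-- A half-line Gaussian transform which is a Laplace transform after squaring the variable. -/
lemma integral_coshQuotDeriv_mul {b : ℝ} (hb : 0 ≤ b) {s : ℂ} (hs : 0 < s.re) :
    ∫ u in Ioi 0, (coshQuotDeriv b u : ℂ) * Complex.exp (-s * u ^ 2) =
      s * (Real.pi / s) ^ (1 / 2 : ℂ) *
        (Complex.exp (b ^ 2 / (4 * s)) - 1 - b ^ 2 / (4 * s)) := by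
  have hs0 : s ≠ 0 := fun h ↦ by simp [h] at hs
  rw [integral_deriv_mul_cexp_neg_sq (f := coshQuot b) (f' := coshQuotDeriv b) (C := b ^ 2) (c := b)
    hs (by simp [coshQuot]) (fun u hu ↦ hasDerivAt_coshQuot b hu.ne') ?_
    (fun u hu ↦ (abs_coshQuot_le hb hu).trans (le_of_eq (by ring)))
    (fun u hu ↦ abs_coshQuotDeriv_le hb hu)]
  · obtain ⟨i1, h1⟩ := integral_cosh_mul_cexp_neg_sq b hs
    obtain ⟨i2, h2⟩ := integral_cosh_mul_cexp_neg_sq 0 hs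
    obtain ⟨i3, h3⟩ := integral_sq_mul_cexp_neg_sq hs
    have e : ∫ u : ℝ in Ioi 0, (u * coshQuot b u : ℂ) * Complex.exp (-s * u ^ 2) =
        ∫ u : ℝ in Ioi 0, ((Real.cosh (b * u) : ℂ) * Complex.exp (-s * u ^ 2) -
          (Real.cosh (0 * u) : ℂ) * Complex.exp (-s * u ^ 2) -
          b ^ 2 / 2 * ((u * u : ℂ) * Complex.exp (-s * u ^ 2))) := by
      refine setIntegral_congr_fun measurableSet_Ioi fun u hu ↦ ?_
      have hu0 : (u : ℂ) ≠ 0 := by exact_mod_cast (mem_Ioi.mp hu).ne'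
      simp only [coshQuot, zero_mul, Real.cosh_zero]
      push_cast
      field_simp
    have i12 : IntegrableOn (fun u : ℝ ↦ (Real.cosh (b * u) : ℂ) * Complex.exp (-s * u ^ 2) -
          (Real.cosh (0 * u) : ℂ) * Complex.exp (-s * u ^ 2)) (Ioi 0) := i1.sub i2
    rw [e, integral_sub i12 (i3.const_mul _), integral_sub i1 i2, h1, h2, integral_const_mul]
    have h4 : ∫ u : ℝ in Ioi 0, (u * u : ℂ) * Complex.exp (-s * u ^ 2) =
        (Real.pi / s) ^ (1 / 2 : ℂ) / 2 / (2 * s) := by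
      rw [← h3, mul_div_cancel_left₀ _ (mul_ne_zero two_ne_zero hs0)]
    rw [h4]
    have e0 : ((0 : ℝ) : ℂ) ^ 2 / (4 * s) = 0 := by simp
    rw [e0, Complex.exp_zero]
    generalize (Real.pi / s) ^ (1 / 2 : ℂ) = P
    field_simp
    ring
  · unfold coshQuotDeriv
    exact ContinuousOn.div (by fun_prop) (by fun_prop) fun u hu ↦
      pow_ne_zero 2 (mem_Ioi.mp hu).ne'

end Laplace

section Inversion

open Filter Topology MeasureTheory Set

/-- The inverse Laplace transform of `laplaceSymbol b`. -/
noncomputable def invDensity (b t : ℝ) : ℝ := coshQuotDeriv b (√t) / (2 * √t)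

/-- The function `s * √(π / s) * (exp (b ^ 2 / (4 * s)) - 1 - b ^ 2 / (4 * s))`. -/
noncomputable def laplaceSymbol (b : ℝ) (s : ℂ) : ℂ :=
  s * (Real.pi / s) ^ (1 / 2 : ℂ) * (Complex.exp (b ^ 2 / (4 * s)) - 1 - b ^ 2 / (4 * s))

lemma continuousOn_coshQuotDeriv (b : ℝ) : ContinuousOn (coshQuotDeriv b) (Ioi 0) := by
  unfold coshQuotDeriv
  exact ContinuousOn.div (by fun_prop) (by fun_prop) fun u hu ↦ pow_ne_zero 2 (mem_Ioi.mp hu).ne'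

lemma continuousOn_invDensity (b : ℝ) : ContinuousOn (invDensity b) (Ioi 0) := by
  unfold invDensity
  refine ContinuousOn.div ((continuousOn_coshQuotDeriv b).comp (by fun_prop) fun t ht ↦ ?_)
    (by fun_prop) fun u hu ↦ ?_
  · exact Real.sqrt_pos.mpr ht
  · have := Real.sqrt_pos.mpr (mem_Ioi.mp hu)
    positivity

lemma integral_invDensity_mul {b : ℝ} (hb : 0 ≤ b) {s : ℂ} (hs : 0 < s.re) :
    IntegrableOn (fun t : ℝ ↦ (invDensity b t : ℂ) * Complex.exp (-s * t)) (Ioi 0) ∧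
    ∫ t in Ioi 0, (invDensity b t : ℂ) * Complex.exp (-s * t) = laplaceSymbol b s := by
  have e : ∀ u ∈ Ioi (0 : ℝ), (|(2 : ℝ)| * u ^ ((2 : ℝ) - 1)) •
      ((invDensity b (u ^ (2 : ℝ)) : ℂ) * Complex.exp (-s * ((u ^ (2 : ℝ) : ℝ) : ℂ))) =
      (coshQuotDeriv b u : ℂ) * Complex.exp (-s * u ^ 2) := by
    intro u hu
    have hu' : (0 : ℝ) < u := hu
    have hu0 : (u : ℂ) ≠ 0 := by exact_mod_cast hu'.ne'
    rw [Real.rpow_two, invDensity, Real.sqrt_sq hu'.le, show (2 : ℝ) - 1 = 1 by norm_num,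
      Real.rpow_one, abs_of_pos two_pos, Complex.real_smul]
    push_cast
    field_simp
  constructor
  · rw [← integrableOn_Ioi_comp_rpow_iff _ (two_ne_zero (α := ℝ))]
    refine IntegrableOn.congr_fun ?_ (fun u hu ↦ (e u hu).symm) measurableSet_Ioi
    exact integrableOn_mul_cexp_neg_sq hs (f := fun u ↦ (coshQuotDeriv b u : ℂ))
      (Complex.continuous_ofReal.comp_continuousOn (continuousOn_coshQuotDeriv b))
      (fun u hu ↦ by rw [Complex.norm_real]; exact abs_coshQuotDeriv_le hb hu)
  · rw [← integral_comp_rpow_Ioi _ (two_ne_zero (α := ℝ)), setIntegral_congr_fun measurableSet_Ioi e,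
      integral_coshQuotDeriv_mul hb hs, laplaceSymbol]

lemma norm_laplaceSymbol_le (b : ℝ) {s : ℂ} (hs : 0 < s.re) :
    ‖laplaceSymbol b s‖ ≤
      √(Real.pi * ‖s‖) * ((b ^ 2 / (4 * ‖s‖)) ^ 2 * Real.exp (b ^ 2 / (4 * ‖s‖))) := by
  have hs0 : s ≠ 0 := fun h ↦ by simp [h] at hs
  have hn : 0 < ‖s‖ := norm_pos_iff.mpr hs0
  have e1 : ‖s * ((Real.pi : ℂ) / s) ^ (1 / 2 : ℂ)‖ = √(Real.pi * ‖s‖) := by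
    rw [norm_mul, show (1 / 2 : ℂ) = ((1 / 2 : ℝ) : ℂ) by push_cast; rfl,
      Complex.norm_cpow_real, norm_div, Complex.norm_real, Real.norm_of_nonneg Real.pi_pos.le,
      ← Real.sqrt_eq_rpow]
    conv_lhs => rw [← Real.sqrt_sq hn.le]
    rw [Real.sqrt_sq hn.le, ← Real.sqrt_sq hn.le, ← Real.sqrt_mul (by positivity),
      Real.sqrt_sq hn.le]
    congr 1
    field_simp
  have e2 : ‖(b : ℂ) ^ 2 / (4 * s)‖ = b ^ 2 / (4 * ‖s‖) := by simp
  have h := Complex.norm_exp_sub_sum_le_norm_mul_exp ((b : ℂ) ^ 2 / (4 * s)) 2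
  rw [e2] at h
  rw [laplaceSymbol, norm_mul, e1]
  refine mul_le_mul_of_nonneg_left ?_ (Real.sqrt_nonneg _)
  refine (le_of_eq (congrArg norm ?_)).trans h
  simp [Finset.sum_range_succ]
  ring

lemma continuous_laplaceSymbol_lineAt (b : ℝ) {σ : ℝ} (hσ : 0 < σ) :
    Continuous fun x ↦ laplaceSymbol b (lineAt σ x) := by
  have h0 : ∀ x, lineAt σ x ≠ 0 := fun x h ↦ by
    have := lineAt_re σ x; rw [h] at this; simp at this; linarith
  have hc := continuous_lineAt σ
  unfold laplaceSymbol
  have hd : Continuous fun x ↦ (b : ℂ) ^ 2 / (4 * lineAt σ x) :=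
    Continuous.div (by fun_prop) (by fun_prop) fun x ↦ mul_ne_zero (by norm_num) (h0 x)
  have hp : Continuous fun x ↦ ((Real.pi : ℂ) / lineAt σ x) :=
    Continuous.div (by fun_prop) (by fun_prop) h0
  refine (hc.mul (hp.cpow continuous_const fun x ↦ ?_)).mul
    (((Complex.continuous_exp.comp hd).sub continuous_const).sub hd)
  left
  exact re_div_pos (by rw [lineAt_re]; exact hσ) Real.pi_pos

lemma sq_norm_lineAt (σ x : ℝ) : ‖lineAt σ x‖ ^ 2 = σ ^ 2 + (2 * Real.pi * x) ^ 2 := by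
  rw [Complex.sq_norm, Complex.normSq_apply, lineAt_re, lineAt_im]; ring

lemma integrable_laplaceSymbol (b : ℝ) {σ : ℝ} (hσ : 0 < σ) :
    Integrable fun x ↦ laplaceSymbol b (lineAt σ x) := by
  have hi := integrable_rpow_neg_one_add_norm_sq (E := ℝ) (μ := volume) (r := 3 / 2)
    (by simp; norm_num)
  set c := min σ 1 with hc
  have hc0 : 0 < c := by positivity
  have hc1 : c ≤ 1 := min_le_right _ _
  refine Integrable.mono' (hi.const_mul (√Real.pi * (b ^ 2 / 4) ^ 2 *
    Real.exp (b ^ 2 / (4 * σ)) * c ^ (-(3 / 2) : ℝ)))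
    (continuous_laplaceSymbol_lineAt b hσ).aestronglyMeasurable (Eventually.of_forall fun x ↦ ?_)
  refine (norm_laplaceSymbol_le b (by rw [lineAt_re]; exact hσ)).trans ?_
  have hσs : σ ≤ ‖lineAt σ x‖ := by
    have := Complex.abs_re_le_norm (lineAt σ x)
    rw [lineAt_re, abs_of_pos hσ] at this
    exact this
  have hn : 0 < ‖lineAt σ x‖ := hσ.trans_le hσs
  have h1 : c * (1 + ‖x‖ ^ 2) ^ (1 / 2 : ℝ) ≤ ‖lineAt σ x‖ := by
    rw [← Real.sqrt_eq_rpow]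
    refine abs_le_of_sq_le_sq' ?_ hn.le |>.2
    rw [mul_pow, Real.sq_sqrt (by positivity), sq_norm_lineAt, Real.norm_eq_abs, sq_abs]
    have : c ^ 2 ≤ σ ^ 2 := pow_le_pow_left₀ hc0.le (min_le_left _ _) 2
    have h2 : c ^ 2 ≤ 1 := pow_le_one₀ hc0.le hc1
    have h3 : 1 ≤ (2 * Real.pi) ^ 2 := by nlinarith [Real.pi_gt_three]
    nlinarith [mul_le_mul_of_nonneg_right (h2.trans h3) (sq_nonneg x)]
  have h2 : ‖lineAt σ x‖ ^ (-(3 / 2) : ℝ) ≤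
      c ^ (-(3 / 2) : ℝ) * (1 + ‖x‖ ^ 2) ^ (-(3 / 2) / 2 : ℝ) := by
    refine (Real.rpow_le_rpow_of_nonpos (by positivity) h1 (by norm_num)).trans (le_of_eq ?_)
    rw [Real.mul_rpow hc0.le (by positivity), ← Real.rpow_mul (by positivity)]
    norm_num
  have e : √(Real.pi * ‖lineAt σ x‖) * ((b ^ 2 / (4 * ‖lineAt σ x‖)) ^ 2 *
      Real.exp (b ^ 2 / (4 * ‖lineAt σ x‖))) = √Real.pi * (b ^ 2 / 4) ^ 2 *
      Real.exp (b ^ 2 / (4 * ‖lineAt σ x‖)) * ‖lineAt σ x‖ ^ (-(3 / 2) : ℝ) := by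
    have : ‖lineAt σ x‖ ^ (-(3 / 2) : ℝ) = √‖lineAt σ x‖ / ‖lineAt σ x‖ ^ 2 := by
      rw [Real.sqrt_eq_rpow, ← Real.rpow_natCast, ← Real.rpow_sub hn]; norm_num
    rw [this, Real.sqrt_mul Real.pi_pos.le]
    field_simp
  rw [e, mul_assoc _ (c ^ _)]
  have h3 : Real.exp (b ^ 2 / (4 * ‖lineAt σ x‖)) ≤ Real.exp (b ^ 2 / (4 * σ)) := by
    gcongr
  exact mul_le_mul (by gcongr) h2 (by positivity) (by positivity)

open FourierTransform in
/-- Laplace inversion for `laplaceSymbol`. -/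
lemma integral_laplaceSymbol {b : ℝ} (hb : 0 ≤ b) {σ : ℝ} (hσ : 0 < σ) {N : ℝ} (hN : 0 < N) :
    ∫ x, laplaceSymbol b (lineAt σ x) * Complex.exp (N * lineAt σ x) = invDensity b N := by
  let f : ℝ → ℂ := (Ioi (0 : ℝ)).indicator
    fun t ↦ (invDensity b t : ℂ) * Complex.exp (-(σ : ℂ) * t)
  have hf : Integrable f :=
    (integrable_indicator_iff measurableSet_Ioi).mpr
      (integral_invDensity_mul hb (s := (σ : ℂ)) (by simpa using hσ)).1
  have hF : 𝓕 f = fun x ↦ laplaceSymbol b (lineAt σ x) := by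
    funext x
    rw [Real.fourier_real_eq_integral_exp_smul,
      ← (integral_invDensity_mul hb (s := lineAt σ x) (by rw [lineAt_re]; exact hσ)).2,
      ← integral_indicator measurableSet_Ioi]
    refine integral_congr_ae (Eventually.of_forall fun t ↦ ?_)
    by_cases ht : t ∈ Ioi (0 : ℝ)
    · simp only [f, indicator_of_mem ht, smul_eq_mul]
      rw [mul_left_comm, ← Complex.exp_add, lineAt]
      congr 2
      push_cast
      ring
    · simp only [f, indicator_of_notMem ht, smul_zero]
  have hcont : ContinuousAt f N := by
    have : f =ᶠ[𝓝 N] fun t ↦ (invDensity b t : ℂ) * Complex.exp (-(σ : ℂ) * t) := by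
      filter_upwards [Ioi_mem_nhds hN] with t ht
      exact indicator_of_mem ht _
    refine ContinuousAt.congr ?_ this.symm
    refine ContinuousAt.mul ?_ (by fun_prop)
    exact Complex.continuous_ofReal.continuousAt.comp
      ((continuousOn_invDensity b).continuousAt (Ioi_mem_nhds hN))
  have h := hf.fourierInv_fourier_eq (by rw [hF]; exact integrable_laplaceSymbol b hσ) hcont
  rw [hF, Real.fourierInv_eq'] at h
  have hfN : f N = (invDensity b N : ℂ) * Complex.exp (-(σ : ℂ) * N) :=
    indicator_of_mem (mem_Ioi.mpr hN) _
  rw [hfN] at h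
  have h2 := congrArg (fun z ↦ Complex.exp (σ * N) * z) h
  simp only [← integral_const_mul] at h2
  rw [mul_left_comm, ← Complex.exp_add, show (σ : ℂ) * N + -σ * N = 0 by ring, Complex.exp_zero,
    mul_one] at h2
  rw [← h2]
  refine integral_congr_ae (Eventually.of_forall fun x ↦ ?_)
  simp only [smul_eq_mul]
  rw [← mul_assoc, ← Complex.exp_add, mul_comm]
  congr 2
  rw [lineAt]
  simp
  ring

end Inversion

section Asymptotics

open Filter Topology MeasureTheory Set

/-- The constant `π * √(2 / 3)` of the Hardy-Ramanujan formula. -/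
noncomputable def hrBeta : ℝ := Real.pi * √(2 / 3)

lemma hrBeta_sq : hrBeta ^ 2 = 2 * Real.pi ^ 2 / 3 := by
  rw [hrBeta, mul_pow, Real.sq_sqrt (by norm_num)]; ring

lemma hrBeta_pos : 0 < hrBeta := by
  have := Real.pi_pos
  unfold hrBeta
  positivity

lemma hrBeta_sq_bounds : 6.5797 < hrBeta ^ 2 ∧ hrBeta ^ 2 < 6.5798 := by
  rw [hrBeta_sq]
  have h1 := Real.pi_gt_d6
  have h2 := Real.pi_lt_d6
  constructor <;> nlinarith

lemma hrBeta_bounds : 2.565 < hrBeta ∧ hrBeta < 2.566 := by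
  have h := hrBeta_sq_bounds
  have h0 := hrBeta_pos
  constructor <;> nlinarith

/-- The main term of the asymptotics of the partition function, as a function of
`w = √(n - 1 / 24)`. -/
noncomputable def hrMain (w : ℝ) : ℝ :=
  (hrBeta * w - 1) * Real.exp (hrBeta * w) / (4 * √2 * Real.pi * w ^ 3)

lemma exp_half_log {r : ℝ} (hr : 0 < r) : Complex.exp ((Real.log r : ℂ) / 2) = (√r : ℝ) := by
  rw [show (Real.log r : ℂ) / 2 = ((Real.log r / 2 : ℝ) : ℂ) by push_cast; rfl,
    ← Complex.ofReal_exp, Real.exp_half, Real.exp_log hr]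

lemma csqrt_div_two_pi {s : ℂ} (hs : 0 < s.re) :
    Complex.sqrt (s / (2 * Real.pi)) =
      1 / ((√2 * Real.pi : ℝ) : ℂ) * (s * (Real.pi / s) ^ (1 / 2 : ℂ)) := by
  have hpi := Real.pi_pos
  have hs0 : s ≠ 0 := fun h ↦ by simp [h] at hs
  have e1 : s / (2 * Real.pi) = (((2 * Real.pi)⁻¹ : ℝ) : ℂ) * s := by push_cast; ring
  have harg : s.arg ≠ Real.pi := by
    have := abs_lt.mp (Complex.abs_arg_lt_pi_div_two_iff.mpr (Or.inl hs))
    linarith [this.2]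
  have hr : 0 < (2 * Real.pi)⁻¹ := by positivity
  have hx : s / (2 * Real.pi) ≠ 0 := by
    rw [e1]; exact mul_ne_zero (by exact_mod_cast hr.ne') hs0
  have hx2 : (Real.pi : ℂ) / s ≠ 0 := div_ne_zero (by exact_mod_cast hpi.ne') hs0
  rw [sqrt_eq_exp hx, e1, Complex.log_ofReal_mul hr hs0, Complex.cpow_def_of_ne_zero hx2,
    div_eq_mul_inv (Real.pi : ℂ) s, Complex.log_ofReal_mul hpi (inv_ne_zero hs0),
    Complex.log_inv _ harg, add_div, Complex.exp_add, exp_half_log hr]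
  conv_rhs => rw [← Complex.exp_log hs0]
  rw [Complex.exp_log hs0, add_mul, Complex.exp_add, mul_one_div, exp_half_log hpi, mul_one_div,
    mul_left_comm s]
  have e2 : s * Complex.exp (-Complex.log s / 2) = Complex.exp (Complex.log s / 2) := by
    conv_lhs => rw [← Complex.exp_log hs0, ← Complex.exp_add, Complex.exp_log hs0]
    congr 1
    ring
  rw [e2, ← mul_assoc]
  congr 1
  rw [← Complex.ofReal_one, ← Complex.ofReal_div, ← Complex.ofReal_mul]
  congr 1
  rw [Real.sqrt_inv, Real.sqrt_mul two_pos.le]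
  have h3 : 0 < √Real.pi := Real.sqrt_pos.mpr hpi
  have h4 : 0 < √(2 : ℝ) := Real.sqrt_pos.mpr two_pos
  field_simp
  exact (Real.sq_sqrt hpi.le).symm

lemma eulerInv_mul_cexp {s : ℂ} (hs : 0 < s.re) (n : ℕ) :
    eulerInv (Complex.exp (-s)) * Complex.exp (n * s) =
      1 / ((√2 * Real.pi : ℝ) : ℂ) * (s * (Real.pi / s) ^ (1 / 2 : ℂ)) *
        (Complex.exp (hrBeta ^ 2 / (4 * s)) *
          eulerInv (Complex.exp (-(4 * (Real.pi : ℂ) ^ 2 / s)))) *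
        Complex.exp (((n - 1 / 24 : ℝ) : ℂ) * s) := by
  have hs0 : s ≠ 0 := fun h ↦ by simp [h] at hs
  have e : (hrBeta : ℂ) ^ 2 = 2 * (Real.pi : ℂ) ^ 2 / 3 := by
    exact_mod_cast congrArg Complex.ofReal hrBeta_sq
  have e2 : Complex.exp (-s / 24 + (Real.pi : ℂ) ^ 2 / (6 * s)) * Complex.exp (n * s) =
      Complex.exp (hrBeta ^ 2 / (4 * s)) * Complex.exp (((n - 1 / 24 : ℝ) : ℂ) * s) := by
    rw [← Complex.exp_add, ← Complex.exp_add, e]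
    congr 1
    push_cast
    field_simp
    ring
  rw [eulerInv_modular hs, csqrt_div_two_pi hs]
  linear_combination (1 / ((√2 * Real.pi : ℝ) : ℂ) * (s * (Real.pi / s) ^ (1 / 2 : ℂ)) *
    eulerInv (Complex.exp (-(4 * (Real.pi : ℂ) ^ 2 / s)))) * e2

lemma norm_mul_cpow_half {s : ℂ} (hs : 0 < s.re) :
    ‖s * ((Real.pi : ℂ) / s) ^ (1 / 2 : ℂ)‖ = √(Real.pi * ‖s‖) := by
  have hs0 : s ≠ 0 := fun h ↦ by simp [h] at hs
  have hn : 0 < ‖s‖ := norm_pos_iff.mpr hs0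
  rw [norm_mul, show (1 / 2 : ℂ) = ((1 / 2 : ℝ) : ℂ) by push_cast; rfl,
    Complex.norm_cpow_real, norm_div, Complex.norm_real, Real.norm_of_nonneg Real.pi_pos.le,
    ← Real.sqrt_eq_rpow, Real.sqrt_div Real.pi_pos.le, Real.sqrt_mul Real.pi_pos.le]
  have h : 0 < √‖s‖ := Real.sqrt_pos.mpr hn
  have h2 : ‖s‖ = √‖s‖ * √‖s‖ := (Real.mul_self_sqrt hn.le).symm
  field_simp
  nlinarith

lemma continuous_eulerInv_lineAt {σ : ℝ} (hσ : 0 < σ) :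
    Continuous fun x ↦ eulerInv (Complex.exp (-lineAt σ x)) := by
  have hr : Real.exp (-σ) < 1 := by simpa using hσ
  have e : (fun x ↦ eulerInv (Complex.exp (-lineAt σ x))) =
      fun x ↦ ∑' n, (partitionFn n : ℂ) * Complex.exp (-lineAt σ x) ^ n := by
    funext x
    exact (hasSum_partitionFn (by rw [norm_cexp_neg_lineAt]; exact hr)).tsum_eq.symm
  rw [e]
  have hc := continuous_lineAt σ
  refine continuous_tsum (fun n ↦ by fun_prop) (summable_partitionFn (Real.exp_pos _).le hr)
    fun n x ↦ le_of_eq ?_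
  rw [norm_mul, norm_pow, norm_cexp_neg_lineAt, Complex.norm_natCast]

end Asymptotics

section CircleMethod
open Filter Topology MeasureTheory Set

lemma sq_quadratic_le_exp {y : ℝ} (hy : 0 ≤ y) : (1 + y + y ^ 2 / 2) ^ 2 ≤ Real.exp (2 * y) := by
  rw [two_mul, Real.exp_add, ← sq]
  gcongr
  exact Real.quadratic_le_exp_of_nonneg hy

lemma re_ofReal_div {s : ℂ} (c : ℝ) : ((c : ℂ) / s).re = c * s.re / ‖s‖ ^ 2 := by
  rw [Complex.div_re, Complex.normSq_eq_norm_sq]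
  simp

/-- The integrand approximating the generating function on a vertical line. -/
noncomputable def hrIntegrand (N : ℝ) (s : ℂ) : ℂ :=
  1 / ((√2 * Real.pi : ℝ) : ℂ) * (laplaceSymbol hrBeta s * Complex.exp (N * s))

lemma four_lt_sqrt_two_mul_pi : 4 < √2 * Real.pi := by
  have h1 := Real.pi_gt_d6
  have h2 : 1.41 < √(2 : ℝ) := Real.lt_sqrt_of_sq_lt (by norm_num)
  nlinarith

lemma norm_one_div_mul_sqrt_le {s : ℂ} (hs : 0 < s.re) (h1 : ‖s‖ ≤ 1) :
    ‖1 / ((√2 * Real.pi : ℝ) : ℂ) * (s * ((Real.pi : ℂ) / s) ^ (1 / 2 : ℂ))‖ ≤ 1 := by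
  have h4 := four_lt_sqrt_two_mul_pi
  rw [norm_mul, norm_mul_cpow_half hs, norm_div, norm_one, Complex.norm_real,
    Real.norm_of_nonneg (by linarith), div_mul_eq_mul_div, one_mul, div_le_one (by linarith)]
  have : √(Real.pi * ‖s‖) ≤ 4 := by
    rw [Real.sqrt_le_left (by norm_num)]
    have := Real.pi_lt_d6
    have := Real.pi_pos
    nlinarith [norm_nonneg s]
  linarith

lemma four_pi_sq_eq : 4 * Real.pi ^ 2 = 24 * (hrBeta ^ 2 / 4) := by
  rw [hrBeta_sq]; ring

lemma norm_cexp_neg_four_pi_sq_div {s : ℂ} :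
    ‖Complex.exp (-(4 * (Real.pi : ℂ) ^ 2 / s))‖ =
      Real.exp (-(24 * (((hrBeta ^ 2 / 4 : ℝ) : ℂ) / s).re)) := by
  rw [Complex.norm_exp]
  congr 1
  have : 4 * (Real.pi : ℂ) ^ 2 = ((24 * (hrBeta ^ 2 / 4) : ℝ) : ℂ) := by
    rw [← four_pi_sq_eq]; push_cast; rfl
  rw [this, Complex.neg_re, re_ofReal_div, re_ofReal_div]
  ring

lemma exp_neg_le_quarter {y : ℝ} (hy : 2 ≤ y) : Real.exp (-y) ≤ 1 / 4 := by
  rw [Real.exp_neg, inv_le_comm₀ (Real.exp_pos _) (by norm_num)]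
  have := Real.quadratic_le_exp_of_nonneg (show 0 ≤ y by linarith)
  nlinarith

lemma norm_sub_hrIntegrand_le {s : ℂ} {n : ℕ} (hs : 0 < s.re) (h1 : ‖s‖ ≤ 1)
    (hv : 1 ≤ (((hrBeta ^ 2 / 4 : ℝ) : ℂ) / s).re) :
    ‖eulerInv (Complex.exp (-s)) * Complex.exp (n * s) - hrIntegrand (n - 1 / 24) s‖ ≤
      Real.exp ((n - 1 / 24) * s.re) * (3 + hrBeta ^ 2 / 4 / s.re) := by
  set a : ℝ := hrBeta ^ 2 / 4 with ha
  have ha0 : 0 < a := by have := hrBeta_pos; positivity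
  have hs0 : s ≠ 0 := fun h ↦ by simp [h] at hs
  have ea : (hrBeta : ℂ) ^ 2 / (4 * s) = (a : ℂ) / s := by
    rw [ha]; push_cast; field_simp
  set q := Complex.exp (-(4 * (Real.pi : ℂ) ^ 2 / s)) with hq
  have hqn : ‖q‖ = Real.exp (-(24 * ((a : ℂ) / s).re)) := norm_cexp_neg_four_pi_sq_div
  have key : eulerInv (Complex.exp (-s)) * Complex.exp (n * s) - hrIntegrand (n - 1 / 24) s =
      1 / ((√2 * Real.pi : ℝ) : ℂ) * (s * (Real.pi / s) ^ (1 / 2 : ℂ)) *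
        (Complex.exp (((n - 1 / 24 : ℝ) : ℂ) * s) *
          (Complex.exp (a / s) * (eulerInv q - 1) + (1 + a / s))) := by
    rw [eulerInv_mul_cexp hs, hrIntegrand, laplaceSymbol, ea]
    ring
  rw [key, norm_mul]
  refine (mul_le_of_le_one_left (norm_nonneg _) (norm_one_div_mul_sqrt_le hs h1)).trans ?_
  rw [norm_mul, Complex.norm_exp, Complex.re_ofReal_mul]
  gcongr
  have hE := norm_eulerInv_sub_one_le (q := q) (by rw [hqn]; exact exp_neg_le_quarter (by linarith))
  have b1 : ‖Complex.exp (a / s) * (eulerInv q - 1)‖ ≤ 2 := by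
    rw [norm_mul, Complex.norm_exp]
    calc _ ≤ Real.exp ((a : ℂ) / s).re * (2 * ‖q‖) := by gcongr
      _ = 2 * Real.exp (((a : ℂ) / s).re + -(24 * ((a : ℂ) / s).re)) := by
        rw [hqn, Real.exp_add]; ring
      _ ≤ 2 * 1 := by
        gcongr
        rw [Real.exp_le_one_iff]
        linarith
      _ = 2 := by norm_num
  have b2 : ‖(a : ℂ) / s‖ ≤ a / s.re := by
    rw [norm_div, Complex.norm_real, Real.norm_of_nonneg ha0.le]
    gcongr
    exact Complex.re_le_norm s
  calc _ ≤ ‖Complex.exp (a / s) * (eulerInv q - 1)‖ + (‖(1 : ℂ)‖ + ‖(a : ℂ) / s‖) :=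
        (norm_add_le _ _).trans (by gcongr; exact norm_add_le _ _)
    _ ≤ 2 + (1 + a / s.re) := by rw [norm_one]; gcongr
    _ = _ := by ring

lemma norm_eulerInv_mul_exp_le {σ : ℝ} (hσ : 0 < σ) (h1 : σ ≤ 1) (n : ℕ) :
    ‖eulerInv (Complex.exp (-(σ : ℂ)))‖ * Real.exp (n * σ) ≤
      3 / 2 * Real.exp ((n - 1 / 24) * σ + hrBeta ^ 2 / (4 * σ)) := by
  have hs : 0 < (σ : ℂ).re := by simpa
  have hv : 1 ≤ (((hrBeta ^ 2 / 4 : ℝ) : ℂ) / (σ : ℂ)).re := by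
    rw [← Complex.ofReal_div, Complex.ofReal_re, le_div_iff₀ hσ]
    linarith [hrBeta_sq_bounds.1]
  have h := congrArg norm (eulerInv_mul_cexp hs n)
  have e1 : ‖Complex.exp (n * (σ : ℂ))‖ = Real.exp (n * σ) := by
    rw [Complex.norm_exp]; simp
  rw [norm_mul, e1] at h
  rw [h, norm_mul, norm_mul, norm_mul (Complex.exp _), Real.exp_add]
  have e2 : ‖Complex.exp (((n - 1 / 24 : ℝ) : ℂ) * σ)‖ = Real.exp ((n - 1 / 24) * σ) := by
    rw [Complex.norm_exp, Complex.re_ofReal_mul, Complex.ofReal_re]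
  have e3 : ‖Complex.exp (hrBeta ^ 2 / (4 * (σ : ℂ)))‖ = Real.exp (hrBeta ^ 2 / (4 * σ)) := by
    rw [Complex.norm_exp]
    congr 1
    exact_mod_cast Complex.ofReal_re _
  rw [e2, e3]
  have hE := norm_eulerInv_le_three_halves (q := Complex.exp (-(4 * (Real.pi : ℂ) ^ 2 / σ)))
    (by rw [norm_cexp_neg_four_pi_sq_div]; exact exp_neg_le_quarter (by linarith))
  have hP := norm_one_div_mul_sqrt_le hs (by
    rw [Complex.norm_real, Real.norm_of_nonneg hσ.le]; exact h1)
  calc _ ≤ 1 * (Real.exp (hrBeta ^ 2 / (4 * σ)) * (3 / 2)) * Real.exp ((n - 1 / 24) * σ) := by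
        gcongr
    _ = _ := by ring

lemma sq_norm_one_sub_cexp_lineAt (σ x : ℝ) :
    ‖1 - Complex.exp (-lineAt σ x)‖ ^ 2 =
      (1 - Real.exp (-σ)) ^ 2 + 4 * Real.exp (-σ) * Real.sin (Real.pi * x) ^ 2 := by
  rw [← Complex.normSq_eq_norm_sq, Complex.normSq_apply]
  have hre : (-lineAt σ x).re = -σ := by simp [lineAt_re]
  have him : (-lineAt σ x).im = -(2 * (Real.pi * x)) := by simp [lineAt_im, mul_assoc]
  rw [Complex.sub_re, Complex.sub_im, Complex.exp_re, Complex.exp_im, hre, him, Complex.one_re,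
    Complex.one_im, Real.cos_neg, Real.sin_neg, Real.cos_two_mul, Real.sin_two_mul]
  have := Real.sin_sq_add_cos_sq (Real.pi * x)
  have h2 : Real.cos (Real.pi * x) ^ 2 = 1 - Real.sin (Real.pi * x) ^ 2 := by linarith
  linear_combination (4 * Real.exp (-σ) ^ 2 * Real.cos (Real.pi * x) ^ 2 -
    4 * Real.exp (-σ)) * this

lemma norm_div_one_sub_le {σ x x0 : ℝ} (hσ : 0 < σ) (hx0 : 0 < x0) (hx : x0 ≤ |x|)
    (hx2 : |x| ≤ 1 / 2) :
    ‖Complex.exp (-lineAt σ x) / (1 - Complex.exp (-lineAt σ x))‖ ≤ 1 / (4 * x0) := by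
  have hr : Real.exp (-σ) < 1 := by simpa using hσ
  have hr0 := Real.exp_pos (-σ)
  rw [norm_div, norm_cexp_neg_lineAt]
  have hsin : 2 * x0 ≤ |Real.sin (Real.pi * x)| := by
    have hp := Real.pi_pos
    have h := Real.mul_le_sin (x := Real.pi * |x|) (by positivity) (by nlinarith)
    have h2 : |Real.sin (Real.pi * x)| = |Real.sin (Real.pi * |x|)| := by
      rcases abs_cases x with ⟨e, -⟩ | ⟨e, -⟩ <;> rw [e]
      rw [mul_neg, Real.sin_neg, abs_neg]
    rw [h2]
    refine le_trans ?_ (le_abs_self _)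
    refine le_trans ?_ h
    rw [← mul_assoc, div_mul_cancel₀ _ hp.ne']
    gcongr
  have hsq : (4 * x0 * Real.exp (-σ)) ^ 2 ≤ ‖1 - Complex.exp (-lineAt σ x)‖ ^ 2 := by
    rw [sq_norm_one_sub_cexp_lineAt]
    have h3 : (2 * x0) ^ 2 ≤ Real.sin (Real.pi * x) ^ 2 := by
      rw [← sq_abs (Real.sin _)]; gcongr
    have h4 := mul_le_mul_of_nonneg_left h3 hr0.le
    have h5 : Real.exp (-σ) ^ 2 ≤ Real.exp (-σ) := by nlinarith
    nlinarith [sq_nonneg (1 - Real.exp (-σ)), mul_le_mul_of_nonneg_left h5 (sq_nonneg x0)]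
  have h6 := (pow_le_pow_iff_left₀ (by positivity) (norm_nonneg _) two_ne_zero).mp hsq
  have h7 : 0 < 4 * x0 * Real.exp (-σ) := by positivity
  rw [div_le_div_iff₀ (by linarith) (by positivity)]
  linarith

lemma inv_sub_one_le_div {σ : ℝ} (hσ : 0 < σ) :
    1 / σ - 1 ≤ Real.exp (-σ) / (1 - Real.exp (-σ)) := by
  have h := Real.one_sub_le_exp_neg σ
  have hr : Real.exp (-σ) < 1 := by simpa using hσ
  rw [le_div_iff₀ (by linarith), sub_mul, div_mul_eq_mul_div, one_mul, sub_le_iff_le_add,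
    div_le_iff₀ hσ]
  linarith

lemma norm_eulerInv_mul_cexp_le {σ x x0 : ℝ} (hσ : 0 < σ) (h1 : σ < 1) (hx0 : 0 < x0)
    (hx : x0 ≤ |x|) (hx2 : |x| ≤ 1 / 2) (n : ℕ) :
    ‖eulerInv (Complex.exp (-lineAt σ x)) * Complex.exp (n * lineAt σ x)‖ ≤
      3 / 2 * Real.exp ((n - 1 / 24) * σ + hrBeta ^ 2 / (4 * σ) + (1 / (4 * x0) - (1 / σ - 1))) := by
  have hr : ‖Complex.exp (-lineAt σ x)‖ = Real.exp (-σ) := norm_cexp_neg_lineAt σ x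
  have hlt : Real.exp (-σ) < 1 := by simpa using hσ
  have h := norm_eulerInv_le (q := Complex.exp (-lineAt σ x)) (by rw [hr]; exact hlt)
  rw [hr] at h
  have e1 : ‖Complex.exp (n * lineAt σ x)‖ = Real.exp (n * σ) := by
    rw [Complex.norm_exp]; simp [lineAt_re]
  rw [norm_mul, e1]
  have e2 : ((Real.exp (-σ) : ℝ) : ℂ) = Complex.exp (-(σ : ℂ)) := by push_cast; rfl
  rw [e2] at h
  have h3 := (Complex.re_le_norm _).trans (norm_div_one_sub_le hσ hx0 hx hx2)
  have h4 := inv_sub_one_le_div hσ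
  calc _ ≤ ‖eulerInv (Complex.exp (-(σ : ℂ)))‖ * Real.exp (1 / (4 * x0) - (1 / σ - 1)) *
        Real.exp (n * σ) := by
        refine mul_le_mul_of_nonneg_right (h.trans ?_) (Real.exp_pos _).le
        gcongr
    _ = ‖eulerInv (Complex.exp (-(σ : ℂ)))‖ * Real.exp (n * σ) *
        Real.exp (1 / (4 * x0) - (1 / σ - 1)) := by ring
    _ ≤ _ := by
      rw [Real.exp_add _ (_ - _), ← mul_assoc]
      exact mul_le_mul_of_nonneg_right (norm_eulerInv_mul_exp_le hσ h1.le n) (Real.exp_pos _).le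

lemma norm_hrIntegrand_le {σ x N : ℝ} (hσ : 0 < σ) (hx : 5 * σ / Real.pi ≤ |x|) :
    ‖hrIntegrand N (lineAt σ x)‖ ≤
      2 * Real.exp (hrBeta ^ 2 / (40 * σ) + N * σ) * |x| ^ (-(3 / 2) : ℝ) := by
  have hp := Real.pi_pos
  have hp3 := Real.pi_gt_three
  have h4 := four_lt_sqrt_two_mul_pi
  have hb := hrBeta_sq_bounds
  have hx0 : 0 < |x| := lt_of_lt_of_le (by positivity) hx
  set y := ‖lineAt σ x‖ with hy
  have hy2 : y ^ 2 = σ ^ 2 + (2 * Real.pi * x) ^ 2 := sq_norm_lineAt σ x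
  have hyx : 2 * Real.pi * |x| ≤ y := by
    refine abs_le_of_sq_le_sq' ?_ (norm_nonneg _) |>.2
    rw [hy2, mul_pow _ |x|, sq_abs, ← mul_pow]
    nlinarith
  have hy10 : 10 * σ ≤ y := by
    rw [div_le_iff₀ hp] at hx
    linarith
  have hy0 : 0 < y := by linarith
  have hs : 0 < (lineAt σ x).re := by rw [lineAt_re]; exact hσ
  have hL := norm_laplaceSymbol_le hrBeta hs
  have e1 : ‖Complex.exp (N * lineAt σ x)‖ = Real.exp (N * σ) := by
    rw [Complex.norm_exp, Complex.re_ofReal_mul, lineAt_re]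
  rw [hrIntegrand, norm_mul, norm_mul, e1, norm_div, norm_one, Complex.norm_real,
    Real.norm_of_nonneg (by linarith)]
  have e2 : √(Real.pi * y) * (hrBeta ^ 2 / (4 * y)) ^ 2 =
      √Real.pi * (hrBeta ^ 2 / 4) ^ 2 * y ^ (-(3 / 2) : ℝ) := by
    rw [Real.sqrt_mul hp.le, show (-(3 / 2) : ℝ) = 1 / 2 - 2 by norm_num, Real.rpow_sub hy0,
      ← Real.sqrt_eq_rpow, Real.rpow_ofNat]
    field_simp
  have e3 : y ^ (-(3 / 2) : ℝ) ≤ |x| ^ (-(3 / 2) : ℝ) :=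
    Real.rpow_le_rpow_of_nonpos hx0 (by nlinarith) (by norm_num)
  have e4 : Real.exp (hrBeta ^ 2 / (4 * y)) ≤ Real.exp (hrBeta ^ 2 / (40 * σ)) := by
    rw [Real.exp_le_exp]
    exact div_le_div_of_nonneg_left (by positivity) (by positivity) (by linarith)
  have e5 : √Real.pi ≤ 2 := by
    rw [Real.sqrt_le_left (by norm_num)]
    linarith [Real.pi_lt_d6]
  have e6 : (hrBeta ^ 2 / 4) ^ 2 ≤ 4 := by nlinarith
  calc _ ≤ 1 / 4 * (√(Real.pi * y) * ((hrBeta ^ 2 / (4 * y)) ^ 2 *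
        Real.exp (hrBeta ^ 2 / (4 * y))) * Real.exp (N * σ)) := by
        gcongr
    _ = 1 / 4 * (√Real.pi * (hrBeta ^ 2 / 4) ^ 2 * y ^ (-(3 / 2) : ℝ) *
        Real.exp (hrBeta ^ 2 / (4 * y)) * Real.exp (N * σ)) := by
        linear_combination (1 / 4 * Real.exp (hrBeta ^ 2 / (4 * y)) * Real.exp (N * σ)) * e2
    _ ≤ 1 / 4 * (2 * 4 * |x| ^ (-(3 / 2) : ℝ) *
        Real.exp (hrBeta ^ 2 / (40 * σ)) * Real.exp (N * σ)) := by
        gcongr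
    _ = _ := by rw [Real.exp_add]; ring

lemma integral_hrIntegrand {σ N : ℝ} (hσ : 0 < σ) (hN : 0 < N) :
    ∫ x, hrIntegrand N (lineAt σ x) = (invDensity hrBeta N / (√2 * Real.pi) : ℝ) := by
  simp only [hrIntegrand]
  rw [integral_const_mul, integral_laplaceSymbol hrBeta_pos.le hσ hN]
  push_cast
  ring

lemma continuous_hrIntegrand_lineAt {σ : ℝ} (N : ℝ) (hσ : 0 < σ) :
    Continuous fun x ↦ hrIntegrand N (lineAt σ x) := by
  have h := continuous_laplaceSymbol_lineAt hrBeta hσ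
  have h2 := continuous_lineAt σ
  unfold hrIntegrand
  fun_prop

lemma norm_setIntegral_le_rpow {g : ℝ → ℂ} {K c : ℝ} (hc : 0 < c)
    (h : ∀ x, c < x → ‖g x‖ ≤ K * x ^ (-(3 / 2) : ℝ)) :
    ‖∫ x in Ioi c, g x‖ ≤ K * (2 * c ^ (-(1 / 2) : ℝ)) := by
  have hi : IntegrableOn (fun x : ℝ ↦ K * x ^ (-(3 / 2) : ℝ)) (Ioi c) :=
    (integrableOn_Ioi_rpow_of_lt (by norm_num) hc).const_mul K
  refine (norm_integral_le_of_norm_le hi ?_).trans (le_of_eq ?_)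
  · exact (ae_restrict_iff' measurableSet_Ioi).mpr (Eventually.of_forall h)
  · rw [integral_const_mul, integral_Ioi_rpow_of_lt (by norm_num) hc,
      show (-(3 / 2) + 1 : ℝ) = -(1 / 2) by norm_num]
    ring

end CircleMethod

section CircleMethodError
open Filter Topology MeasureTheory Set

lemma integrable_hrIntegrand_lineAt {σ : ℝ} (N : ℝ) (hσ : 0 < σ) :
    Integrable fun x ↦ hrIntegrand N (lineAt σ x) := by
  refine ((integrable_laplaceSymbol hrBeta hσ).norm.mul_const (Real.exp (N * σ))).mono'
    (continuous_hrIntegrand_lineAt N hσ).aestronglyMeasurable (Eventually.of_forall fun x ↦ ?_)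
  have h4 := four_lt_sqrt_two_mul_pi
  rw [hrIntegrand, norm_mul, norm_mul, Complex.norm_exp, Complex.re_ofReal_mul, lineAt_re,
    norm_div, norm_one, Complex.norm_real, Real.norm_of_nonneg (by linarith)]
  refine mul_le_of_le_one_left (by positivity) ?_
  rw [div_le_one (by linarith)]
  linarith

lemma integral_split {f g : ℝ → ℂ} (hf : Continuous f) (hg : Integrable g) (hgc : Continuous g)
    (c d : ℝ) :
    (∫ x in (-d)..d, f x) - ∫ x, g x = (∫ x in (-c)..c, (f x - g x)) +
      ((∫ x in (-d)..(-c), f x) + ∫ x in c..d, f x) -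
      ((∫ x in Ioi c, g (-x)) + ∫ x in Ioi c, g x) := by
  have h1 : (∫ x in (-d)..d, f x) = (∫ x in (-d)..(-c), f x) + (∫ x in (-c)..c, f x) +
      ∫ x in c..d, f x := by
    rw [intervalIntegral.integral_add_adjacent_intervals (hf.intervalIntegrable _ _)
      (hf.intervalIntegrable _ _), intervalIntegral.integral_add_adjacent_intervals
      (hf.intervalIntegrable _ _) (hf.intervalIntegrable _ _)]
  have h2 := intervalIntegral.integral_Iic_sub_Iic (μ := volume) (a := -c) (b := c)
    hg.integrableOn hg.integrableOn
  have h3 := intervalIntegral.integral_Iic_add_Ioi (μ := volume) (b := c)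
    hg.integrableOn hg.integrableOn
  rw [h1, intervalIntegral.integral_sub (hf.intervalIntegrable _ _) (hgc.intervalIntegrable _ _),
    integral_comp_neg_Ioi, ← h3, ← h2]
  ring

lemma abs_invDensity_sub_hrMain_le {w : ℝ} (hw : 1 ≤ w) (hX : 250 ≤ hrBeta * w) :
    |invDensity hrBeta (w ^ 2) / (√2 * Real.pi) - hrMain w| ≤
      Real.exp (3 / 4 * (hrBeta * w)) := by
  have h4 := four_lt_sqrt_two_mul_pi
  set X := hrBeta * w with hXd
  have hw0 : 0 < w := by linarith
  have hc : 0 < √2 * Real.pi := by linarith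
  have key : invDensity hrBeta (w ^ 2) / (√2 * Real.pi) - hrMain w =
      (1 - X ^ 2 / 2 - (X + 1) * Real.exp (-X) / 2) / (2 * w ^ 3 * (√2 * Real.pi)) := by
    rw [invDensity, coshQuotDeriv, Real.sqrt_sq hw0.le, hrMain, ← hXd, Real.sinh_eq, Real.cosh_eq]
    have := Real.pi_pos
    field_simp
    ring
  rw [key, abs_div]
  have hw3 : 1 ≤ w ^ 3 := one_le_pow₀ hw
  have hd : 1 ≤ 2 * w ^ 3 * (√2 * Real.pi) := by nlinarith
  rw [abs_of_pos (show 0 < 2 * w ^ 3 * (√2 * Real.pi) by linarith)]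
  refine (div_le_self (abs_nonneg _) hd).trans ?_
  have he : Real.exp (-X) ≤ 1 := by rw [Real.exp_le_one_iff]; linarith
  have he0 := Real.exp_pos (-X)
  have h := sq_quadratic_le_exp (y := 3 / 8 * X) (by linarith)
  rw [show 2 * (3 / 8 * X) = 3 / 4 * X by ring] at h
  have h5 : X ^ 2 ≤ (1 + 3 / 8 * X + (3 / 8 * X) ^ 2 / 2) ^ 2 := by
    refine pow_le_pow_left₀ (by linarith) ?_ 2
    nlinarith
  have h6 : (X + 1) * Real.exp (-X) ≤ (X + 1) * 1 := by gcongr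
  have h7 : 0 ≤ (X + 1) * Real.exp (-X) := by positivity
  rw [abs_le]
  constructor <;> nlinarith

lemma minor_arc_exponent_le {X u : ℝ} (hX : 250 ≤ X) (hu : 0.3039 * X ≤ u) :
    1 / 2 + (X / 2 + X / 2 + (Real.pi / 20 * u - (u - 1))) ≤ 3 / 4 * X := by
  have hp4 := Real.pi_lt_d6
  have h1 : Real.pi / 20 * u ≤ 0.15708 * u := by
    gcongr
    · linarith
    · linarith
  linarith

lemma rpow_neg_half_le {c X : ℝ} (hc : 0 < c) (hX : 0 < X) (h : 1 ≤ c * X ^ 2) :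
    c ^ (-(1 / 2) : ℝ) ≤ X := by
  rw [Real.rpow_neg hc.le, ← Real.sqrt_eq_rpow]
  refine inv_le_of_inv_le₀ hX (Real.le_sqrt_of_sq_le ?_)
  rwa [inv_pow, inv_le_iff_one_le_mul₀ (by positivity)]

lemma eight_mul_le_exp {X : ℝ} (hX : 250 ≤ X) : 8 * X ≤ Real.exp (2 * (X / 10)) := by
  have h2 := sq_quadratic_le_exp (y := X / 10) (by linarith)
  have : X ≤ 1 + X / 10 + (X / 10) ^ 2 / 2 := by nlinarith
  nlinarith

set_option maxHeartbeats 1000000 in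
/-- The Hardy-Ramanujan formula with an explicit error term. -/
lemma abs_partitionFn_sub_hrMain_le {n : ℕ} {w : ℝ} (hw : 1 ≤ w) (hn : w ^ 2 = n - 1 / 24)
    (hX : 250 ≤ hrBeta * w) :
    |(partitionFn n : ℝ) - hrMain w| ≤ 4 * Real.exp (3 / 4 * (hrBeta * w)) := by
  set X := hrBeta * w with hXd
  have hp := Real.pi_pos
  have hp3 := Real.pi_gt_d6
  have hp4 := Real.pi_lt_d6
  have hb := hrBeta_pos
  have hb2 := hrBeta_sq_bounds
  have hX0 : 0 < X := by linarith
  have hw0 : 0 < w := by linarith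
  set σ := hrBeta ^ 2 / (2 * X) with hσd
  have hσ : 0 < σ := by positivity
  have hσX : σ * X = hrBeta ^ 2 / 2 := by rw [hσd]; field_simp
  have hσ1 : σ ≤ 1 / 75 := by
    rw [hσd, div_le_iff₀ (by positivity)]
    linarith
  have hNσ : ((n : ℝ) - 1 / 24) * σ = X / 2 := by
    rw [← hn, hσd, hXd]; field_simp
  have haσ : hrBeta ^ 2 / (4 * σ) = X / 2 := by
    rw [hσd]; field_simp; norm_num
  have hiσ : 1 / σ = 2 * X / hrBeta ^ 2 := by
    rw [hσd]; field_simp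
  set c := 5 * σ / Real.pi with hc
  have hc0 : 0 < c := by positivity
  have hcpi : c * Real.pi = 5 * σ := by rw [hc]; field_simp
  have hc2 : c ≤ 1 / 2 := by
    rw [hc, div_le_iff₀ hp]; linarith
  set F : ℝ → ℂ := fun x ↦ eulerInv (Complex.exp (-lineAt σ x)) * Complex.exp (n * lineAt σ x)
    with hF
  set G : ℝ → ℂ := fun x ↦ hrIntegrand (n - 1 / 24) (lineAt σ x) with hG
  have hFc : Continuous F := by
    have h1 := continuous_eulerInv_lineAt hσ
    have h2 := continuous_lineAt σ
    rw [hF]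
    fun_prop
  have hsplit := integral_split hFc (integrable_hrIntegrand_lineAt (n - 1 / 24) hσ)
    (continuous_hrIntegrand_lineAt _ hσ) c (1 / 2)
  have hN0 : 0 < (n : ℝ) - 1 / 24 := by rw [← hn]; positivity
  rw [← partitionFn_eq_integral hσ n, integral_hrIntegrand hσ hN0] at hsplit
  have bA : ‖∫ x in (-c)..c, (F x - G x)‖ ≤ Real.exp (3 / 4 * X) := by
    have hpt : ∀ x ∈ uIoc (-c) c, ‖F x - G x‖ ≤ Real.exp (X / 2) * (3 + X / 2) := by
      intro x hx
      rw [uIoc_of_le (by linarith)] at hx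
      have hxc : |x| ≤ c := abs_le.mpr ⟨hx.1.le, hx.2⟩
      have hs : 0 < (lineAt σ x).re := by rw [lineAt_re]; exact hσ
      have hsq : ‖lineAt σ x‖ ^ 2 ≤ 101 * σ ^ 2 := by
        have h1 : (Real.pi * |x|) ^ 2 ≤ (5 * σ) ^ 2 := by
          refine pow_le_pow_left₀ (by positivity) ?_ 2
          nlinarith
        rw [mul_pow, sq_abs] at h1
        rw [sq_norm_lineAt]
        nlinarith
      have hn1 : ‖lineAt σ x‖ ≤ 1 := by
        rw [← sq_le_one_iff₀ (norm_nonneg _)]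
        nlinarith
      have hnpos : 0 < ‖lineAt σ x‖ ^ 2 := by
        rw [sq_norm_lineAt]; positivity
      have h := norm_sub_hrIntegrand_le (n := n) hs hn1 (by
        rw [re_ofReal_div, lineAt_re, le_div_iff₀ hnpos]
        nlinarith)
      rw [lineAt_re, hNσ] at h
      refine h.trans (le_of_eq ?_)
      rw [div_div, haσ]
    refine (intervalIntegral.norm_integral_le_of_norm_le_const hpt).trans ?_
    rw [show 3 / 4 * X = X / 2 + X / 4 by ring, Real.exp_add]
    have h2 := Real.quadratic_le_exp_of_nonneg (show 0 ≤ X / 4 by linarith)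
    have h3 : |c - -c| ≤ 1 := by rw [abs_of_pos (by linarith)]; linarith
    calc _ ≤ Real.exp (X / 2) * (3 + X / 2) * 1 := by gcongr
      _ ≤ _ := by
        rw [mul_one]
        gcongr
        nlinarith
  have hptB : ∀ x, c ≤ |x| → |x| ≤ 1 / 2 → ‖F x‖ ≤ Real.exp (3 / 4 * X) := by
    intro x hx hx2
    have h := norm_eulerInv_mul_cexp_le hσ (by linarith) hc0 hx hx2 n
    rw [hNσ, haσ] at h
    refine h.trans ?_
    have e1 : 1 / (4 * c) = Real.pi / 20 * (1 / σ) := by rw [hc]; field_simp; norm_num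
    have e2 : 0.3039 * X ≤ 1 / σ := by
      rw [hiσ, le_div_iff₀ (by positivity)]
      nlinarith
    have e3 : 3 / 2 ≤ Real.exp (1 / 2) := by
      have := Real.add_one_le_exp (1 / 2 : ℝ); linarith
    rw [e1]
    calc _ ≤ Real.exp (1 / 2) * Real.exp (X / 2 + X / 2 +
          (Real.pi / 20 * (1 / σ) - (1 / σ - 1))) := by gcongr
      _ ≤ _ := by
        rw [← Real.exp_add, Real.exp_le_exp]
        exact minor_arc_exponent_le hX e2
  have bB1 : ‖∫ x in (-(1 / 2))..(-c), F x‖ ≤ Real.exp (3 / 4 * X) * (1 / 2) := by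
    refine (intervalIntegral.norm_integral_le_of_norm_le_const (C := Real.exp (3 / 4 * X))
      fun x hx ↦ ?_).trans ?_
    · rw [uIoc_of_le (by linarith)] at hx
      have hx0 : |x| = -x := abs_of_nonpos (by linarith [hx.2])
      exact hptB x (by rw [hx0]; linarith [hx.2]) (by rw [hx0]; linarith [hx.1])
    · gcongr
      rw [abs_of_nonneg (by linarith)]; linarith
  have bB2 : ‖∫ x in c..(1 / 2), F x‖ ≤ Real.exp (3 / 4 * X) * (1 / 2) := by
    refine (intervalIntegral.norm_integral_le_of_norm_le_const (C := Real.exp (3 / 4 * X))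
      fun x hx ↦ ?_).trans ?_
    · rw [uIoc_of_le (by linarith)] at hx
      have hx0 : |x| = x := abs_of_nonneg (by linarith [hx.1])
      exact hptB x (by rw [hx0]; linarith [hx.1]) (by rw [hx0]; linarith [hx.2])
    · gcongr
      rw [abs_of_nonneg (by linarith)]; linarith
  have hptC : ∀ x, c ≤ |x| → ‖G x‖ ≤ 2 * Real.exp (11 / 20 * X) * |x| ^ (-(3 / 2) : ℝ) := by
    intro x hx
    have h := norm_hrIntegrand_le (N := n - 1 / 24) hσ hx
    rw [hNσ, show hrBeta ^ 2 / (40 * σ) = X / 20 by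
      rw [show (40 : ℝ) * σ = 4 * σ * 10 by ring, ← div_div, haσ]; ring,
      show X / 20 + X / 2 = 11 / 20 * X by ring] at h
    exact h
  have hcX : 2 * Real.exp (11 / 20 * X) * (2 * c ^ (-(1 / 2) : ℝ)) ≤
      Real.exp (3 / 4 * X) * (1 / 2) := by
    have h1 : c ^ (-(1 / 2) : ℝ) ≤ X := by
      refine rpow_neg_half_le hc0 hX0 ?_
      rw [hc, div_mul_eq_mul_div, le_div_iff₀ hp]
      nlinarith
    have h3 := eight_mul_le_exp hX
    calc _ ≤ 2 * Real.exp (11 / 20 * X) * (2 * X) := by gcongr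
      _ = Real.exp (11 / 20 * X) * (8 * X) * (1 / 2) := by ring
      _ ≤ Real.exp (11 / 20 * X) * Real.exp (2 * (X / 10)) * (1 / 2) := by
        gcongr
      _ = _ := by rw [← Real.exp_add]; ring_nf
  have bC1 : ‖∫ x in Ioi c, G x‖ ≤ Real.exp (3 / 4 * X) * (1 / 2) := by
    refine (norm_setIntegral_le_rpow hc0 fun x hx ↦ ?_).trans hcX
    have h := hptC x (by rw [abs_of_pos (by linarith)]; exact hx.le)
    rwa [abs_of_pos (by linarith)] at h
  have bC2 : ‖∫ x in Ioi c, G (-x)‖ ≤ Real.exp (3 / 4 * X) * (1 / 2) := by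
    refine (norm_setIntegral_le_rpow hc0 fun x hx ↦ ?_).trans hcX
    have h := hptC (-x) (by rw [abs_neg, abs_of_pos (by linarith)]; exact hx.le)
    rwa [abs_neg, abs_of_pos (by linarith)] at h
  have bD := abs_invDensity_sub_hrMain_le hw hX
  rw [hn, ← hXd] at bD
  have bE : |(partitionFn n : ℝ) - invDensity hrBeta (n - 1 / 24) / (√2 * Real.pi)| ≤
      3 * Real.exp (3 / 4 * X) := by
    have e : ‖(partitionFn n : ℂ) - ((invDensity hrBeta (n - 1 / 24) / (√2 * Real.pi) : ℝ) : ℂ)‖ =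
        |(partitionFn n : ℝ) - invDensity hrBeta (n - 1 / 24) / (√2 * Real.pi)| := by
      rw [← Complex.ofReal_natCast, ← Complex.ofReal_sub, Complex.norm_real, Real.norm_eq_abs]
    rw [← e, hsplit]
    calc _ ≤ _ := norm_sub_le _ _
      _ ≤ _ := add_le_add (norm_add_le _ _) (norm_add_le _ _)
      _ ≤ _ := add_le_add (add_le_add bA (norm_add_le _ _)) (add_le_add bC2 bC1)
      _ ≤ _ := by linarith
  calc _ = |((partitionFn n : ℝ) - invDensity hrBeta (n - 1 / 24) / (√2 * Real.pi)) +
        (invDensity hrBeta (n - 1 / 24) / (√2 * Real.pi) - hrMain w)| := by ring_nf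
    _ ≤ _ := abs_add_le _ _
    _ ≤ _ := by linarith

end CircleMethodError

section Differences
open Filter Topology Set Metric

lemma norm_fwdDiff_le_of_ball {f : ℂ → ℂ} {c : ℂ} {R ρ B : ℝ} (hρ : 0 < ρ)
    (hf : DifferentiableOn ℂ f (ball c R)) (hB : ∀ z ∈ ball c R, ‖f z‖ ≤ B) :
    DifferentiableOn ℂ (fwdDiff 1 f) (ball c (R - ρ - 1)) ∧
      ∀ z ∈ ball c (R - ρ - 1), ‖fwdDiff 1 f z‖ ≤ B / ρ := by
  have hshift : ∀ z ∈ ball c (R - ρ - 1), z + 1 ∈ ball c (R - ρ) := by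
    intro z hz
    rw [mem_ball, dist_eq_norm] at hz ⊢
    calc ‖z + 1 - c‖ = ‖(z - c) + 1‖ := by ring_nf
      _ ≤ ‖z - c‖ + ‖(1 : ℂ)‖ := norm_add_le _ _
      _ < R - ρ := by rw [norm_one]; linarith
  have hsub : ball c (R - ρ) ⊆ ball c R := ball_subset_ball (by linarith)
  have hsub2 : ball c (R - ρ - 1) ⊆ ball c (R - ρ) := ball_subset_ball (by linarith)
  refine ⟨?_, fun z hz ↦ ?_⟩
  · refine DifferentiableOn.sub ?_ (hf.mono (hsub2.trans hsub))
    exact hf.comp (differentiableOn_id.add_const 1) fun z hz ↦ hsub (hshift z hz)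
  · have hd : ∀ w ∈ ball c (R - ρ), ‖deriv f w‖ ≤ B / ρ := by
      intro w hw
      have hcl : closedBall w ρ ⊆ ball c R := by
        refine closedBall_subset_ball' ?_
        rw [mem_ball] at hw
        linarith
      refine Complex.norm_deriv_le_of_forall_mem_sphere_norm_le hρ ?_
        fun y hy ↦ hB y (hcl (sphere_subset_closedBall hy))
      exact (hf.mono hcl).diffContOnCl_ball le_rfl
    have h := (convex_ball c (R - ρ)).norm_image_sub_le_of_norm_deriv_le
      (fun w hw ↦ hf.differentiableAt (isOpen_ball.mem_nhds (hsub hw))) hd (hsub2 hz) (hshift z hz)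
    simpa [fwdDiff] using h

lemma hasDerivAt_fwdDiff {f f' : ℝ → ℝ} {t : ℝ} (h : ∀ x, t < x → HasDerivAt f (f' x) x) :
    ∀ x, t < x → HasDerivAt (fwdDiff 1 f) (fwdDiff 1 f' x) x := fun x hx ↦
  ((h (x + 1) (by linarith)).comp_add_const x 1).sub (h x hx)

lemma exists_fwdDiff_eq {f f' : ℝ → ℝ} {t s : ℝ} (h : ∀ x, t < x → HasDerivAt f (f' x) x)
    (hs : t < s) : ∃ ξ ∈ Ioo s (s + 1), fwdDiff 1 f s = f' ξ := by
  obtain ⟨ξ, hξ, e⟩ := exists_hasDerivAt_eq_slope f f' (lt_add_one s)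
    (fun x hx ↦ (h x (by linarith [hx.1])).continuousAt.continuousWithinAt)
    (fun x hx ↦ h x (by linarith [hx.1]))
  exact ⟨ξ, hξ, by simp [e, fwdDiff]⟩

lemma fwdDiff_ofReal {f : ℝ → ℝ} {g : ℂ → ℂ} {t : ℝ} (h : ∀ x : ℝ, t < x → g x = f x) :
    ∀ x : ℝ, t < x → fwdDiff 1 g x = (fwdDiff 1 f x : ℝ) := by
  intro x hx
  have := h (x + 1) (by linarith)
  push_cast at this
  rw [fwdDiff, fwdDiff, this, h x hx]
  push_cast
  rfl

end Differences

section SqrtDifferences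
open Set

lemma fwdDiff_sqrt_bounds {t : ℝ} (ht : 0 < t) :
    fwdDiff 1 (fwdDiff 1 Real.sqrt) t ≤ -(1 / 4) * (t + 2) ^ (-(3 / 2) : ℝ) ∧
      -(1 / 4) * t ^ (-(3 / 2) : ℝ) ≤ fwdDiff 1 (fwdDiff 1 Real.sqrt) t ∧
      |fwdDiff 1 (fwdDiff 1 (fwdDiff 1 (fwdDiff 1 Real.sqrt))) t| ≤
        15 / 16 * t ^ (-(7 / 2) : ℝ) := by
  have h1 : ∀ x : ℝ, t / 2 < x → HasDerivAt Real.sqrt (1 / 2 * x ^ (-(1 / 2) : ℝ)) x := by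
    intro x hx
    have h0 : 0 < x := by linarith
    convert Real.hasDerivAt_sqrt h0.ne' using 1
    rw [Real.rpow_neg h0.le, ← Real.sqrt_eq_rpow, one_div_mul_eq_div, div_eq_mul_inv, one_div,
      mul_inv, mul_comm]
  have hk : ∀ (a b r s : ℝ), a * r = b → r - 1 = s → ∀ x : ℝ, t / 2 < x →
      HasDerivAt (fun y : ℝ ↦ a * y ^ r) (b * x ^ s) x := by
    intro a b r s hb hs x hx
    rw [← hb, ← hs, mul_assoc]
    exact (Real.hasDerivAt_rpow_const (Or.inl (by linarith))).const_mul a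
  have h2 := hk (1 / 2) (-(1 / 4)) (-(1 / 2)) (-(3 / 2)) (by norm_num) (by norm_num)
  have h3 := hk (-(1 / 4)) (3 / 8) (-(3 / 2)) (-(5 / 2)) (by norm_num) (by norm_num)
  have h4 := hk (3 / 8) (-(15 / 16)) (-(5 / 2)) (-(7 / 2)) (by norm_num) (by norm_num)
  have ht2 : t / 2 < t := by linarith
  refine and_assoc.mp ⟨?_, ?_⟩
  · obtain ⟨ξ, hξ, e⟩ := exists_fwdDiff_eq (hasDerivAt_fwdDiff h1) ht2
    obtain ⟨η, hη, e2⟩ := exists_fwdDiff_eq h2 (s := ξ) (by linarith [hξ.1])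
    rw [e, e2]
    have m1 : (t + 2) ^ (-(3 / 2) : ℝ) ≤ η ^ (-(3 / 2) : ℝ) :=
      Real.rpow_le_rpow_of_nonpos (by linarith [hξ.1, hη.1]) (by linarith [hξ.2, hη.2])
        (by norm_num)
    have m2 : η ^ (-(3 / 2) : ℝ) ≤ t ^ (-(3 / 2) : ℝ) :=
      Real.rpow_le_rpow_of_nonpos ht (by linarith [hξ.1, hη.1]) (by norm_num)
    constructor <;> linarith
  · obtain ⟨ξ, hξ, e⟩ := exists_fwdDiff_eq
      (hasDerivAt_fwdDiff (hasDerivAt_fwdDiff (hasDerivAt_fwdDiff h1))) ht2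
    obtain ⟨η, hη, e2⟩ := exists_fwdDiff_eq (hasDerivAt_fwdDiff (hasDerivAt_fwdDiff h2))
      (s := ξ) (by linarith [hξ.1])
    obtain ⟨ζ, hζ, e3⟩ := exists_fwdDiff_eq (hasDerivAt_fwdDiff h3)
      (s := η) (by linarith [hξ.1, hη.1])
    obtain ⟨θ, hθ, e4⟩ := exists_fwdDiff_eq h4 (s := ζ) (by linarith [hξ.1, hη.1, hζ.1])
    rw [e, e2, e3, e4]
    have hθt : t < θ := by linarith [hξ.1, hη.1, hζ.1, hθ.1]
    have m2 : θ ^ (-(7 / 2) : ℝ) ≤ t ^ (-(7 / 2) : ℝ) :=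
      Real.rpow_le_rpow_of_nonpos ht hθt.le (by norm_num)
    have m3 : 0 ≤ θ ^ (-(7 / 2) : ℝ) := Real.rpow_nonneg (by linarith) _
    rw [abs_of_nonpos (by linarith)]
    linarith

end SqrtDifferences

section LogDerivAlgebra

variable {x y : ℂ}

lemma norm_bounds_of_close (hx : 100 ≤ ‖x‖) (hu : ‖y - x‖ ≤ 1 / 50) :
    ‖y‖ ≤ 1.001 * ‖x‖ ∧ 0.999 * ‖x‖ ≤ ‖y‖ ∧ 0.99 * ‖x‖ ≤ ‖x - 1‖ ∧ 0.98 * ‖x‖ ≤ ‖y - 1‖ ∧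
      ‖x - 1‖ ≤ 1.01 * ‖x‖ := by
  have h1 : ‖y‖ ≤ ‖x‖ + ‖y - x‖ := by
    calc ‖y‖ = ‖x + (y - x)‖ := by ring_nf
      _ ≤ _ := norm_add_le _ _
  have h2 : ‖x‖ - ‖y - x‖ ≤ ‖y‖ := by
    have := norm_sub_norm_le x (x - y)
    rwa [sub_sub_cancel, norm_sub_rev x y] at this
  have h3 := norm_sub_norm_le x 1
  have h4 := norm_sub_norm_le y 1
  have h5 := norm_sub_le x 1
  rw [norm_one] at h3 h4 h5
  refine ⟨?_, ?_, ?_, ?_, ?_⟩ <;> linarith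

lemma norm_sub_logDeriv_le (hx : 100 ≤ ‖x‖) (hu : ‖y - x‖ ≤ 1 / 50) :
    ‖(1 / (y - 1) - 3 / y ^ 2) - (1 / (x - 1) - 3 / x ^ 2)‖ ≤ 1.1 * ‖y - x‖ / ‖x‖ ^ 2 := by
  obtain ⟨b1, b2, b3, b4, -⟩ := norm_bounds_of_close hx hu
  have hx0 : x ≠ 0 := norm_pos_iff.mp (by linarith)
  have hy0 : y ≠ 0 := norm_pos_iff.mp (by linarith)
  have hx1 : x - 1 ≠ 0 := norm_pos_iff.mp (by linarith)
  have hy1 : y - 1 ≠ 0 := norm_pos_iff.mp (by linarith)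
  have key : (1 / (y - 1) - 3 / y ^ 2) - (1 / (x - 1) - 3 / x ^ 2) =
      (y - x) * (3 * (x + y) / (x ^ 2 * y ^ 2) - 1 / ((y - 1) * (x - 1))) := by
    field_simp
    ring
  have hp : 0 < ‖x‖ := by linarith
  have c1 : ‖3 * (x + y) / (x ^ 2 * y ^ 2)‖ ≤ 0.07 / ‖x‖ ^ 2 := by
    rw [norm_div, norm_mul, norm_mul, norm_pow, norm_pow, Complex.norm_ofNat,
      div_le_div_iff₀ (by positivity) (by positivity)]
    have := norm_add_le x y
    have hy2 : 0.998 * ‖x‖ ^ 2 ≤ ‖y‖ ^ 2 := by nlinarith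
    calc _ ≤ 3 * (2.001 * ‖x‖) * ‖x‖ ^ 2 := by gcongr; linarith
      _ = 6.003 * ‖x‖ * ‖x‖ ^ 2 := by ring
      _ ≤ 0.06003 * ‖x‖ ^ 2 * ‖x‖ ^ 2 := by
        refine mul_le_mul_of_nonneg_right ?_ (by positivity)
        nlinarith
      _ ≤ _ := by nlinarith [mul_le_mul_of_nonneg_left hy2 (sq_nonneg ‖x‖), sq_nonneg (‖x‖ ^ 2)]
  have c2 : ‖1 / ((y - 1) * (x - 1))‖ ≤ 1.03 / ‖x‖ ^ 2 := by
    rw [norm_div, norm_one, norm_mul, div_le_div_iff₀ (by nlinarith) (by positivity)]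
    have : (0.98 * ‖x‖) * (0.995 * ‖x‖) ≤ ‖y - 1‖ * ‖x - 1‖ := by
      have h3 := norm_sub_norm_le x 1
      have h4 := norm_sub_norm_le y 1
      rw [norm_one] at h3 h4
      have h5 : 0.989 * ‖x‖ ≤ ‖y - 1‖ := by linarith
      have h6 : 0.99 * ‖x‖ ≤ ‖x - 1‖ := by linarith
      nlinarith
    nlinarith
  rw [key, norm_mul]
  calc _ ≤ ‖y - x‖ * (0.07 / ‖x‖ ^ 2 + 1.03 / ‖x‖ ^ 2) := by
        gcongr
        exact (norm_sub_le _ _).trans (add_le_add c1 c2)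
    _ = _ := by ring

lemma le_norm_one_sub_ratio (hx : 100 ≤ ‖x‖) (hu : ‖y - x‖ ≤ 1 / 50) :
    0.9 * ‖y - x‖ ≤ ‖1 - Complex.exp (x - y) * ((x - 1) * y ^ 3 / ((y - 1) * x ^ 3))‖ := by
  obtain ⟨b1, b2, b3, b4, -⟩ := norm_bounds_of_close hx hu
  have hx0 : x ≠ 0 := norm_pos_iff.mp (by linarith)
  have hx1 : x - 1 ≠ 0 := norm_pos_iff.mp (by linarith)
  have hy1 : y - 1 ≠ 0 := norm_pos_iff.mp (by linarith)
  have hp : 0 < ‖x‖ := by linarith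
  have hu' : ‖x - y‖ ≤ 1 / 50 := by rwa [norm_sub_rev]
  have key : 1 - Complex.exp (x - y) * ((x - 1) * y ^ 3 / ((y - 1) * x ^ 3)) =
      -(x - y) - (Complex.exp (x - y) - 1 - (x - y)) -
        Complex.exp (x - y) * ((y - x) * ((x * y * (x + y) - (x ^ 2 + x * y + y ^ 2)) /
          ((y - 1) * x ^ 3))) := by
    field_simp
    ring
  have h1 := Complex.norm_exp_sub_one_sub_id_le (x := x - y) (by linarith)
  have h2 : ‖Complex.exp (x - y)‖ ≤ 1.03 := by
    calc _ = ‖(Complex.exp (x - y) - 1 - (x - y)) + (1 + (x - y))‖ := by ring_nf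
      _ ≤ ‖x - y‖ ^ 2 + (1 + ‖x - y‖) := by
        refine (norm_add_le _ _).trans (add_le_add h1 ((norm_add_le _ _).trans ?_))
        rw [norm_one]
      _ ≤ _ := by nlinarith [norm_nonneg (x - y)]
  have h3 : ‖(x * y * (x + y) - (x ^ 2 + x * y + y ^ 2)) / ((y - 1) * x ^ 3)‖ ≤ 0.03 := by
    rw [norm_div, norm_mul, norm_pow, div_le_iff₀ (by positivity)]
    have hxy : ‖x * y * (x + y)‖ ≤ 1.001 * ‖x‖ ^ 2 * (2.001 * ‖x‖) := by
      rw [norm_mul, norm_mul]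
      have := norm_add_le x y
      refine mul_le_mul ?_ (by linarith) (norm_nonneg _) (by positivity)
      nlinarith
    have hq : ‖x ^ 2 + x * y + y ^ 2‖ ≤ 3.01 * ‖x‖ ^ 2 := by
      refine (norm_add_le _ _).trans ((add_le_add_left (norm_add_le _ _) _).trans ?_)
      rw [norm_pow, norm_mul, norm_pow]
      nlinarith [norm_nonneg y]
    have h4 : 0.98 * ‖x‖ * ‖x‖ ^ 3 ≤ ‖y - 1‖ * ‖x‖ ^ 3 := by gcongr
    have h5 : 100 * ‖x‖ ^ 3 ≤ ‖x‖ * ‖x‖ ^ 3 := by gcongr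
    have h6 : 100 * ‖x‖ ^ 2 ≤ ‖x‖ * ‖x‖ ^ 2 := by gcongr
    refine (norm_sub_le _ _).trans ?_
    nlinarith
  have h7 : ‖Complex.exp (x - y) * ((y - x) * ((x * y * (x + y) - (x ^ 2 + x * y + y ^ 2)) /
      ((y - 1) * x ^ 3)))‖ ≤ 1.03 * (‖y - x‖ * 0.03) := by
    rw [norm_mul, norm_mul]
    gcongr
  rw [key]
  have h8 := norm_sub_norm_le (-(x - y) - (Complex.exp (x - y) - 1 - (x - y)))
    (Complex.exp (x - y) * ((y - x) * ((x * y * (x + y) - (x ^ 2 + x * y + y ^ 2)) /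
      ((y - 1) * x ^ 3))))
  have h9 := norm_sub_norm_le (-(x - y)) (Complex.exp (x - y) - 1 - (x - y))
  rw [norm_neg] at h9
  have e := norm_sub_rev x y
  nlinarith [norm_nonneg (x - y)]

end LogDerivAlgebra

section LogDeriv
open Metric

/-- The function `β * √z` on the complex plane. -/
noncomputable def hrPhase (z : ℂ) : ℂ := hrBeta * z ^ (1 / 2 : ℂ)

/-- The logarithmic derivative of the first difference of `hrMain (√z)`, minus the derivative of
`β * √z`. -/
noncomputable def hrLogDeriv (z : ℂ) : ℂ :=
  hrBeta ^ 2 / (2 * hrPhase z ^ 2) * (-2 + 1 / (hrPhase z - 1)) +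
    hrBeta ^ 2 / 2 * ((1 / (hrPhase (z + 1) - 1) - 3 / hrPhase (z + 1) ^ 2) -
      (1 / (hrPhase z - 1) - 3 / hrPhase z ^ 2)) /
      (1 - Complex.exp (hrPhase z - hrPhase (z + 1)) *
        ((hrPhase z - 1) * hrPhase (z + 1) ^ 3 / ((hrPhase (z + 1) - 1) * hrPhase z ^ 3)))

lemma hrPhase_sq (z : ℂ) : hrPhase z ^ 2 = hrBeta ^ 2 * z := by
  rw [hrPhase, mul_pow, ← Complex.cpow_nat_mul]
  simp

lemma norm_hrPhase_sq (z : ℂ) : ‖hrPhase z‖ ^ 2 = hrBeta ^ 2 * ‖z‖ := by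
  rw [← norm_pow, hrPhase_sq, norm_mul, norm_pow, Complex.norm_real,
    Real.norm_of_nonneg hrBeta_pos.le]

lemma le_re_hrPhase {z : ℂ} {r : ℝ} (hz : r ^ 2 ≤ z.re) :
    hrBeta * r ≤ (hrPhase z).re := by
  rw [hrPhase, Complex.re_ofReal_mul]
  gcongr
  · exact hrBeta_pos.le
  have h1 : ((z ^ (1 / 2 : ℂ)) ^ 2).re = z.re := by
    rw [← Complex.cpow_nat_mul]; simp
  have h2 : 0 ≤ (z ^ (1 / 2 : ℂ)).re := by
    rw [show (1 / 2 : ℂ) = (2⁻¹ : ℂ) by norm_num, Complex.cpow_inv_two_re]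
    positivity
  rw [sq, Complex.mul_re] at h1
  nlinarith [mul_self_nonneg (z ^ (1 / 2 : ℂ)).im]

lemma hrPhase_add_one_sub {z : ℂ} (h : hrPhase z + hrPhase (z + 1) ≠ 0) :
    hrPhase (z + 1) - hrPhase z = hrBeta ^ 2 / (hrPhase z + hrPhase (z + 1)) := by
  rw [eq_div_iff h]
  linear_combination hrPhase_sq (z + 1) - hrPhase_sq z

lemma hrPhase_close {z : ℂ} (hz : 5000 ≤ z.re) :
    100 ≤ ‖hrPhase z‖ ∧ 0 < ‖hrPhase (z + 1) - hrPhase z‖ ∧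
      ‖hrPhase (z + 1) - hrPhase z‖ ≤ 1 / 50 := by
  have hb := hrBeta_bounds
  have h1 := le_re_hrPhase (z := z) (r := 70) (by linarith)
  have h2 := le_re_hrPhase (z := z + 1) (r := 70) (by simp; linarith)
  have h3 := Complex.re_le_norm (hrPhase z)
  have h4 := Complex.re_le_norm (hrPhase z + hrPhase (z + 1))
  rw [Complex.add_re] at h4
  have h5 : hrPhase z + hrPhase (z + 1) ≠ 0 := norm_pos_iff.mp (by linarith)
  have hb2 := hrBeta_sq_bounds
  rw [hrPhase_add_one_sub h5, norm_div, norm_pow, Complex.norm_real,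
    Real.norm_of_nonneg hrBeta_pos.le]
  refine ⟨by linarith, div_pos (by linarith) (by linarith), ?_⟩
  rw [div_le_iff₀ (by linarith)]
  linarith

lemma norm_hrLogDeriv_le {z : ℂ} (hz : 5000 ≤ z.re) : ‖hrLogDeriv z‖ ≤ 2 / ‖z‖ := by
  obtain ⟨h1, h2, h3⟩ := hrPhase_close hz
  have c1 := norm_sub_logDeriv_le h1 h3
  have c2 := le_norm_one_sub_ratio h1 h3
  have hb := hrBeta_pos
  have hz0 : 0 < ‖z‖ := by have := Complex.re_le_norm z; linarith
  have hb2 : ‖(hrBeta : ℂ)‖ = hrBeta := by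
    rw [Complex.norm_real, Real.norm_of_nonneg hb.le]
  rw [hrLogDeriv]
  refine (norm_add_le _ _).trans ?_
  have d1 : ‖(hrBeta : ℂ) ^ 2 / (2 * hrPhase z ^ 2) * (-2 + 1 / (hrPhase z - 1))‖ ≤
      1.1 / ‖z‖ := by
    rw [norm_mul, norm_div, norm_mul, norm_pow, norm_pow, norm_hrPhase_sq, hb2,
      Complex.norm_ofNat]
    have e : ‖(-2 : ℂ) + 1 / (hrPhase z - 1)‖ ≤ 2.2 := by
      refine (norm_add_le _ _).trans ?_
      have := (norm_bounds_of_close h1 h3).2.2.1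
      rw [norm_neg, Complex.norm_ofNat, norm_div, norm_one]
      have : 1 / ‖hrPhase z - 1‖ ≤ 1 / 5 := by
        apply one_div_le_one_div_of_le <;> linarith
      linarith
    calc _ ≤ hrBeta ^ 2 / (2 * (hrBeta ^ 2 * ‖z‖)) * 2.2 := by gcongr
      _ = _ := by field_simp; norm_num
  have d2 : ∀ a b : ℂ, ‖a‖ ≤ 1.1 * ‖hrPhase (z + 1) - hrPhase z‖ / ‖hrPhase z‖ ^ 2 →
      0.9 * ‖hrPhase (z + 1) - hrPhase z‖ ≤ ‖b‖ → ‖(hrBeta : ℂ) ^ 2 / 2 * a / b‖ ≤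
      0.9 / ‖z‖ := by
    intro a b ha hb'
    set u := ‖hrPhase (z + 1) - hrPhase z‖
    rw [norm_hrPhase_sq] at ha
    rw [norm_div, norm_mul, norm_div, norm_pow, hb2, Complex.norm_ofNat]
    calc _ ≤ hrBeta ^ 2 / 2 * (1.1 * u / (hrBeta ^ 2 * ‖z‖)) / (0.9 * u) := by gcongr
      _ = (1.1 / 1.8) / ‖z‖ := by field_simp; norm_num
      _ ≤ _ := by gcongr; norm_num
  refine (add_le_add d1 (d2 _ _ c1 c2)).trans (le_of_eq ?_)
  rw [← add_div]
  norm_num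

lemma differentiableAt_hrPhase {z : ℂ} (hz : 0 < z.re) : DifferentiableAt ℂ hrPhase z := by
  have : z ∈ Complex.slitPlane := Or.inl hz
  unfold hrPhase
  exact (differentiableAt_id.cpow_const this).const_mul _

lemma differentiableAt_hrLogDeriv {z : ℂ} (hz : 5000 ≤ z.re) :
    DifferentiableAt ℂ hrLogDeriv z := by
  obtain ⟨h1, h2, h3⟩ := hrPhase_close hz
  have c2 := le_norm_one_sub_ratio h1 h3
  obtain ⟨b1, b2, b3, b4, -⟩ := norm_bounds_of_close h1 h3
  have n1 : hrPhase z ≠ 0 := norm_pos_iff.mp (by linarith)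
  have n2 : hrPhase (z + 1) ≠ 0 := norm_pos_iff.mp (by linarith)
  have n3 : hrPhase z - 1 ≠ 0 := norm_pos_iff.mp (by linarith)
  have n4 : hrPhase (z + 1) - 1 ≠ 0 := norm_pos_iff.mp (by linarith)
  have n5 := norm_pos_iff.mp (lt_of_lt_of_le (by positivity) c2)
  have d1 : DifferentiableAt ℂ hrPhase z := differentiableAt_hrPhase (by linarith)
  have d2 : DifferentiableAt ℂ (fun w ↦ hrPhase (w + 1)) z :=
    differentiableAt_comp_add_const.mpr
      (differentiableAt_hrPhase (z := z + 1) (by simp; linarith))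
  unfold hrLogDeriv
  have m1 : 2 * hrPhase z ^ 2 ≠ 0 := mul_ne_zero two_ne_zero (pow_ne_zero 2 n1)
  have m2 : hrPhase (z + 1) ^ 2 ≠ 0 := pow_ne_zero 2 n2
  have m3 : hrPhase z ^ 2 ≠ 0 := pow_ne_zero 2 n1
  have m4 : (hrPhase (z + 1) - 1) * hrPhase z ^ 3 ≠ 0 := mul_ne_zero n4 (pow_ne_zero 3 n1)
  fun_prop (disch := assumption)

end LogDeriv

section LogDiff
open Metric Set

lemma hrPhase_ofReal {t : ℝ} (ht : 0 ≤ t) : hrPhase t = ((hrBeta * √t : ℝ) : ℂ) := by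
  rw [hrPhase, Real.sqrt_eq_rpow, Complex.ofReal_mul, Complex.ofReal_cpow ht]
  push_cast
  rfl

lemma hrBeta_mul_sqrt_sq {t : ℝ} (ht : 0 ≤ t) : (hrBeta * √t) ^ 2 = hrBeta ^ 2 * t := by
  rw [mul_pow, Real.sq_sqrt ht]

lemma le_hrBeta_mul_sqrt {t : ℝ} (ht : 5000 ≤ t) : 100 ≤ hrBeta * √t := by
  have h : 70 ≤ √t := Real.le_sqrt_of_sq_le (by linarith)
  have := hrBeta_bounds
  nlinarith

lemma hasDerivAt_hrMain {w : ℝ} (hw : 0 < w) (hX : 1 < hrBeta * w) :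
    HasDerivAt hrMain (hrMain w *
      (hrBeta * (1 + 1 / (hrBeta * w - 1) - 3 / (hrBeta * w)))) w := by
  have hb := hrBeta_pos
  have hp := Real.pi_pos
  have h2 : 0 < √(2 : ℝ) := by positivity
  have hX1 : hrBeta * w - 1 ≠ 0 := by linarith
  have d1 : HasDerivAt (fun w ↦ hrBeta * w) hrBeta w := by
    simpa using (hasDerivAt_id w).const_mul hrBeta
  have d2 : HasDerivAt (fun w : ℝ ↦ 4 * √2 * Real.pi * w ^ 3)
      (4 * √2 * Real.pi * (3 * w ^ 2)) w := by
    simpa using (hasDerivAt_pow 3 w).const_mul (4 * √2 * Real.pi)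
  have d := ((d1.sub_const 1).mul d1.exp).div d2 (by positivity)
  refine d.congr_deriv ?_
  simp only [hrMain, Pi.mul_apply]
  field_simp
  ring

lemma hasDerivAt_hrMain_sqrt {t : ℝ} (ht : 0 < t) (hX : 1 < hrBeta * √t) :
    HasDerivAt (fun x ↦ hrMain √x) (hrMain √t *
      (hrBeta ^ 2 / 2 * (1 / (hrBeta * √t - 1) - 3 / (hrBeta * √t) ^ 2))) t := by
  have hw : 0 < √t := Real.sqrt_pos.mpr ht
  have hb := hrBeta_pos
  have hX1 : hrBeta * √t - 1 ≠ 0 := by linarith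
  refine ((hasDerivAt_hrMain hw hX).comp t (Real.hasDerivAt_sqrt ht.ne')).congr_deriv ?_
  rw [mul_assoc]
  congr 1
  field_simp
  ring

/-- The first difference of `hrMain (√t)`. -/
noncomputable def hrDiff (t : ℝ) : ℝ := hrMain √(t + 1) - hrMain √t

lemma hrMain_lower {t : ℝ} (ht : 5000 ≤ t) :
    0.9 * Real.exp (hrBeta * √t) / (hrBeta * √t) ^ 2 ≤ hrMain √t := by
  have hX := le_hrBeta_mul_sqrt ht
  have hb := hrBeta_bounds
  have hp := Real.pi_pos
  have hw : 0 < √t := Real.sqrt_pos.mpr (by linarith)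
  have h2 : √(2 : ℝ) < 1.4143 := by rw [Real.sqrt_lt' (by norm_num)]; norm_num
  have h2' : 0 < √(2 : ℝ) := by positivity
  have hc : 4 * √2 * Real.pi ≤ 17.78 := by
    have := Real.pi_lt_d6
    nlinarith
  have hb3 : 16.87 ≤ hrBeta ^ 3 := by
    have := hrBeta_sq_bounds
    rw [pow_succ]
    nlinarith
  rw [hrMain, div_le_div_iff₀ (by positivity) (by positivity)]
  have e : √t ^ 3 * hrBeta ^ 3 = (hrBeta * √t) ^ 3 := by ring
  have h3 : 4 * √2 * Real.pi * √t ^ 3 * 16.87 ≤ 17.78 * (hrBeta * √t) ^ 3 := by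
    calc _ ≤ 17.78 * √t ^ 3 * hrBeta ^ 3 := by gcongr
      _ = _ := by rw [mul_assoc, e]
  set X := hrBeta * √t
  have h4 : 0.9 * (4 * √2 * Real.pi * √t ^ 3) ≤ (X - 1) * X ^ 2 := by
    have : 0 < X ^ 2 := by positivity
    nlinarith
  calc _ = Real.exp X * (0.9 * (4 * √2 * Real.pi * √t ^ 3)) := by ring
    _ ≤ Real.exp X * ((X - 1) * X ^ 2) := by gcongr
    _ = _ := by ring

lemma hrDiff_lower {t : ℝ} (ht : 5000 ≤ t) :
    Real.exp (hrBeta * √t) / (hrBeta * √t) ^ 3 ≤ hrDiff t := by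
  obtain ⟨ξ, hξ, e⟩ := exists_hasDerivAt_eq_slope (fun x ↦ hrMain √x) _ (lt_add_one t)
    (fun x hx ↦ (hasDerivAt_hrMain_sqrt (by linarith [hx.1])
      (by linarith [le_hrBeta_mul_sqrt (ht.trans hx.1)])).continuousAt.continuousWithinAt)
    (fun x hx ↦ hasDerivAt_hrMain_sqrt (by linarith [hx.1])
      (by linarith [le_hrBeta_mul_sqrt (ht.trans hx.1.le)]))
  rw [add_sub_cancel_left, div_one] at e
  have hξ' : 5000 ≤ ξ := ht.trans hξ.1.le
  have hX := le_hrBeta_mul_sqrt hξ'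
  have hX0 := le_hrBeta_mul_sqrt ht
  have hb := hrBeta_pos
  have hM := hrMain_lower hξ'
  have hle : hrBeta * √t ≤ hrBeta * √ξ := by
    gcongr
    exact hξ.1.le
  have hle2 : hrBeta * √ξ ≤ 1.01 * (hrBeta * √t) := by
    refine abs_le_of_sq_le_sq' ?_ (by positivity) |>.2
    rw [mul_pow 1.01, hrBeta_mul_sqrt_sq (by linarith), hrBeta_mul_sqrt_sq (by linarith)]
    have := hrBeta_sq_bounds
    nlinarith [hξ.2]
  rw [hrDiff, ← e]
  have hb2 := hrBeta_sq_bounds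
  set X := hrBeta * √ξ
  set Y := hrBeta * √t
  have hk : 0.9 / X ≤ 1 / (X - 1) - 3 / X ^ 2 := by
    rw [div_sub_div _ _ (by linarith) (by positivity), div_le_div_iff₀ (by linarith)
      (mul_pos (by linarith) (by positivity))]
    nlinarith [sq_nonneg X]
  have hlow : 2 * Real.exp X / X ^ 3 ≤
      hrMain √ξ * (hrBeta ^ 2 / 2 * (1 / (X - 1) - 3 / X ^ 2)) := by
    calc 2 * Real.exp X / X ^ 3 ≤ 0.9 * Real.exp X / X ^ 2 * (6.5 / 2 * (0.9 / X)) := by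
          rw [show 0.9 * Real.exp X / X ^ 2 * (6.5 / 2 * (0.9 / X)) =
            2.6325 * Real.exp X / X ^ 3 by field_simp; norm_num]
          gcongr
          norm_num
      _ ≤ _ := by
        gcongr
        · exact (by positivity : (0 : ℝ) ≤ _).trans hM
        · linarith
  refine le_trans ?_ hlow
  rw [div_le_div_iff₀ (by positivity) (by positivity)]
  have h1 : X ^ 3 ≤ (1.01 * Y) ^ 3 := by gcongr
  have h2 : Real.exp Y ≤ Real.exp X := by gcongr
  have h3 : 0 < Y ^ 3 := by positivity
  calc _ ≤ Real.exp X * (1.01 * Y) ^ 3 := by gcongr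
    _ = 1.030301 * (Real.exp X * Y ^ 3) := by ring
    _ ≤ 2 * (Real.exp X * Y ^ 3) := by
      have : 0 < Real.exp X * Y ^ 3 := by positivity
      linarith
    _ = _ := by ring

lemma hrDiff_pos {t : ℝ} (ht : 5000 ≤ t) : 0 < hrDiff t := by
  have := le_hrBeta_mul_sqrt ht
  exact lt_of_lt_of_le (by positivity) (hrDiff_lower ht)

lemma hasDerivAt_log_hrDiff {t : ℝ} (ht : 5000 ≤ t) :
    HasDerivAt (fun x ↦ Real.log (hrDiff x) - hrBeta * √x) (hrLogDeriv t).re t ∧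
      hrLogDeriv t = ((hrLogDeriv t).re : ℝ) := by
  have ht0 : 0 < t := by linarith
  have ht1 : 5000 ≤ t + 1 := by linarith
  have hX := le_hrBeta_mul_sqrt ht
  have hY := le_hrBeta_mul_sqrt ht1
  have hD := hrDiff_pos ht
  have hb := hrBeta_pos
  have hM1 : 0 < hrMain √(t + 1) := lt_of_lt_of_le (by positivity) (hrMain_lower ht1)
  have hw : 0 < √t := Real.sqrt_pos.mpr ht0
  have hw1 : 0 < √(t + 1) := Real.sqrt_pos.mpr (by linarith)
  have e1 : hrPhase (t + 1) = ((hrBeta * √(t + 1) : ℝ) : ℂ) := by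
    rw [← hrPhase_ofReal (by linarith)]; push_cast; rfl
  have eg : hrLogDeriv t = ((hrBeta ^ 2 / (2 * (hrBeta * √t) ^ 2) *
      (-2 + 1 / (hrBeta * √t - 1)) +
      hrBeta ^ 2 / 2 * ((1 / (hrBeta * √(t + 1) - 1) - 3 / (hrBeta * √(t + 1)) ^ 2) -
      (1 / (hrBeta * √t - 1) - 3 / (hrBeta * √t) ^ 2)) /
      (1 - Real.exp (hrBeta * √t - hrBeta * √(t + 1)) *
        ((hrBeta * √t - 1) * (hrBeta * √(t + 1)) ^ 3 /
          ((hrBeta * √(t + 1) - 1) * (hrBeta * √t) ^ 3))) : ℝ) : ℂ) := by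
    rw [hrLogDeriv, e1, hrPhase_ofReal ht0.le]
    push_cast
    rfl
  rw [eg, Complex.ofReal_re]
  refine ⟨?_, rfl⟩
  have d0 := hasDerivAt_hrMain_sqrt ht0 (by linarith)
  have d1 := (hasDerivAt_hrMain_sqrt (by linarith) (by linarith : 1 < hrBeta * √(t + 1))).comp_add_const t 1
  have d := ((d1.sub d0).log hD.ne').sub ((Real.hasDerivAt_sqrt ht0.ne').const_mul hrBeta)
  refine d.congr_deriv ?_
  have hρ : Real.exp (hrBeta * √t - hrBeta * √(t + 1)) *
        ((hrBeta * √t - 1) * (hrBeta * √(t + 1)) ^ 3 /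
          ((hrBeta * √(t + 1) - 1) * (hrBeta * √t) ^ 3)) = hrMain √t / hrMain √(t + 1) := by
    have hp := Real.pi_pos
    have h2 : 0 < √(2 : ℝ) := by positivity
    have hY1 : hrBeta * √(t + 1) - 1 ≠ 0 := by linarith
    rw [hrMain, hrMain, Real.exp_sub]
    field_simp
  rw [hρ]
  have e2 : 1 - hrMain √t / hrMain √(t + 1) = hrDiff t / hrMain √(t + 1) := by
    rw [hrDiff]; field_simp
  have e3 : hrBeta * (1 / (2 * √t)) = hrBeta ^ 2 / (2 * (hrBeta * √t) ^ 2) * (hrBeta * √t) := by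
    field_simp
  rw [e2, e3]
  have e4 : hrMain √(t + 1) = hrDiff t + hrMain √t := by rw [hrDiff]; ring
  simp only [Pi.sub_apply]
  rw [← hrDiff]
  have hX1 : hrBeta * √t - 1 ≠ 0 := by linarith
  have hY1 : hrBeta * √(t + 1) - 1 ≠ 0 := by linarith
  set X := hrBeta * √t
  set Y := hrBeta * √(t + 1)
  set M := hrMain √t
  rw [e4]
  set D := hrDiff t
  have hMD : D + M ≠ 0 := by rw [← e4]; exact hM1.ne'
  field_simp
  ring

end LogDiff

section LogDiffDifferences
open Metric Set

lemma hrLogDeriv_ball {c : ℝ} (hc : 10000 ≤ c) :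
    DifferentiableOn ℂ hrLogDeriv (ball (c : ℂ) (c / 2)) ∧
      ∀ z ∈ ball (c : ℂ) (c / 2), ‖hrLogDeriv z‖ ≤ 4 / c := by
  have hre : ∀ z ∈ ball (c : ℂ) (c / 2), c / 2 ≤ z.re := by
    intro z hz
    rw [mem_ball, dist_eq_norm] at hz
    have := abs_le.mp ((Complex.abs_re_le_norm (z - c)).trans hz.le)
    rw [Complex.sub_re, Complex.ofReal_re] at this
    linarith [this.1]
  refine ⟨fun z hz ↦ (differentiableAt_hrLogDeriv
    (by linarith [hre z hz])).differentiableWithinAt, fun z hz ↦ ?_⟩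
  refine (norm_hrLogDeriv_le (by linarith [hre z hz])).trans ?_
  have := (hre z hz).trans (Complex.re_le_norm z)
  rw [div_le_div_iff₀ (by linarith) (by linarith)]
  linarith

lemma ofReal_mem_ball {x c r : ℝ} (h : |x - c| < r) : (x : ℂ) ∈ ball (c : ℂ) r := by
  rw [mem_ball, dist_eq_norm, ← Complex.ofReal_sub, Complex.norm_real]
  exact h

lemma abs_fwdDiff_log_hrDiff_sub {t : ℝ} (ht : 9998 ≤ t) :
    |fwdDiff 1 (fwdDiff 1 fun x ↦ Real.log (hrDiff x) - hrBeta * √x) (t + 1)| ≤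
        0.0801 * (√(t + 3) ^ 3)⁻¹ ∧
      |fwdDiff 1 (fwdDiff 1 (fwdDiff 1 (fwdDiff 1
        fun x ↦ Real.log (hrDiff x) - hrBeta * √x))) t| ≤ 0.088 * (√(t + 3) ^ 6)⁻¹ := by
  have hd : ∀ x, 5000 < x → HasDerivAt (fun x ↦ Real.log (hrDiff x) - hrBeta * √x)
    ((fun x : ℝ ↦ (hrLogDeriv x).re) x) x := fun x hx ↦ (hasDerivAt_log_hrDiff hx.le).1
  have hr : ∀ x : ℝ, 5000 < x → hrLogDeriv x = ((fun x : ℝ ↦ (hrLogDeriv x).re) x : ℝ) :=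
    fun x hx ↦ (hasDerivAt_log_hrDiff hx.le).2
  set m := t + 2 with hm
  have hm0 : 10000 ≤ m := by linarith
  obtain ⟨hdiff, hbd⟩ := hrLogDeriv_ball hm0
  set s := √(t + 3) with hs
  have hs2 : s ^ 2 = m + 1 := by rw [hs, Real.sq_sqrt (by linarith)]; linarith
  have hs100 : 100 ≤ s := Real.le_sqrt_of_sq_le (by linarith)
  constructor
  · obtain ⟨ξ, hξ, e⟩ := exists_fwdDiff_eq (hasDerivAt_fwdDiff hd) (s := t + 1) (by linarith)
    have h := (norm_fwdDiff_le_of_ball (ρ := m / 2 - 2) (by linarith) hdiff hbd).2 ξ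
      (ofReal_mem_ball (by rw [abs_lt]; constructor <;> linarith [hξ.1, hξ.2]))
    rw [fwdDiff_ofReal hr ξ (by linarith [hξ.1]), Complex.norm_real, Real.norm_eq_abs] at h
    rw [e]
    refine h.trans ?_
    rw [div_div, ← div_eq_mul_inv, div_le_div_iff₀ (by nlinarith) (by positivity)]
    have h3 : s ^ 3 * 100 ≤ (m + 1) ^ 2 := by
      rw [← hs2]
      calc s ^ 3 * 100 ≤ s ^ 3 * s := by gcongr
        _ = _ := by ring
    nlinarith
  · obtain ⟨ξ, hξ, e⟩ := exists_fwdDiff_eq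
      (hasDerivAt_fwdDiff (hasDerivAt_fwdDiff (hasDerivAt_fwdDiff hd))) (s := t) (by linarith)
    set ρ := 0.4995 * m / 3 with hρ
    have hρ0 : 0 < ρ := by positivity
    obtain ⟨d1, b1⟩ := norm_fwdDiff_le_of_ball hρ0 hdiff hbd
    obtain ⟨d2, b2⟩ := norm_fwdDiff_le_of_ball hρ0 d1 b1
    have h := (norm_fwdDiff_le_of_ball hρ0 d2 b2).2 ξ
      (ofReal_mem_ball (by rw [abs_lt]; constructor <;> linarith [hξ.1, hξ.2]))
    rw [fwdDiff_ofReal (fwdDiff_ofReal (fwdDiff_ofReal hr)) ξ (by linarith [hξ.1]),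
      Complex.norm_real, Real.norm_eq_abs] at h
    rw [e]
    refine h.trans ?_
    have e2 : 4 / m / ρ / ρ / ρ = 4 * 3 ^ 3 / (0.4995 ^ 3 * m ^ 4) := by
      rw [hρ]; field_simp
    rw [e2, ← div_eq_mul_inv, div_le_div_iff₀ (by positivity) (by positivity)]
    have h6 : s ^ 6 * 10000 ≤ (m + 1) ^ 4 := by
      rw [← hs2]
      calc s ^ 6 * 10000 = s ^ 6 * 100 ^ 2 := by norm_num
        _ ≤ s ^ 6 * s ^ 2 := by gcongr
        _ = _ := by ring
    have h7 : (m + 1) ^ 4 ≤ (1.0001 * m) ^ 4 := by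
      gcongr
      linarith
    have h8 : 0 < m ^ 4 := by positivity
    rw [mul_pow] at h7
    norm_num at h7 ⊢
    linarith

lemma fwdDiff_log_hrDiff {t : ℝ} (ht : 9998 ≤ t) :
    fwdDiff 1 (fwdDiff 1 fun x ↦ Real.log (hrDiff x)) (t + 1) ≤ -0.56 * (√(t + 3) ^ 3)⁻¹ ∧
      -1 / 2 ≤ fwdDiff 1 (fwdDiff 1 fun x ↦ Real.log (hrDiff x)) (t + 1) ∧
      |fwdDiff 1 (fwdDiff 1 (fwdDiff 1 (fwdDiff 1 fun x ↦ Real.log (hrDiff x)))) t| ≤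
        0.1125 * (√(t + 3) ^ 6)⁻¹ := by
  obtain ⟨h1, h2⟩ := abs_fwdDiff_log_hrDiff_sub ht
  obtain ⟨h3, h4, -⟩ := fwdDiff_sqrt_bounds (t := t + 1) (by linarith)
  obtain ⟨-, -, h5⟩ := fwdDiff_sqrt_bounds (t := t) (by linarith)
  have hb := hrBeta_bounds
  set s := √(t + 3) with hs
  have hs2 : s ^ 2 = t + 3 := by rw [hs, Real.sq_sqrt (by linarith)]
  have hs100 : 100 ≤ s := Real.le_sqrt_of_sq_le (by linarith)
  have hs0 : 0 < s := by linarith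
  have e3 : (t + 1 + 2) ^ (-(3 / 2) : ℝ) = (s ^ 3)⁻¹ := by
    rw [show t + 1 + 2 = s ^ 2 by rw [hs2]; ring, ← Real.rpow_natCast s 2, ← Real.rpow_mul hs0.le,
      ← Real.rpow_natCast s 3, ← Real.rpow_neg hs0.le]
    norm_num
  have e4 : (t + 1) ^ (-(3 / 2) : ℝ) ≤ 1 / 100 := by
    calc _ ≤ (100 : ℝ) ^ (-(3 / 2) : ℝ) :=
          Real.rpow_le_rpow_of_nonpos (by norm_num) (by linarith) (by norm_num)
      _ ≤ (100 : ℝ) ^ (-1 : ℝ) := Real.rpow_le_rpow_of_exponent_le (by norm_num) (by norm_num)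
      _ = _ := by rw [Real.rpow_neg_one]; norm_num
  have e5 : t ^ (-(7 / 2) : ℝ) ≤ 0.01004 * (s ^ 6)⁻¹ := by
    have h99 : 99.98 ≤ √t := Real.le_sqrt_of_sq_le (by linarith)
    have ht0 : 0 < t := by linarith
    have : t ^ (-(7 / 2) : ℝ) = (√t * t ^ 3)⁻¹ := by
      rw [Real.rpow_neg ht0.le, Real.sqrt_eq_rpow, ← Real.rpow_natCast t 3, ← Real.rpow_add ht0]
      norm_num
    rw [this, ← div_eq_mul_inv, inv_eq_one_div, div_le_div_iff₀ (by positivity) (by positivity)]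
    have h6 : s ^ 6 ≤ 1.00031 ^ 3 * t ^ 3 := by
      rw [show s ^ 6 = (s ^ 2) ^ 3 by ring, hs2, ← mul_pow]
      gcongr
      linarith
    have h7 : 99.98 * t ^ 3 ≤ √t * t ^ 3 := by gcongr
    have : 0 < t ^ 3 := by positivity
    norm_num at h6 ⊢
    linarith
  have k2 : fwdDiff 1 (fwdDiff 1 fun x ↦ Real.log (hrDiff x)) (t + 1) =
      fwdDiff 1 (fwdDiff 1 fun x ↦ Real.log (hrDiff x) - hrBeta * √x) (t + 1) +
        hrBeta * fwdDiff 1 (fwdDiff 1 Real.sqrt) (t + 1) := by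
    simp only [fwdDiff]; ring
  have k4 : fwdDiff 1 (fwdDiff 1 (fwdDiff 1 (fwdDiff 1 fun x ↦ Real.log (hrDiff x)))) t =
      fwdDiff 1 (fwdDiff 1 (fwdDiff 1 (fwdDiff 1
        fun x ↦ Real.log (hrDiff x) - hrBeta * √x))) t +
        hrBeta * fwdDiff 1 (fwdDiff 1 (fwdDiff 1 (fwdDiff 1 Real.sqrt))) t := by
    simp only [fwdDiff]; ring
  have hi3 : 0 < (s ^ 3)⁻¹ := by positivity
  have hi3' : (s ^ 3)⁻¹ ≤ 1 := inv_le_one_of_one_le₀ (one_le_pow₀ (by linarith))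
  rw [e3] at h3
  rw [abs_le] at h1
  rw [k2, k4]
  refine ⟨by nlinarith [h1.2], by nlinarith [h1.1], ?_⟩
  refine (abs_add_le _ _).trans ?_
  rw [abs_mul, abs_of_pos hrBeta_pos]
  have hi6 : 0 < (s ^ 6)⁻¹ := by positivity
  have : hrBeta * |fwdDiff 1 (fwdDiff 1 (fwdDiff 1 (fwdDiff 1 Real.sqrt))) t| ≤
      2.566 * (15 / 16 * (0.01004 * (s ^ 6)⁻¹)) := by
    gcongr
    · exact hb.2.le
    · exact h5.trans (by gcongr)
  linarith

end LogDiffDifferences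

section Toeplitz

lemma toeplitz_pos_of_exp {y₀ y₁ y₂ y₃ y₄ : ℝ} (hx : y₁ - 2 * y₂ + y₃ < 0)
    (hx1 : -1 ≤ y₁ - 2 * y₂ + y₃)
    (hT : |y₀ - 4 * y₁ + 6 * y₂ - 4 * y₃ + y₄| ≤ (y₁ - 2 * y₂ + y₃) ^ 2 / 2) :
    0 < Real.exp y₂ ^ 3 + Real.exp y₁ ^ 2 * Real.exp y₄ + Real.exp y₀ * Real.exp y₃ ^ 2 -
      Real.exp y₀ * Real.exp y₂ * Real.exp y₄ - 2 * Real.exp y₁ * Real.exp y₂ * Real.exp y₃ := by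
  obtain ⟨x, hxd⟩ : ∃ x, x = -(y₁ - 2 * y₂ + y₃) := ⟨_, rfl⟩
  obtain ⟨S, hS⟩ : ∃ S, S = y₀ - 2 * y₁ + y₂ := ⟨_, rfl⟩
  obtain ⟨S', hS'⟩ : ∃ S', S' = y₂ - 2 * y₃ + y₄ := ⟨_, rfl⟩
  obtain ⟨T, hTd⟩ : ∃ T, T = y₀ - 4 * y₁ + 6 * y₂ - 4 * y₃ + y₄ := ⟨_, rfl⟩
  have hsum : S + S' = -2 * x + T := by rw [hxd, hS, hS', hTd]; ring
  rw [← hTd, show (y₁ - 2 * y₂ + y₃) ^ 2 = x ^ 2 by rw [hxd]; ring, abs_le] at hT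
  have hx0 : 0 < x := by linarith
  have hx1' : x ≤ 1 := by linarith
  have hprod : (1 - Real.exp S) * (1 - Real.exp S') < (Real.exp x - 1) ^ 2 := by
    have h1 : x + x ^ 2 / 2 ≤ Real.exp x - 1 := by
      have := Real.quadratic_le_exp_of_nonneg hx0.le
      linarith
    have h2 : (x + x ^ 2 / 2) ^ 2 ≤ (Real.exp x - 1) ^ 2 := by gcongr
    refine lt_of_lt_of_le ?_ h2
    have hpos : 0 < (x + x ^ 2 / 2) ^ 2 := by positivity
    rcases le_or_gt S 0 with hS0 | hS0 <;> rcases le_or_gt S' 0 with hS0' | hS0'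
    · have e1 := Real.add_one_le_exp S
      have e2 := Real.add_one_le_exp S'
      have e3 : Real.exp S' ≤ 1 := Real.exp_le_one_iff.mpr hS0'
      have e4 : Real.exp S ≤ 1 := Real.exp_le_one_iff.mpr hS0
      have e5 : (1 - Real.exp S) * (1 - Real.exp S') ≤ (-S) * (-S') :=
        mul_le_mul (by linarith) (by linarith) (by linarith) (by linarith)
      have e6 : (-S) * (-S') ≤ ((S + S') / 2) ^ 2 := by nlinarith [sq_nonneg (S - S')]
      refine (e5.trans e6).trans_lt ?_
      rw [hsum]
      have h7 : (-2 * x + T) / 2 ≤ 0 := by nlinarith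
      have h8 : -(x + x ^ 2 / 4) ≤ (-2 * x + T) / 2 := by linarith
      have : ((-2 * x + T) / 2) ^ 2 ≤ (x + x ^ 2 / 4) ^ 2 := by nlinarith
      have : (x + x ^ 2 / 4) ^ 2 < (x + x ^ 2 / 2) ^ 2 := by gcongr; norm_num
      linarith
    · have e3 : 1 < Real.exp S' := Real.one_lt_exp_iff.mpr hS0'
      have e4 : Real.exp S ≤ 1 := Real.exp_le_one_iff.mpr hS0
      nlinarith
    · have e3 : 1 < Real.exp S := Real.one_lt_exp_iff.mpr hS0
      have e4 : Real.exp S' ≤ 1 := Real.exp_le_one_iff.mpr hS0'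
      nlinarith
    · nlinarith
  have p2 := Real.exp_pos y₂
  have p1 := Real.exp_pos y₁
  have p3 := Real.exp_pos y₃
  have k1 : Real.exp y₁ * Real.exp y₃ * Real.exp x = Real.exp y₂ ^ 2 := by
    rw [sq, ← Real.exp_add, ← Real.exp_add, ← Real.exp_add, hxd]; ring_nf
  have k2 : Real.exp y₀ * Real.exp y₂ = Real.exp y₁ ^ 2 * Real.exp S := by
    rw [sq, ← Real.exp_add, ← Real.exp_add, ← Real.exp_add, hS]; ring_nf
  have k3 : Real.exp y₂ * Real.exp y₄ = Real.exp y₃ ^ 2 * Real.exp S' := by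
    rw [sq, ← Real.exp_add, ← Real.exp_add, ← Real.exp_add, hS']; ring_nf
  set a := Real.exp y₁
  set b := Real.exp y₂
  set c := Real.exp y₃
  refine (mul_pos_iff_of_pos_left p2).mp ?_
  have key : b * (b ^ 3 + a ^ 2 * Real.exp y₄ + Real.exp y₀ * c ^ 2 -
      Real.exp y₀ * b * Real.exp y₄ - 2 * a * b * c) =
      (a * c) ^ 2 * ((Real.exp x - 1) ^ 2 - (1 - Real.exp S) * (1 - Real.exp S')) := by
    have : b * (b ^ 3 + a ^ 2 * Real.exp y₄ + Real.exp y₀ * c ^ 2 -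
        Real.exp y₀ * b * Real.exp y₄ - 2 * a * b * c) =
        (b ^ 2 - a * c) ^ 2 - (c ^ 2 - b * Real.exp y₄) * (a ^ 2 - Real.exp y₀ * b) := by ring
    rw [this, k2, k3, ← k1]
    ring
  rw [key]
  have : 0 < (a * c) ^ 2 := by positivity
  exact mul_pos this (by linarith)

lemma abs_log_sub_log_le {a d η : ℝ} (hd : 0 < d) (hη : η ≤ 1 / 2) (h : |a - d| ≤ η * d) :
    0 < a ∧ |Real.log a - Real.log d| ≤ 2 * η := by
  rw [abs_le] at h
  have hη0 : 0 ≤ η := by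
    by_contra hneg
    push Not at hneg
    nlinarith [h.1, h.2]
  have ha : 0 < a := by nlinarith [h.1]
  refine ⟨ha, ?_⟩
  rw [← Real.log_div ha.ne' hd.ne']
  have h1 : a / d ≤ 1 + η := by rw [div_le_iff₀ hd]; linarith [h.2]
  have h2 : d / a ≤ 1 + 2 * η := by
    rw [div_le_iff₀ ha]
    nlinarith [h.1, mul_nonneg hη0 (sub_nonneg.mpr hη), mul_nonneg hη0 hd.le]
  have hp : 0 < a / d := by positivity
  have l1 := Real.log_le_sub_one_of_pos hp
  have l2 := Real.one_sub_inv_le_log_of_pos hp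
  rw [inv_div] at l2
  rw [abs_le]
  constructor <;> linarith

end Toeplitz

section LargeIndices

lemma pow_nine_le_exp {X : ℝ} (hX : 256 ≤ X) : 4300 * X ^ 9 ≤ Real.exp (X / 4) := by
  have h7 : 1096 ≤ Real.exp 7 := by
    have h := Real.exp_one_gt_d9
    calc (1096 : ℝ) ≤ 2.7182818 ^ 7 := by norm_num
      _ ≤ Real.exp 1 ^ 7 := by gcongr; linarith
      _ = _ := by rw [← Real.exp_nat_mul]; norm_num
  have h1 : 92 * (X / 36) ≤ Real.exp (X / 36) := by
    rw [show X / 36 = 7 + (X / 36 - 7) by ring, Real.exp_add]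
    have h := Real.add_one_le_exp (X / 36 - 7)
    have h0 : 0 ≤ X / 36 - 7 + 1 := by linarith
    calc _ ≤ 1096 * (X / 36 - 7 + 1) := by linarith
      _ ≤ _ := mul_le_mul h7 h h0 (by linarith)
  calc 4300 * X ^ 9 ≤ (92 * (X / 36)) ^ 9 := by
        rw [show (92 * (X / 36)) ^ 9 = (92 / 36) ^ 9 * X ^ 9 by ring]
        gcongr
        norm_num
    _ ≤ Real.exp (X / 36) ^ 9 := by gcongr
    _ = _ := by rw [← Real.exp_nat_mul]; congr 1; push_cast; ring

lemma abs_dP_sub_hrDiff_le {n : ℕ} (hn : 9999 ≤ n) :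
    |(dP n : ℝ) - hrDiff (n - 1 / 24)| ≤
      1 / 100000 / (n - 1 / 24 + 3) ^ 3 * hrDiff (n - 1 / 24) := by
  have hn' : (9999 : ℝ) ≤ n := by exact_mod_cast hn
  obtain ⟨t, ht⟩ : ∃ t : ℝ, t = n - 1 / 24 := ⟨_, rfl⟩
  rw [← ht]
  have ht0 : 9998.9 ≤ t := by linarith
  have hb := hrBeta_bounds
  have hb2 := hrBeta_sq_bounds
  have hw : 99.99 ≤ √t := Real.le_sqrt_of_sq_le (by linarith)
  have hw1 : 99.99 ≤ √(t + 1) := Real.le_sqrt_of_sq_le (by linarith)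
  have hX : 256 ≤ hrBeta * √t := by nlinarith
  have hY : 256 ≤ hrBeta * √(t + 1) := by nlinarith
  have h0 := abs_partitionFn_sub_hrMain_le (n := n) (w := √t) (by linarith)
    (by rw [Real.sq_sqrt (by linarith), ht]) (by linarith)
  have h1 := abs_partitionFn_sub_hrMain_le (n := n + 1) (w := √(t + 1)) (by linarith)
    (by rw [Real.sq_sqrt (by linarith), ht]; push_cast; ring) (by linarith)
  have hD := hrDiff_lower (t := t) (by linarith)
  have hXY : hrBeta * √(t + 1) ≤ hrBeta * √t + 1 / 50 := by
    have e1 := hrBeta_mul_sqrt_sq (t := t) (by linarith)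
    have e2 := hrBeta_mul_sqrt_sq (t := t + 1) (by linarith)
    nlinarith
  have hs := hrBeta_mul_sqrt_sq (t := t) (by linarith)
  have hle : hrBeta * √t ≤ hrBeta * √(t + 1) := by
    have := hrBeta_pos
    gcongr
    linarith
  have hd : |(dP n : ℝ) - hrDiff t| ≤ 8 * Real.exp (3 / 4 * (hrBeta * √(t + 1))) := by
    have e : (dP n : ℝ) - hrDiff t = ((partitionFn (n + 1) : ℝ) - hrMain √(t + 1)) -
        ((partitionFn n : ℝ) - hrMain √t) := by
      rw [dP, hrDiff]; push_cast; ring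
    rw [e]
    have e2 : Real.exp (3 / 4 * (hrBeta * √t)) ≤ Real.exp (3 / 4 * (hrBeta * √(t + 1))) := by
      gcongr
    refine (abs_sub _ _).trans ?_
    linarith
  refine hd.trans ?_
  set X := hrBeta * √t
  have h9 := pow_nine_le_exp hX
  have e15 : Real.exp (3 / 200) ≤ 1.02 := by
    have := Real.exp_bound_div_one_sub_of_interval' (x := 3 / 200) (by norm_num) (by norm_num)
    refine this.le.trans (by norm_num)
  have u1 : Real.exp (3 / 4 * (hrBeta * √(t + 1))) ≤ Real.exp (3 / 4 * X) * 1.02 := by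
    calc _ ≤ Real.exp (3 / 4 * X + 3 / 200) := by gcongr; linarith
      _ = Real.exp (3 / 4 * X) * Real.exp (3 / 200) := Real.exp_add _ _
      _ ≤ _ := by gcongr
  have u2 : Real.exp X = Real.exp (3 / 4 * X) * Real.exp (X / 4) := by
    rw [← Real.exp_add]; ring_nf
  have u3 : (t + 3) ^ 3 ≤ (X ^ 2 / 6) ^ 3 := by
    gcongr
    rw [hs]
    nlinarith
  have hX0 : 0 < X := by linarith
  have ht3 : 0 < t + 3 := by linarith
  calc _ ≤ 8 * (Real.exp (3 / 4 * X) * 1.02) := by gcongr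
    _ ≤ 1 / 100000 / (t + 3) ^ 3 * (Real.exp X / X ^ 3) := by
      rw [u2, div_mul_div_comm, le_div_iff₀ (by positivity)]
      have : 816000 * (X ^ 2 / 6) ^ 3 * X ^ 3 ≤ Real.exp (X / 4) := by
        refine le_trans ?_ h9
        rw [show 816000 * (X ^ 2 / 6) ^ 3 * X ^ 3 = 816000 / 216 * X ^ 9 by ring]
        gcongr
        norm_num
      have v : 816000 * (t + 3) ^ 3 * X ^ 3 ≤ Real.exp (X / 4) := by
        refine le_trans ?_ this
        gcongr
      have := mul_le_mul_of_nonneg_left v (Real.exp_pos (3 / 4 * X)).le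
      linarith
    _ ≤ _ := by gcongr

lemma toeplitz_pos_of_log_approx {y₀ y₁ y₂ y₃ y₄ d₀ d₁ d₂ d₃ d₄ v : ℝ} (hv0 : 0 < v)
    (hv1 : v ≤ 1 / 100) (h1 : d₃ - d₂ - (d₂ - d₁) ≤ -0.56 * v)
    (h2 : -1 / 2 ≤ d₃ - d₂ - (d₂ - d₁))
    (h3 : |d₄ - d₃ - (d₃ - d₂) - (d₃ - d₂ - (d₂ - d₁)) -
      (d₃ - d₂ - (d₂ - d₁) - (d₂ - d₁ - (d₁ - d₀)))| ≤ 0.1125 * v ^ 2)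
    (l0 : |y₀ - d₀| ≤ 0.00002 * v ^ 2) (l1 : |y₁ - d₁| ≤ 0.00002 * v ^ 2)
    (l2 : |y₂ - d₂| ≤ 0.00002 * v ^ 2) (l3 : |y₃ - d₃| ≤ 0.00002 * v ^ 2)
    (l4 : |y₄ - d₄| ≤ 0.00002 * v ^ 2) :
    0 < Real.exp y₂ ^ 3 + Real.exp y₁ ^ 2 * Real.exp y₄ + Real.exp y₀ * Real.exp y₃ ^ 2 -
      Real.exp y₀ * Real.exp y₂ * Real.exp y₄ - 2 * Real.exp y₁ * Real.exp y₂ * Real.exp y₃ := by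
  have hvv : v ^ 2 ≤ v / 100 := by nlinarith
  have hS : y₁ - 2 * y₂ + y₃ ≤ -(0.55 * v) := by
    rw [abs_le] at l1 l2 l3
    linarith [l1.2, l2.1, l3.2]
  have hS2 : -1 ≤ y₁ - 2 * y₂ + y₃ := by
    rw [abs_le] at l1 l2 l3
    linarith [l1.1, l2.2, l3.1]
  refine toeplitz_pos_of_exp (by linarith) hS2 ?_
  have hsq : (0.55 * v) ^ 2 ≤ (-(y₁ - 2 * y₂ + y₃)) ^ 2 := by
    gcongr
    linarith
  rw [neg_sq] at hsq
  have hv2 : 0 < v ^ 2 := by positivity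
  rw [abs_le] at l0 l1 l2 l3 l4 h3
  refine le_trans (b := 0.1129 * v ^ 2) (abs_le.2 ⟨?_, ?_⟩) (by linarith)
  · linarith [l0.1, l1.2, l2.1, l3.2, l4.1, h3.1]
  · linarith [l0.2, l1.1, l2.2, l3.1, l4.2, h3.2]

lemma toeplitz_dP_pos {n : ℕ} (hn : 9999 ≤ n) :
    0 < dP (n + 2) ^ 3 + dP (n + 1) ^ 2 * dP (n + 4) + dP n * dP (n + 3) ^ 2 -
      dP n * dP (n + 2) * dP (n + 4) - 2 * dP (n + 1) * dP (n + 2) * dP (n + 3) := by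
  have hn' : (9999 : ℝ) ≤ n := by exact_mod_cast hn
  obtain ⟨t, ht⟩ : ∃ t : ℝ, t = n - 1 / 24 := ⟨_, rfl⟩
  have ht0 : 9998 ≤ t := by linarith
  obtain ⟨h1, h2, h3⟩ := fwdDiff_log_hrDiff ht0
  set s := √(t + 3) with hs
  have hs2 : s ^ 2 = t + 3 := by rw [hs, Real.sq_sqrt (by linarith)]
  have hs100 : 100 ≤ s := Real.le_sqrt_of_sq_le (by linarith)
  have herr : ∀ j : ℕ, 0 < (dP (n + j) : ℝ) ∧
      |Real.log (dP (n + j)) - Real.log (hrDiff (t + j))| ≤ 0.00002 * (s ^ 6)⁻¹ := by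
    intro j
    have h := abs_dP_sub_hrDiff_le (n := n + j) (by omega)
    have e : ((n + j : ℕ) : ℝ) - 1 / 24 = t + j := by rw [ht]; push_cast; ring
    rw [e] at h
    have hj : (0 : ℝ) ≤ j := Nat.cast_nonneg j
    have hle : 1 / 100000 / (t + j + 3) ^ 3 ≤ 0.00001 * (s ^ 6)⁻¹ := by
      rw [show s ^ 6 = (s ^ 2) ^ 3 by ring, hs2, ← div_eq_mul_inv]
      gcongr
      · norm_num
      · linarith
    have hs1 : (s ^ 6)⁻¹ ≤ 1 := inv_le_one_of_one_le₀ (one_le_pow₀ (by linarith))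
    obtain ⟨hp, hl⟩ := abs_log_sub_log_le (hrDiff_pos (t := t + j) (by linarith))
      (by linarith) h
    exact ⟨hp, hl.trans (by linarith)⟩
  obtain ⟨p0, l0⟩ := herr 0
  obtain ⟨p1, l1⟩ := herr 1
  obtain ⟨p2, l2⟩ := herr 2
  obtain ⟨p3, l3⟩ := herr 3
  obtain ⟨p4, l4⟩ := herr 4
  push_cast at l0 l1 l2 l3 l4
  rw [add_zero, add_zero] at l0
  rw [add_zero] at p0
  simp only [fwdDiff] at h1 h2 h3
  rw [show t + 1 + 1 + 1 = t + 3 by ring, show t + 1 + 1 = t + 2 by ring] at h1 h2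
  rw [show t + 1 + 1 + 1 + 1 = t + 4 by ring, show t + 1 + 1 + 1 = t + 3 by ring,
    show t + 1 + 1 = t + 2 by ring] at h3
  obtain ⟨v, hv⟩ : ∃ v, v = (s ^ 3)⁻¹ := ⟨_, rfl⟩
  have hv6 : (s ^ 6)⁻¹ = v ^ 2 := by rw [hv, inv_pow, ← pow_mul]
  have hv0 : 0 < v := by rw [hv]; positivity
  have hv1 : v ≤ 1 / 100 := by
    rw [hv, one_div]
    refine inv_anti₀ (by norm_num) ?_
    calc (100 : ℝ) ≤ s := hs100
      _ ≤ s ^ 3 := le_self_pow₀ (by linarith) (by norm_num)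
  rw [hv6] at l0 l1 l2 l3 l4 h3
  rw [← hv] at h1
  have h := toeplitz_pos_of_log_approx hv0 hv1 h1 h2 h3 l0 l1 l2 l3 l4
  rw [Real.exp_log p0, Real.exp_log p1, Real.exp_log p2, Real.exp_log p3, Real.exp_log p4] at h
  exact_mod_cast h

end LargeIndices

section Recurrence

open Filter Topology PowerSeries

lemma mk_dvd_mul_one_sub_X_pow {R : Type*} [CommRing R] (i : ℕ) :
    (PowerSeries.mk fun n ↦ if i + 1 ∣ n then (1 : R) else 0) * (1 - X ^ (i + 1)) = 1 := by
  ext n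
  rw [mul_sub, mul_one, map_sub, coeff_mul_X_pow', coeff_mk, coeff_one]
  rcases Nat.eq_zero_or_pos n with rfl | hn
  · simp
  · rw [if_neg hn.ne']
    by_cases h : i + 1 ≤ n
    · simp only [if_pos h, coeff_mk, Nat.dvd_sub_iff_left h dvd_rfl, sub_self]
    · rw [if_neg h, if_neg (fun hd ↦ h (Nat.le_of_dvd hn hd)), sub_zero]

open scoped PowerSeries.WithPiTopology in
/-- The generating function of the partition numbers is inverse to the pentagonal series. -/
lemma mk_partitionFn_mul_pentagonalSeries :
    (PowerSeries.mk fun n ↦ (partitionFn n : ℤ)) * pentagonalSeries ℤ = 1 := by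
  let _ : TopologicalSpace ℤ := ⊥
  have : DiscreteTopology ℤ := ⟨rfl⟩
  have h := Nat.Partition.hasProd_genFun (R := ℤ) (fun _ _ ↦ 1)
  simp_rw [one_add_tsum_X_pow_mul] at h
  have h2 := h.mul (WithPiTopology.hasProd_one_sub_X_pow ℤ)
  simp_rw [mk_dvd_mul_one_sub_X_pow] at h2
  rw [← h2.unique hasProd_one]
  congr 1
  ext n
  simp [partitionFn, Finsupp.prod]

/-- The polynomial truncation of the pentagonal series. -/
noncomputable def pentagonalPoly (K : ℕ) : Polynomial ℤ :=
  ∑ k ∈ Finset.range K, (-1) ^ k *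
    (Polynomial.X ^ (k * (3 * k + 1) / 2) - Polynomial.X ^ ((k + 1) * (3 * k + 2) / 2))

lemma pentagonal_neg_natCast (k : ℕ) : pentagonal (-k) = k * (3 * k + 1) / 2 := by
  rw [pentagonal_neg]
  exact_mod_cast Int.toNat_natCast (k * (3 * k + 1) / 2)

lemma pentagonal_natCast_add_one (k : ℕ) : pentagonal (k + 1) = (k + 1) * (3 * k + 2) / 2 := by
  rw [pentagonal_def, show (3 * (k + 1 : ℤ) - 1) = 3 * k + 2 by ring]
  exact_mod_cast Int.toNat_natCast ((k + 1) * (3 * k + 2) / 2)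

open scoped PowerSeries.WithPiTopology in
lemma coeff_pentagonalPoly {K i : ℕ} (hi : i < K * (3 * K + 1) / 2) :
    (pentagonalPoly K).coeff i = coeff i (pentagonalSeries ℤ) := by
  let _ : TopologicalSpace ℤ := ⊥
  have : DiscreteTopology ℤ := ⟨rfl⟩
  have h := (WithPiTopology.hasSum_pow_pentagonal_sub_pentagonalSeries ℤ).map
    (coeff (R := ℤ) i) (WithPiTopology.continuous_coeff ℤ i)
  have h2 := hasSum_sum_of_ne_finset_zero (s := Finset.range K) (f := (coeff (R := ℤ) i) ∘
    fun k : ℕ ↦ (-1) ^ k * (X ^ pentagonal (-k) - X ^ pentagonal (k + 1)))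
    (L := SummationFilter.unconditional ℕ) ?_
  · rw [← h2.unique h, pentagonalPoly, Polynomial.finsetSum_coeff]
    refine Finset.sum_congr rfl fun k _ ↦ ?_
    rw [Function.comp_apply, pentagonal_neg_natCast, pentagonal_natCast_add_one]
    rw [← Polynomial.coeff_coe]
    simp
  · intro k hk
    rw [Finset.mem_range, not_lt] at hk
    have h1 : K * (3 * K + 1) / 2 ≤ k * (3 * k + 1) / 2 := by gcongr
    have h3 : k * (3 * k + 1) / 2 ≤ (k + 1) * (3 * k + 2) / 2 := by gcongr <;> omega
    rw [Function.comp_apply, pentagonal_neg_natCast, pentagonal_natCast_add_one, mul_sub, map_sub,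
      coeff_mul_X_pow', coeff_mul_X_pow', if_neg (by omega), if_neg (by omega), sub_zero]

lemma dvd_sum_partitionFn_mul_eval_sub_one {K N : ℕ} (hN : N ≤ K * (3 * K + 1) / 2) (b : ℤ) :
    b ^ N ∣ (∑ i ∈ Finset.range N, (partitionFn i : ℤ) * b ^ i) * (pentagonalPoly K).eval b - 1 := by
  have hX : (Polynomial.X : Polynomial ℤ) ^ N ∣
      trunc N (PowerSeries.mk fun n ↦ (partitionFn n : ℤ)) * pentagonalPoly K - 1 := by
    rw [Polynomial.X_pow_dvd_iff]
    intro d hd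
    rw [Polynomial.coeff_sub, sub_eq_zero, ← Polynomial.coeff_coe 1, Polynomial.coe_one,
      ← mk_partitionFn_mul_pentagonalSeries, coeff_mul, Polynomial.coeff_mul]
    refine Finset.sum_congr rfl fun x hx ↦ ?_
    have := Finset.HasAntidiagonal.mem_antidiagonal.1 hx
    rw [coeff_trunc, if_pos (by omega), coeff_pentagonalPoly (by omega)]
  have h := Polynomial.eval_dvd (x := b) hX
  rw [Polynomial.eval_sub, Polynomial.eval_mul, Polynomial.eval_pow, Polynomial.eval_X,
    Polynomial.eval_one] at h
  rw [← Polynomial.eval₂_id (p := trunc N _), eval₂_trunc_eq_sum_range] at h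
  simpa only [eq_intCast, Int.cast_id, coeff_mk] using h

end Recurrence

section Bound

set_option exponentiation.threshold 500 in
lemma partitionFn_lt_two_pow {n : ℕ} (hn : n < 10078) : partitionFn n < 2 ^ 400 := by
  have hn' : (n : ℝ) ≤ 10078 := by exact_mod_cast hn.le
  have hσ : (0 : ℝ) < 1 / 64 := by norm_num
  have hq : ‖Complex.exp (-((1 / 64 : ℝ) : ℂ))‖ < 1 := by
    rw [Complex.norm_exp]
    simp
  have h := norm_eulerInv_mul_exp_le hσ (by norm_num) n
  have hreal : Complex.exp (-((1 / 64 : ℝ) : ℂ)) = (Real.exp (-(1 / 64)) : ℂ) := by push_cast; rfl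
  have hle : (partitionFn n : ℝ) * Real.exp (-(1 / 64)) ^ n ≤
      ‖eulerInv (Complex.exp (-((1 / 64 : ℝ) : ℂ)))‖ := by
    have hs := (hasSum_partitionFn hq)
    have hr : HasSum (fun k ↦ (partitionFn k : ℝ) * Real.exp (-(1 / 64)) ^ k)
        (eulerInv (Complex.exp (-((1 / 64 : ℝ) : ℂ)))).re := by
      convert Complex.hasSum_re hs with k
      rw [hreal]
      exact_mod_cast (Complex.ofReal_re _).symm
    exact (le_hasSum hr n fun k _ ↦ by positivity).trans (Complex.re_le_norm _)
  have hexp : Real.exp (-(1 / 64)) ^ n * Real.exp (n * (1 / 64)) = 1 := by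
    rw [← Real.exp_nat_mul, ← Real.exp_add]
    simp
  have hp : (partitionFn n : ℝ) ≤ 3 / 2 * Real.exp 265 := by
    calc (partitionFn n : ℝ) = partitionFn n * (Real.exp (-(1 / 64)) ^ n * Real.exp (n * (1 / 64))) := by
          rw [hexp, mul_one]
      _ = (partitionFn n * Real.exp (-(1 / 64)) ^ n) * Real.exp (n * (1 / 64)) := by ring
      _ ≤ _ := mul_le_mul_of_nonneg_right hle (Real.exp_pos _).le
      _ ≤ _ := h
      _ ≤ _ := by
        gcongr
        rw [show hrBeta ^ 2 / (4 * (1 / 64)) = 16 * hrBeta ^ 2 by ring]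
        linarith [hrBeta_sq_bounds.2]
  have he : Real.exp 265 ≤ 2.72 ^ 265 := by
    rw [show (265 : ℝ) = (265 : ℕ) * 1 by norm_num, Real.exp_nat_mul]
    gcongr
    linarith [Real.exp_one_lt_d9]
  have : (partitionFn n : ℝ) < 2 ^ 400 := by
    refine hp.trans_lt ((mul_le_mul_of_nonneg_left he (by norm_num)).trans_lt ?_)
    norm_num
  exact_mod_cast this

end Bound

section KernelComputation

/-- `f x`, in a form where kernel reduction evaluates `x` to a literal before unfolding `f`. -/
def forceEval (x : ℕ) (f : ℕ → Bool) : Bool := Nat.rec (f 0) (fun n _ ↦ f (n + 1)) x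

lemma forceEval_eq (x : ℕ) (f : ℕ → Bool) : forceEval x f = f x := by cases x <;> rfl

/-- Positivity of the Toeplitz determinant of the successive differences of `p₀, …, p₅`. -/
def toeplitzCheck (p₀ p₁ p₂ p₃ p₄ p₅ : ℕ) : Bool :=
  p₀.ble p₁ && p₁.ble p₂ && p₂.ble p₃ && p₃.ble p₄ && p₄.ble p₅ &&
  forceEval (p₁ - p₀) fun a ↦ forceEval (p₂ - p₁) fun b ↦ forceEval (p₃ - p₂) fun c ↦
  forceEval (p₄ - p₃) fun d ↦ forceEval (p₅ - p₄) fun e ↦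
    Nat.blt (a * c * e + 2 * (b * c * d)) (c * c * c + b * b * e + a * (d * d))

/-- The digit of `x` with index `i` in base `2 ^ 400`. -/
def digit400 (x i : ℕ) : ℕ := x / 2 ^ (400 * i) % 2 ^ 400

/-- `toeplitzCheck` for the first six digits of `x`. -/
def digitsCheck (x : ℕ) : Bool :=
  forceEval (digit400 x 0) fun p₀ ↦ forceEval (digit400 x 1) fun p₁ ↦
  forceEval (digit400 x 2) fun p₂ ↦ forceEval (digit400 x 3) fun p₃ ↦
  forceEval (digit400 x 4) fun p₄ ↦ forceEval (digit400 x 5) fun p₅ ↦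
    toeplitzCheck p₀ p₁ p₂ p₃ p₄ p₅

/-- `toeplitzCheck` for the first `k` windows of six digits of `x`. -/
def linearCheck (k : ℕ) : ℕ → Bool :=
  Nat.rec (fun _ ↦ true) (fun _ ih x ↦ digitsCheck x && forceEval (x / 2 ^ 400) ih) k

/-- `toeplitzCheck` for the first `38 * 2 ^ d` windows of six digits of `x`, by bisection. -/
def bisectCheck (d : ℕ) : ℕ → Bool :=
  Nat.rec (linearCheck 38) (fun d ih x ↦
    forceEval (x % 2 ^ (400 * (38 * 2 ^ d + 5))) ih &&
      forceEval (x / 2 ^ (400 * (38 * 2 ^ d))) ih) d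

/-- The sum of the positive terms of `(pentagonalPoly K).eval (2 ^ 400)`. -/
def pentagonalPos (K : ℕ) : ℕ :=
  Nat.rec 0 (fun k ih ↦ ih + 2 ^ (400 * (if k % 2 = 0 then k * (3 * k + 1) / 2 else
    (k + 1) * (3 * k + 2) / 2))) K

/-- The sum of the negated negative terms of `(pentagonalPoly K).eval (2 ^ 400)`. -/
def pentagonalNeg (K : ℕ) : ℕ :=
  Nat.rec 0 (fun k ih ↦ ih + 2 ^ (400 * (if k % 2 = 0 then (k + 1) * (3 * k + 2) / 2 else
    k * (3 * k + 1) / 2))) K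

/-- Pass to `f` the result of `k` Newton steps for the inverse of `E` modulo powers of two. -/
def newtonInverse (E k : ℕ) : ℕ → (ℕ → Bool) → Bool :=
  Nat.rec (fun x f ↦ f x) (fun k ih x f ↦
    forceEval (2 ^ (400 * (10078 / 2 ^ k + 1))) fun m ↦
    forceEval (x * (E % m) % m) fun y ↦ forceEval (x * (m + 2 - y) % m) fun z ↦ ih z f) k

/-- Computation of the partition numbers below `10078` as the digits of an inverse of the
pentagonal series, followed by `toeplitzCheck` for all of them from `345` on. -/
def partitionCheck : Bool :=
  forceEval (pentagonalPos 82) fun P ↦ forceEval (pentagonalNeg 82) fun N ↦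
  newtonInverse (P - N) 14 1 fun x ↦ forceEval (x % 2 ^ (400 * 10078)) fun x ↦
    Nat.beq (x * P % 2 ^ (400 * 10078)) ((x * N + 1) % 2 ^ (400 * 10078)) &&
      forceEval (x / 2 ^ (400 * 345)) (bisectCheck 8)

lemma partitionCheck_eq_true : partitionCheck = true := by decide +kernel

lemma toeplitz_pos_of_toeplitzCheck {p₀ p₁ p₂ p₃ p₄ p₅ : ℕ}
    (h : toeplitzCheck p₀ p₁ p₂ p₃ p₄ p₅ = true) :
    0 < ((p₃ : ℤ) - p₂) ^ 3 + ((p₂ : ℤ) - p₁) ^ 2 * (p₅ - p₄) + (p₁ - p₀) * (p₄ - p₃) ^ 2 -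
      (p₁ - p₀) * (p₃ - p₂) * (p₅ - p₄) - 2 * (p₂ - p₁) * (p₃ - p₂) * (p₄ - p₃) := by
  simp only [toeplitzCheck, forceEval_eq, Bool.and_eq_true, Nat.ble_eq, Nat.blt_eq] at h
  obtain ⟨⟨⟨⟨⟨h0, h1⟩, h2⟩, h3⟩, h4⟩, h5⟩ := h
  zify [h0, h1, h2, h3, h4] at h5
  linarith

/-- The window of six digits of `x` starting with index `j` satisfies `toeplitzCheck`. -/
def WindowCheck (x j : ℕ) : Prop :=
  toeplitzCheck (digit400 x j) (digit400 x (j + 1)) (digit400 x (j + 2)) (digit400 x (j + 3))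
    (digit400 x (j + 4)) (digit400 x (j + 5)) = true

lemma digit400_div (x k i : ℕ) : digit400 (x / 2 ^ (400 * k)) i = digit400 x (k + i) := by
  rw [digit400, digit400, Nat.div_div_eq_div_mul, ← pow_add, mul_add]

lemma digit400_mod {x k i : ℕ} (h : i < k) : digit400 (x % 2 ^ (400 * k)) i = digit400 x i := by
  rw [digit400, digit400, show 400 * k = 400 * i + 400 * (k - i) by omega, pow_add,
    Nat.mod_mul_right_div_self, Nat.mod_mod_of_dvd _ (pow_dvd_pow 2 (by omega))]

lemma windowCheck_div {x k j : ℕ} : WindowCheck (x / 2 ^ (400 * k)) j ↔ WindowCheck x (k + j) := by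
  simp only [WindowCheck, digit400_div, add_assoc]

lemma windowCheck_mod {x k j : ℕ} (h : j + 5 < k) :
    WindowCheck (x % 2 ^ (400 * k)) j ↔ WindowCheck x j := by
  simp only [WindowCheck]
  rw [digit400_mod, digit400_mod, digit400_mod, digit400_mod, digit400_mod, digit400_mod] <;> omega

lemma windowCheck_zero_of_digitsCheck {x : ℕ} (h : digitsCheck x = true) : WindowCheck x 0 := by
  simpa only [WindowCheck, digitsCheck, forceEval_eq, zero_add] using h

set_option exponentiation.threshold 500 in
lemma windowCheck_of_linearCheck {k x j : ℕ} (h : linearCheck k x = true) (hj : j < k) :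
    WindowCheck x j := by
  induction k generalizing x j with
  | zero => omega
  | succ k ih =>
    have h' : (digitsCheck x && forceEval (x / 2 ^ 400) (linearCheck k)) = true := h
    rw [forceEval_eq, Bool.and_eq_true] at h'
    rcases j with _ | j
    · exact windowCheck_zero_of_digitsCheck h'.1
    · have := ih (x := x / 2 ^ (400 * 1)) h'.2 (j := j) (by omega)
      rwa [windowCheck_div, add_comm] at this

lemma windowCheck_of_bisectCheck {d x j : ℕ} (h : bisectCheck d x = true) (hj : j < 38 * 2 ^ d) :
    WindowCheck x j := by
  induction d generalizing x j with
  | zero => exact windowCheck_of_linearCheck (show linearCheck 38 x = true from h) (by simpa using hj)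
  | succ d ih =>
    have h' : (forceEval (x % 2 ^ (400 * (38 * 2 ^ d + 5))) (bisectCheck d) &&
      forceEval (x / 2 ^ (400 * (38 * 2 ^ d))) (bisectCheck d)) = true := h
    rw [forceEval_eq, forceEval_eq, Bool.and_eq_true] at h'
    rcases lt_or_ge j (38 * 2 ^ d) with hlt | hge
    · have := ih h'.1 hlt
      rwa [windowCheck_mod (by omega)] at this
    · have := ih (j := j - 38 * 2 ^ d) h'.2 (by rw [pow_succ] at hj; omega)
      rwa [windowCheck_div, Nat.add_sub_cancel' hge] at this

set_option exponentiation.threshold 500 in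
lemma exists_of_newtonInverse {E k x : ℕ} {f : ℕ → Bool} (h : newtonInverse E k x f = true) :
    ∃ y, f y = true := by
  induction k generalizing x with
  | zero => exact ⟨x, h⟩
  | succ k ih =>
    have h' : (forceEval (2 ^ (400 * (10078 / 2 ^ k + 1))) fun m ↦
      forceEval (x * (E % m) % m) fun y ↦ forceEval (x * (m + 2 - y) % m) fun z ↦
        newtonInverse E k z f) = true := h
    rw [forceEval_eq, forceEval_eq, forceEval_eq] at h'
    exact ih h'

set_option exponentiation.threshold 500 in
lemma eval_pentagonalPoly (K : ℕ) :
    (pentagonalPoly K).eval (2 ^ 400 : ℤ) = pentagonalPos K - pentagonalNeg K := by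
  induction K with
  | zero => simp [pentagonalPoly, pentagonalPos, pentagonalNeg]
  | succ k ih =>
    have hP : pentagonalPos (k + 1) = pentagonalPos k + 2 ^ (400 * (if k % 2 = 0 then
      k * (3 * k + 1) / 2 else (k + 1) * (3 * k + 2) / 2)) := rfl
    have hN : pentagonalNeg (k + 1) = pentagonalNeg k + 2 ^ (400 * (if k % 2 = 0 then
      (k + 1) * (3 * k + 2) / 2 else k * (3 * k + 1) / 2)) := rfl
    rw [pentagonalPoly, Finset.sum_range_succ, ← pentagonalPoly, Polynomial.eval_add, ih, hP, hN]
    generalize k * (3 * k + 1) / 2 = a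
    generalize (k + 1) * (3 * k + 2) / 2 = b
    rcases Nat.even_or_odd k with hk | hk
    · rw [if_pos (Nat.even_iff.1 hk), if_pos (Nat.even_iff.1 hk), hk.neg_one_pow, pow_mul, pow_mul]
      simp only [Polynomial.eval_mul, Polynomial.eval_sub, Polynomial.eval_pow, Polynomial.eval_X,
        Polynomial.eval_one, Nat.cast_add, Nat.cast_pow, Nat.cast_ofNat]
      ring
    · have hk' : k % 2 ≠ 0 := by rw [Nat.odd_iff.1 hk]; simp
      rw [if_neg hk', if_neg hk', hk.neg_one_pow, pow_mul, pow_mul]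
      simp only [Polynomial.eval_mul, Polynomial.eval_sub, Polynomial.eval_pow, Polynomial.eval_X,
        Polynomial.eval_neg, Polynomial.eval_one, Nat.cast_add, Nat.cast_pow, Nat.cast_ofNat]
      ring

lemma sum_range_mul_pow_lt {p : ℕ → ℕ} {b N : ℕ} (hp : ∀ i < N, p i < b) :
    ∑ i ∈ Finset.range N, p i * b ^ i < b ^ N := by
  induction N with
  | zero => simp
  | succ N ih =>
    rw [Finset.sum_range_succ, pow_succ]
    have h1 := ih fun i hi ↦ hp i (by omega)
    have h2 := Nat.mul_le_mul_right (b ^ N) (Nat.succ_le_of_lt (hp N (by omega)))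
    rw [Nat.succ_mul] at h2
    linarith

set_option exponentiation.threshold 500 in
lemma digit400_sum {p : ℕ → ℕ} {N i : ℕ} (hp : ∀ i < N, p i < 2 ^ 400) (hi : i < N) :
    digit400 (∑ i ∈ Finset.range N, p i * (2 ^ 400) ^ i) i = p i := by
  obtain ⟨M, rfl⟩ := Nat.exists_eq_add_of_lt hi
  have h1 := sum_range_mul_pow_lt (p := p) (b := 2 ^ 400) (N := i) fun j hj ↦ hp j (by omega)
  have h2 : ∑ j ∈ Finset.range (i + M + 1), p j * (2 ^ 400) ^ j =
      (2 ^ 400) ^ i * (p i + 2 ^ 400 * ∑ j ∈ Finset.range M, p (i + 1 + j) * (2 ^ 400) ^ j) +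
        ∑ j ∈ Finset.range i, p j * (2 ^ 400) ^ j := by
    rw [show i + M + 1 = i + 1 + M by ring, Finset.sum_range_add, Finset.sum_range_succ, mul_add,
      ← mul_assoc, ← pow_succ, Finset.mul_sum]
    have : ∀ j, p (i + 1 + j) * (2 ^ 400) ^ (i + 1 + j) =
        (2 ^ 400) ^ (i + 1) * (p (i + 1 + j) * (2 ^ 400) ^ j) := fun j ↦ by
      rw [pow_add (2 ^ 400) (i + 1)]; ring
    rw [Finset.sum_congr rfl fun j _ ↦ this j]
    ring
  rw [digit400, pow_mul, h2, Nat.mul_add_div (by positivity), Nat.div_eq_of_lt h1, add_zero,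
    Nat.add_mul_mod_self_left, Nat.mod_eq_of_lt (hp i hi)]

lemma eq_of_mul_mod_eq_mul_add_one_mod {x y P N m : ℕ} (hx : x < m) (hy : y < m)
    (h1 : x * P % m = (x * N + 1) % m) (h2 : (m : ℤ) ∣ y * (P - N) - 1) : x = y := by
  have h3 := Nat.ModEq.dvd (n := m) h1.symm
  push_cast at h3
  have h4 : (m : ℤ) ∣ x - y := by
    rw [show (x : ℤ) - y = y * (x * P - (x * N + 1)) - x * (y * (P - N) - 1) by ring]
    exact dvd_sub (h3.mul_left _) (h2.mul_left _)
  rw [← Nat.modEq_iff_dvd] at h4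
  exact (h4.eq_of_lt_of_lt hy hx).symm

set_option exponentiation.threshold 500 in
lemma windowCheck_partitionFn {j : ℕ} (hj : j < 9728) :
    WindowCheck (∑ i ∈ Finset.range 10078, partitionFn i * (2 ^ 400) ^ i) (345 + j) := by
  have h := partitionCheck_eq_true
  rw [partitionCheck, forceEval_eq, forceEval_eq] at h
  obtain ⟨x, hx⟩ := exists_of_newtonInverse h
  rw [forceEval_eq, forceEval_eq, Bool.and_eq_true] at hx
  obtain ⟨h1, h2⟩ := hx
  have h3 : x % 2 ^ (400 * 10078) =
      ∑ i ∈ Finset.range 10078, partitionFn i * (2 ^ 400) ^ i := by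
    refine eq_of_mul_mod_eq_mul_add_one_mod (P := pentagonalPos 82) (N := pentagonalNeg 82)
      (m := 2 ^ (400 * 10078)) (Nat.mod_lt _ (Nat.two_pow_pos _)) ?_ (Nat.eq_of_beq_eq_true h1) ?_
    · rw [pow_mul]
      exact sum_range_mul_pow_lt fun i hi ↦ partitionFn_lt_two_pow hi
    · have h4 := dvd_sum_partitionFn_mul_eval_sub_one (K := 82) (N := 10078) (by norm_num) (2 ^ 400)
      rw [eval_pentagonalPoly, ← pow_mul] at h4
      simpa only [Nat.cast_pow, Nat.cast_ofNat, Nat.cast_sum, Nat.cast_mul] using h4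
  rw [← h3, ← windowCheck_div]
  exact windowCheck_of_bisectCheck h2 hj

lemma toeplitz_dP_pos_of_lt {n : ℕ} (hn : 345 ≤ n) (hn' : n < 10073) :
    0 < dP (n + 2) ^ 3 + dP (n + 1) ^ 2 * dP (n + 4) + dP n * dP (n + 3) ^ 2 -
      dP n * dP (n + 2) * dP (n + 4) - 2 * dP (n + 1) * dP (n + 2) * dP (n + 3) := by
  have h := windowCheck_partitionFn (j := n - 345) (by omega)
  rw [Nat.add_sub_cancel' hn, WindowCheck] at h
  have hd : ∀ i < 10078, digit400 (∑ i ∈ Finset.range 10078, partitionFn i * (2 ^ 400) ^ i) i =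
      partitionFn i := fun i hi ↦ digit400_sum (fun _ hj ↦ partitionFn_lt_two_pow hj) hi
  rw [hd n (by omega), hd (n + 1) (by omega), hd (n + 2) (by omega), hd (n + 3) (by omega),
    hd (n + 4) (by omega), hd (n + 5) (by omega)] at h
  exact toeplitz_pos_of_toeplitzCheck h

end KernelComputation

theorem det3_dP (n : ℕ) (hn : 345 ≤ n) :
    (Matrix.det !![dP (n + 2), dP (n + 3), dP (n + 4);
                   dP (n + 1), dP (n + 2), dP (n + 3);
                   dP n,       dP (n + 1), dP (n + 2)]) > 0 := by
  have h : 0 < dP (n + 2) ^ 3 + dP (n + 1) ^ 2 * dP (n + 4) + dP n * dP (n + 3) ^ 2 -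
      dP n * dP (n + 2) * dP (n + 4) - 2 * dP (n + 1) * dP (n + 2) * dP (n + 3) := by
    rcases lt_or_ge n 10073 with h | h
    · exact toeplitz_dP_pos_of_lt hn h
    · exact toeplitz_dP_pos (by omega)
  rw [Matrix.det_fin_three]
  simp only [Matrix.of_apply, Matrix.cons_val]
  linarith
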